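/- Let T be a self-adjoint operator in a complex Hilbert space H with domain D(T) whose essential spectrum is contained in pairwise disjoint intervals Δ_k = [α_{2k−1}, α_{2k}], k ∈ ℤ, whose gaps Λ_k = (α_{2k}, α_{2k+1}) satisfy α_{2k+1} − α_{2k} ≥ 2^{1−p}·b₁·|α_{2k+1} + α_{2k}|^p for some b₁ > 0 and p ∈ [0,1); outside the intervals Δ_k the operator T has only discrete spectrum, and each gap Λ_k contains at most m eigenvalues of T counted with multiplicity, where m ∈ ℕ does not depend on k. Let B be a linear operator defined on D(T) that is p-subordinate to T with subordination bound b', assume b₁ > b', fix h > b' and δ ∈ (0, b₁ − b'), and set r_k = (α_{2k} + α_{2k+1})/2. Then there exist N ∈ ℕ and real numbers r'_k with |r'_k − r_k| ≤ δ|r_k|^p such that: the boundaries of the curvilinear trapezoids Π_k bounded by the vertical lines Re λ = r'_{k−1}, Re λ = r'_k and by the boundary of the parabola P_{p,h} contain no points of the spectrum of A = T + B; and the Riesz projections Q_k = −(1/2πi)∮_{∂Π_k} (A − λ)^{−1} dλ, |k| ≥ N, together with the Riesz projection Q_0 corresponding to the part of the spectrum of A not contained in the trapezoids Π_k with |k|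 ≥ N, are such that the subspaces Q_k(H), |k| ≥ N, together with Q_0(H), form an unconditional basis of subspaces of H. -/

import Mathlib

noncomputable section

variable {H : Type*} [NormedAddCommGroup H] [InnerProductSpace ℂ H] [CompleteSpace H]

/-- `R` is a two-sided bounded inverse of `T - z` (so `z` is in the resolvent set of `T`). -/
def IsResolventOf (T : H →ₗ.[ℂ] H) (z : ℂ) (R : H →L[ℂ] H) : Prop :=
  (∀ x : T.domain, R (T x - z • (x : H)) = (x : H)) ∧
  (∀ y : H, ∃ hy : R y ∈ T.domain, T ⟨R y, hy⟩ - z • (R y) = y)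

/-- The resolvent set of the (in general unbounded) operator `T`. -/
def pmResolventSet (T : H →ₗ.[ℂ] H) : Set ℂ := {z | ∃ R, IsResolventOf T z R}

/-- The spectrum of the (in general unbounded) operator `T`. -/
def pmSpectrum (T : H →ₗ.[ℂ] H) : Set ℂ := (pmResolventSet T)ᶜ

/-- The set of constants `b` for which `B` is `p`-subordinate to `T` with some admissible
constant `M ≥ 0` (with `M = 0` required when `p = 0`); the subordination bound `b'` is the
infimum of this set. -/
def SubordSet (T B : H →ₗ.[ℂ] H) (hle : T.domain ≤ B.domain) (p : ℝ) : Set ℝ :=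
  {b | 0 < b ∧ ∃ M : ℝ, 0 ≤ M ∧ (p = 0 → M = 0) ∧
    ∀ x : T.domain, ‖B ⟨(x : H), hle x.2⟩‖ ≤ b * ‖T x‖ ^ p * ‖(x : H)‖ ^ (1 - p) + M * ‖(x : H)‖}

/-- The operator sum `A = T + B` defined on the domain of `T`. -/
def pmSum (T B : H →ₗ.[ℂ] H) (hle : T.domain ≤ B.domain) : H →ₗ.[ℂ] H :=
  ⟨T.domain, T.toFun + B.toFun.comp (Submodule.inclusion hle)⟩

/-- The eigenspace of the unbounded operator `T` for the eigenvalue `z`. -/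
def pmEigenspace (T : H →ₗ.[ℂ] H) (z : ℂ) : Submodule ℂ H :=
  (LinearMap.ker (T.toFun - z • T.domain.subtype)).map T.domain.subtype

/-- `A - z` restricts to a bijection (with bounded inverse `R` preserving `V`) of the part
of `A` in the `A`-invariant subspace `V`. -/
def MapsResolvently (A : H →ₗ.[ℂ] H) (V : Submodule ℂ H) (z : ℂ) : Prop :=
  ∃ R : H →L[ℂ] H, (∀ y ∈ V, R y ∈ V) ∧
    (∀ x : A.domain, (x : H) ∈ V → R (A x - z • (x : H)) = (x : H)) ∧
    (∀ y ∈ V, ∃ hy : R y ∈ A.domain, A ⟨R y, hy⟩ - z • (R y) = y)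

/-- `Q` is the Riesz projection of `A` associated with the part of the spectrum of `A` in `U`:
`Q` is a bounded projection commuting with `A` such that the spectrum of the part of `A` in the
invariant subspace `ran Q` lies in `U` and the spectrum of the part of `A` in `ker Q` lies
outside `U`.  (This characterizes the contour-integral Riesz projection
`Q = −(2πi)⁻¹ ∮_{∂U} (A−λ)⁻¹ dλ`.) -/
def IsRieszProjFor (A : H →ₗ.[ℂ] H) (U : Set ℂ) (Q : H →L[ℂ] H) : Prop :=
  Q.comp Q = Q ∧
  (∀ x : A.domain, ∃ hQx : Q (x : H) ∈ A.domain, A ⟨Q (x : H), hQx⟩ = Q (A x)) ∧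
  (∀ z ∉ U, MapsResolvently A (LinearMap.range (Q : H →ₗ[ℂ] H)) z) ∧
  (∀ z ∈ U, MapsResolvently A (LinearMap.ker (Q : H →ₗ[ℂ] H)) z)

/-- The curvilinear trapezoid bounded by the vertical lines `Re λ = r' (k−1)`, `Re λ = r' k`
and the boundary of the double parabola `P_{p,h} = {|Im λ| < h |Re λ|^p}`. -/
def Trapezoid (h p : ℝ) (r' : ℤ → ℝ) (k : ℤ) : Set ℂ :=
  {z : ℂ | r' (k - 1) ≤ z.re ∧ z.re ≤ r' k ∧ |z.im| ≤ h * |z.re| ^ p}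

namespace PM
open Filter Topology

open Classical in
/-- The resolvent `(A - z)⁻¹` (zero if `z` is in the spectrum). -/
def res (A : H →ₗ.[ℂ] H) (z : ℂ) : H →L[ℂ] H :=
  if h : ∃ R, IsResolventOf A z R then h.choose else 0

open Classical in
/-- A choice of the resolvent of the part of `A` in `V`. -/
def resPart (A : H →ₗ.[ℂ] H) (V : Submodule ℂ H) (z : ℂ) : H →L[ℂ] H :=
  if h : MapsResolvently A V z then h.choose else 0

section basic
variable {A : H →ₗ.[ℂ] H} {z w : ℂ}

theorem res_spec (hz : z ∈ pmResolventSet A) : IsResolventOf A z (res A z) := by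
  have h : ∃ R, IsResolventOf A z R := hz
  unfold res
  rw [dif_pos h]
  exact h.choose_spec

theorem res_mem (hz : z ∈ pmResolventSet A) (y : H) : res A z y ∈ A.domain :=
  ((res_spec hz).2 y).1

theorem apply_res (hz : z ∈ pmResolventSet A) (y : H) (h : res A z y ∈ A.domain) :
    A ⟨res A z y, h⟩ = y + z • res A z y := by
  obtain ⟨h1, h2⟩ := (res_spec hz).2 y
  exact sub_eq_iff_eq_add.mp h2

theorem res_apply_sub (hz : z ∈ pmResolventSet A) (x : A.domain) :
    res A z (A x - z • (x : H)) = x := (res_spec hz).1 x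

theorem eq_res (hz : z ∈ pmResolventSet A) {x y : H} (hx : x ∈ A.domain)
    (h : A ⟨x, hx⟩ - z • x = y) : res A z y = x := by
  rw [← h]; exact res_apply_sub hz ⟨x, hx⟩

theorem res_identity (hz : z ∈ pmResolventSet A) (hw : w ∈ pmResolventSet A) (y : H) :
    res A z y - res A w y = (z - w) • res A z (res A w y) := by
  have h := eq_res (y := y - (z - w) • res A w y) hz (res_mem hw y) (by
    rw [apply_res hw y]; module)
  rw [map_sub, map_smul] at h
  rw [← sub_eq_zero, ← sub_eq_zero.mpr h]; abel

theorem res_comm (hz : z ∈ pmResolventSet A) (hw : w ∈ pmResolventSet A) (y : H) :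
    res A z (res A w y) = res A w (res A z y) := by
  by_cases h : z = w
  · rw [h]
  · have h1 := res_identity hz hw y
    have h2 := res_identity hw hz y
    have h3 : (z - w) • (res A z (res A w y) - res A w (res A z y)) = 0 := by
      rw [smul_sub, ← h1, ← neg_sub w z, neg_smul, ← h2]; abel
    exact sub_eq_zero.mp ((smul_eq_zero.mp h3).resolve_left (sub_ne_zero.mpr h))

theorem eq_res_of_isResolventOf {R : H →L[ℂ] H} (h : IsResolventOf A z R) : res A z = R := by
  have hz : z ∈ pmResolventSet A := ⟨R, h⟩
  ext y
  obtain ⟨h1, h2⟩ := h.2 y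
  exact eq_res hz h1 h2

theorem resPart_spec {V : Submodule ℂ H} (h : MapsResolvently A V z) :
    (∀ y ∈ V, resPart A V z y ∈ V) ∧
    (∀ x : A.domain, (x : H) ∈ V → resPart A V z (A x - z • (x : H)) = (x : H)) ∧
    (∀ y ∈ V, ∃ hy : resPart A V z y ∈ A.domain,
      A ⟨resPart A V z y, hy⟩ - z • (resPart A V z y) = y) := by
  unfold resPart
  rw [dif_pos h]
  exact h.choose_spec

theorem part_near {V : Submodule ℂ H} (P : H →L[ℂ] H) (hP : ∀ y, P y ∈ V)
    (hP' : ∀ y ∈ V, P y = y) (hAV : ∀ x : A.domain, (x : H) ∈ V → A x ∈ V)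
    {z₀ : ℂ} (h : MapsResolvently A V z₀) :
    ∃ S : ℂ → H →L[ℂ] H, ∀ᶠ z in 𝓝 z₀, DifferentiableAt ℂ S z ∧ (∀ y, S z y ∈ V) ∧
    (∀ x : A.domain, (x : H) ∈ V → S z (A x - z • (x : H)) = (x : H)) ∧
    (∀ y ∈ V, ∃ hy : S z y ∈ A.domain, A ⟨S z y, hy⟩ - z • (S z y) = y) := by
  obtain ⟨R₀, h1, h2, h3⟩ := h
  set Rq : H →L[ℂ] H := R₀ * P with hRq
  refine ⟨fun z => Rq * Ring.inverse (1 - (z - z₀) • Rq), ?_⟩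
  have hev : ∀ᶠ z in 𝓝 z₀, ‖(z - z₀) • Rq‖ < 1 := by
    have : Tendsto (fun z : ℂ => ‖(z - z₀) • Rq‖) (𝓝 z₀) (𝓝 ‖(z₀ - z₀) • Rq‖) := by
      apply Continuous.tendsto
      fun_prop
    apply this.eventually_lt_const
    simp
  filter_upwards [hev] with z hz
  set u := Units.oneSub _ hz with hu
  have hu1 : (u : H →L[ℂ] H) = 1 - (z - z₀) • Rq := rfl
  set J : H →L[ℂ] H := Ring.inverse (1 - (z - z₀) • Rq) with hJ
  have hJu : J = ↑u⁻¹ := by rw [hJ, ← hu1, Ring.inverse_unit]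
  have hJ1 : (1 - (z - z₀) • Rq) * J = 1 := by rw [hJu, ← hu1]; simp
  have hJ2 : J * (1 - (z - z₀) • Rq) = 1 := by rw [hJu, ← hu1]; simp
  have e1 : ∀ y, J y = y + (z - z₀) • Rq (J y) := by
    intro y
    have := congrArg (fun f : H →L[ℂ] H => f y) hJ1
    simp only [ContinuousLinearMap.mul_apply, ContinuousLinearMap.sub_apply,
      ContinuousLinearMap.one_apply, ContinuousLinearMap.smul_apply] at this
    rw [← sub_eq_iff_eq_add]; exact this
  have e2 : ∀ y, J y - (z - z₀) • J (Rq y) = y := by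
    intro y
    have := congrArg (fun f : H →L[ℂ] H => f y) hJ2
    simpa using this
  have hc : ∀ y, Rq (J y) = J (Rq y) := by
    intro y
    have h5 : Rq * (1 - (z - z₀) • Rq) = (1 - (z - z₀) • Rq) * Rq := by
      simp [mul_sub, sub_mul]
    have h4 : Rq * J = J * Rq := by
      calc Rq * J = (J * (1 - (z - z₀) • Rq)) * (Rq * J) := by rw [hJ2, one_mul]
        _ = J * ((1 - (z - z₀) • Rq) * Rq) * J := by simp only [mul_assoc]
        _ = J * (Rq * (1 - (z - z₀) • Rq)) * J := by rw [h5]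
        _ = J * Rq * ((1 - (z - z₀) • Rq) * J) := by simp only [mul_assoc]
        _ = _ := by rw [hJ1, mul_one]
    exact congrArg (fun f : H →L[ℂ] H => f y) h4
  have hV : ∀ y, Rq y ∈ V := fun y => h1 _ (hP y)
  refine ⟨?_, fun y => hV _, ?_, ?_⟩
  · apply DifferentiableAt.const_mul
    have hd : DifferentiableAt ℂ (Ring.inverse : (H →L[ℂ] H) → _) (1 - (z - z₀) • Rq) := by
      rw [← hu1]; exact differentiableAt_inverse (𝕜 := ℂ) u.isUnit
    exact hd.comp z (f := fun z => 1 - (z - z₀) • Rq) (by fun_prop)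
  · intro x hx
    have hy : A x - z • (x : H) ∈ V := V.sub_mem (hAV x hx) (V.smul_mem _ hx)
    set y := A x - z • (x : H) with hydef
    have : Rq (y + (z - z₀) • (x : H)) = x := by
      rw [hRq, ContinuousLinearMap.mul_apply, hP' _ (V.add_mem hy (V.smul_mem _ hx))]
      rw [← h2 x hx]; congr 1; rw [hydef, h2 x hx]; module
    rw [ContinuousLinearMap.mul_apply, hc]
    have h6 : Rq y = x - (z - z₀) • Rq x := by
      rw [map_add, map_smul] at this
      rw [eq_sub_iff_add_eq]; exact this
    rw [h6, map_sub, map_smul]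
    exact e2 _
  · intro y hy
    have hw : J y ∈ V := by rw [e1]; exact V.add_mem hy (V.smul_mem _ (hV _))
    obtain ⟨hd, he⟩ := h3 _ hw
    have : (Rq * J) y = R₀ (J y) := by
      rw [ContinuousLinearMap.mul_apply, hRq, ContinuousLinearMap.mul_apply, hP' _ hw]
    have hd' : (Rq * J) y ∈ A.domain := by rw [this]; exact hd
    refine ⟨hd', ?_⟩
    have h7 : A ⟨(Rq * J) y, hd'⟩ = A ⟨R₀ (J y), hd⟩ := by congr 1; ext; exact this
    rw [h7, this]
    have h8 := e1 y
    have h9 : Rq (J y) = R₀ (J y) := this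
    rw [h9] at h8
    have h10 : A ⟨R₀ (J y), hd⟩ = J y + z₀ • R₀ (J y) := by rw [← sub_eq_iff_eq_add]; exact he
    rw [h10]
    nth_rewrite 1 [h8]
    module

theorem mapsResolvently_top (hz : z ∈ pmResolventSet A) : MapsResolvently A ⊤ z :=
  ⟨res A z, fun _ _ => trivial, fun x _ => res_apply_sub hz x, fun y _ => (res_spec hz).2 y⟩

theorem eventually_res (hz : z ∈ pmResolventSet A) : ∃ S : ℂ → H →L[ℂ] H, ∀ᶠ w in 𝓝 z,
    DifferentiableAt ℂ S w ∧ IsResolventOf A w (S w) := by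
  obtain ⟨S, hS⟩ := part_near (A := A) (V := ⊤) 1 (fun _ => trivial) (fun _ _ => rfl)
    (fun _ _ => trivial) (mapsResolvently_top hz)
  refine ⟨S, hS.mono ?_⟩
  rintro w ⟨h1, h2, h3, h4⟩
  exact ⟨h1, fun x => h3 x trivial, fun y => h4 y trivial⟩

theorem isOpen_rho (A : H →ₗ.[ℂ] H) : IsOpen (pmResolventSet A) := by
  rw [isOpen_iff_mem_nhds]
  intro z hz
  obtain ⟨S, hS⟩ := eventually_res hz
  exact hS.mono fun w hw => ⟨_, hw.2⟩

theorem differentiableAt_res (hz : z ∈ pmResolventSet A) : DifferentiableAt ℂ (res A) z := by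
  obtain ⟨S, hS⟩ := eventually_res hz
  have : res A =ᶠ[𝓝 z] S := hS.mono fun w hw => eq_res_of_isResolventOf hw.2
  exact this.differentiableAt_iff.mpr hS.self_of_nhds.1

theorem continuousOn_res (A : H →ₗ.[ℂ] H) : ContinuousOn (res A) (pmResolventSet A) :=
  fun _ hz => (differentiableAt_res hz).continuousAt.continuousWithinAt

theorem differentiableAt_resPart {V : Submodule ℂ H} (P : H →L[ℂ] H) (hP : ∀ y, P y ∈ V)
    (hP' : ∀ y ∈ V, P y = y) (hAV : ∀ x : A.domain, (x : H) ∈ V → A x ∈ V)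
    {z₀ : ℂ} (h : ∀ᶠ z in 𝓝 z₀, MapsResolvently A V z) {v : H} (hv : v ∈ V) :
    DifferentiableAt ℂ (fun z => resPart A V z v) z₀ := by
  obtain ⟨S, hS⟩ := part_near P hP hP' hAV h.self_of_nhds
  have : (fun z => resPart A V z v) =ᶠ[𝓝 z₀] fun z => S z v := by
    filter_upwards [hS, h] with z h1 h2
    obtain ⟨hd, he⟩ := h1.2.2.2 v hv
    have := (resPart_spec h2).2.1 ⟨_, hd⟩ (h1.2.1 v)
    rw [he] at this
    exact this
  rw [this.differentiableAt_iff]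
  exact hS.self_of_nhds.1.clm_apply (differentiableAt_const _)

end basic

/-- Liouville property of the operator `A`: a vector with entire local resolvent vanishes. -/
def LProp (A : H →ₗ.[ℂ] H) : Prop :=
  ∀ (v : H) (Φ : ℂ → H), (∀ z ∈ pmResolventSet A, Φ z = res A z v) →
    (∀ z ∉ pmResolventSet A, DifferentiableAt ℂ Φ z) → v = 0

section riesz
variable {A : H →ₗ.[ℂ] H} {U U' : Set ℂ} {Q Q' : H →L[ℂ] H}

theorem IsRieszProjFor.compl (h : IsRieszProjFor A U Q) : IsRieszProjFor A Uᶜ (1 - Q) := by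
  obtain ⟨h1, h2, h3, h4⟩ := h
  have hQQ : ∀ x, Q (Q x) = Q x := fun x => congrArg (fun f : H →L[ℂ] H => f x) h1
  have e1 : LinearMap.range ((1 - Q : H →L[ℂ] H) : H →ₗ[ℂ] H)
      = LinearMap.ker (Q : H →ₗ[ℂ] H) := by
    ext x
    simp only [LinearMap.mem_range, LinearMap.mem_ker]
    constructor
    · rintro ⟨y, rfl⟩
      simp [hQQ]
    · intro hx
      refine ⟨x, ?_⟩
      have hx' : Q x = 0 := hx
      simp [hx']
  have e2 : LinearMap.ker ((1 - Q : H →L[ℂ] H) : H →ₗ[ℂ] H)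
      = LinearMap.range (Q : H →ₗ[ℂ] H) := by
    ext x
    simp only [LinearMap.mem_range, LinearMap.mem_ker]
    constructor
    · intro hx
      refine ⟨x, ?_⟩
      have hx' : x - Q x = 0 := hx
      exact (sub_eq_zero.mp hx').symm
    · rintro ⟨y, rfl⟩
      simp [hQQ]
  refine ⟨?_, ?_, ?_, ?_⟩
  · ext x; simp [hQQ]
  · intro x
    obtain ⟨hd, he⟩ := h2 x
    have hd' : (1 - Q) (x : H) ∈ A.domain := A.domain.sub_mem x.2 hd
    refine ⟨hd', ?_⟩
    have : (⟨(1 - Q) (x : H), hd'⟩ : A.domain) = x - ⟨Q x, hd⟩ := by ext; rfl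
    rw [this, LinearPMap.map_sub, he]; rfl
  · intro z hz
    rw [e1]; exact h4 z (by simpa using hz)
  · intro z hz
    rw [e2]; exact h3 z hz

theorem resPart_eq_res {V : Submodule ℂ H} {z : ℂ} (h : MapsResolvently A V z)
    (hz : z ∈ pmResolventSet A) {v : H} (hv : v ∈ V) : resPart A V z v = res A z v := by
  obtain ⟨hd, he⟩ := (resPart_spec h).2.2 v hv
  exact (eq_res hz hd he).symm

theorem riesz_range_inv (h : IsRieszProjFor A U Q) (x : A.domain)
    (hx : (x : H) ∈ LinearMap.range (Q : H →ₗ[ℂ] H)) :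
    A x ∈ LinearMap.range (Q : H →ₗ[ℂ] H) := by
  obtain ⟨h1, h2, h3, h4⟩ := h
  obtain ⟨y, hy⟩ := hx
  have hQx : Q (x : H) = x := by
    rw [← hy]; exact congrArg (fun f : H →L[ℂ] H => f y) h1
  obtain ⟨hd, he⟩ := h2 x
  refine ⟨A x, ?_⟩
  change Q (A x) = A x
  rw [← he]; congr 1; ext; exact hQx

theorem mem_nhds_or_of_frontier {U : Set ℂ} {z : ℂ} (hz : z ∉ frontier U) :
    (z ∈ U → U ∈ 𝓝 z) ∧ (z ∉ U → Uᶜ ∈ 𝓝 z) := by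
  constructor
  · intro h
    by_contra h'
    rw [← mem_interior_iff_mem_nhds] at h'
    exact hz ⟨subset_closure h, h'⟩
  · intro h
    by_contra h'
    rw [← mem_interior_iff_mem_nhds] at h'
    rw [← frontier_compl] at hz
    exact hz ⟨subset_closure h, h'⟩

theorem riesz_diffAt (h : IsRieszProjFor A U Q) {z : ℂ} (hz : Uᶜ ∈ 𝓝 z) (x : H) :
    DifferentiableAt ℂ
      (fun w => resPart A (LinearMap.range (Q : H →ₗ[ℂ] H)) w (Q x)) z := by
  refine differentiableAt_resPart (V := LinearMap.range (Q : H →ₗ[ℂ] H)) Q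
    (fun y => LinearMap.mem_range_self (Q : H →ₗ[ℂ] H) y) ?_ (riesz_range_inv h)
    (mem_of_superset hz fun w hw => h.2.2.1 w hw) (LinearMap.mem_range_self (Q : H →ₗ[ℂ] H) x)
  rintro _ ⟨y, rfl⟩
  exact congrArg (fun f : H →L[ℂ] H => f y) h.1

open Classical in
theorem riesz_kill (hL : LProp A) (h : IsRieszProjFor A U Q) (h' : IsRieszProjFor A U' Q')
    (hf : frontier U ⊆ pmResolventSet A) (hf' : frontier U' ⊆ pmResolventSet A)
    (hUU : U ∩ U' ⊆ pmResolventSet A) (x : H) : Q' (Q x) = 0 := by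
  set V := LinearMap.range (Q : H →ₗ[ℂ] H)
  set V' := LinearMap.range (Q' : H →ₗ[ℂ] H)
  have hQres : ∀ z ∈ pmResolventSet A, ∀ y, Q' (res A z y) = res A z (Q' y) := by
    intro z hz y
    obtain ⟨hd, he⟩ := h'.2.1 ⟨_, res_mem hz y⟩
    refine (eq_res hz hd ?_).symm
    rw [he, apply_res hz, map_add, map_smul]; simp
  apply hL (Q' (Q x)) (fun z => if z ∈ pmResolventSet A then res A z (Q' (Q x)) else
    if z ∈ U then resPart A V' z (Q' (Q x)) else Q' (resPart A V z (Q x)))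
  · intro z hz; rw [if_pos hz]
  · intro z hz
    by_cases hzU : z ∈ U
    · have hzU' : z ∉ U' := fun h3 => hz (hUU ⟨hzU, h3⟩)
      have n1 := (mem_nhds_or_of_frontier fun h3 => hz (hf h3)).1 hzU
      have n2 := (mem_nhds_or_of_frontier fun h3 => hz (hf' h3)).2 hzU'
      refine (EventuallyEq.differentiableAt_iff ?_).mpr (riesz_diffAt h' n2 (Q x))
      filter_upwards [n1, n2] with w hw1 hw2
      by_cases hw : w ∈ pmResolventSet A
      · rw [if_pos hw]
        exact (resPart_eq_res (v := Q' (Q x)) (h'.2.2.1 w hw2) hw ⟨Q x, rfl⟩).symm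
      · rw [if_neg hw, if_pos hw1]
    · have n1 := (mem_nhds_or_of_frontier fun h3 => hz (hf h3)).2 hzU
      have := (Q'.differentiableAt (x := resPart A V z (Q x))).comp z (riesz_diffAt h n1 x)
      refine (EventuallyEq.differentiableAt_iff ?_).mpr this
      filter_upwards [n1] with w hw1
      by_cases hw : w ∈ pmResolventSet A
      · rw [if_pos hw]
        simp only [Function.comp]
        have h9 := resPart_eq_res (v := Q x) (h.2.2.1 w hw1) hw ⟨x, rfl⟩
        rw [h9, hQres w hw]
      · rw [if_neg hw, if_neg hw1]; rfl

theorem riesz_unique (hL : LProp A) (h : IsRieszProjFor A U Q) (h' : IsRieszProjFor A U Q')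
    (hf : frontier U ⊆ pmResolventSet A) : Q = Q' := by
  have hf' : frontier Uᶜ ⊆ pmResolventSet A := by rwa [frontier_compl]
  ext x
  have h1 := riesz_kill hL h (IsRieszProjFor.compl h') hf hf' (by simp) x
  have h2 := riesz_kill hL (IsRieszProjFor.compl h) h' hf' hf (by simp) x
  simp at h1 h2
  rw [sub_eq_zero] at h1 h2
  rw [h1, h2]

end riesz
end PM

namespace PM
open Filter Topology

/-- A chain made of finitely many (continuous, with continuous speed) parametrized pieces. -/
structure Chain (ι : Type) where
  γ : ι → ℝ → ℂ
  γ' : ι → ℝ → ℂ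
  s : ι → ℝ
  t : ι → ℝ
  cont : ∀ i, ContinuousOn (γ i) (Set.uIcc (s i) (t i))
  cont' : ∀ i, ContinuousOn (γ' i) (Set.uIcc (s i) (t i))

namespace Chain
variable {ι : Type} [Fintype ι] (c : Chain ι)

/-- The carrier of the chain. -/
def carrier : Set ℂ := ⋃ i, c.γ i '' Set.uIcc (c.s i) (c.t i)

/-- The contour integral along the chain. -/
def oint {E : Type*} [NormedAddCommGroup E] [NormedSpace ℂ E] (f : ℂ → E) : E :=
  ∑ i, ∫ u in (c.s i)..(c.t i), c.γ' i u • f (c.γ i u)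

theorem mem_carrier {i : ι} {u : ℝ} (hu : u ∈ Set.uIcc (c.s i) (c.t i)) :
    c.γ i u ∈ c.carrier := Set.mem_iUnion.mpr ⟨i, u, hu, rfl⟩

theorem isCompact_carrier : IsCompact c.carrier :=
  isCompact_iUnion fun i => isCompact_uIcc.image_of_continuousOn (c.cont i)

section
variable {E F : Type*} [NormedAddCommGroup E] [NormedSpace ℂ E]
  [NormedAddCommGroup F] [NormedSpace ℂ F] [CompleteSpace E] [CompleteSpace F]
  {f g : ℂ → E}

theorem contOn (hf : ContinuousOn f c.carrier) (i : ι) :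
    ContinuousOn (fun u => c.γ' i u • f (c.γ i u)) (Set.uIcc (c.s i) (c.t i)) :=
  (c.cont' i).smul (hf.comp (c.cont i) fun _ hu => c.mem_carrier hu)

theorem intble (hf : ContinuousOn f c.carrier) (i : ι) :
    IntervalIntegrable (fun u => c.γ' i u • f (c.γ i u)) MeasureTheory.volume (c.s i) (c.t i) :=
  (c.contOn hf i).intervalIntegrable

theorem oint_clm (L : E →L[ℂ] F) (hf : ContinuousOn f c.carrier) :
    c.oint (fun z => L (f z)) = L (c.oint f) := by
  unfold oint
  rw [map_sum]
  refine Finset.sum_congr rfl fun i _ => ?_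
  rw [← L.intervalIntegral_comp_comm (c.intble hf i)]
  simp

theorem oint_add (hf : ContinuousOn f c.carrier) (hg : ContinuousOn g c.carrier) :
    c.oint (fun z => f z + g z) = c.oint f + c.oint g := by
  unfold oint
  rw [← Finset.sum_add_distrib]
  refine Finset.sum_congr rfl fun i _ => ?_
  rw [← intervalIntegral.integral_add (c.intble hf i) (c.intble hg i)]
  exact intervalIntegral.integral_congr fun u _ => smul_add _ _ _

theorem oint_congr (h : ∀ z ∈ c.carrier, f z = g z) : c.oint f = c.oint g := by
  unfold oint
  refine Finset.sum_congr rfl fun i _ => ?_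
  refine intervalIntegral.integral_congr fun u hu => ?_
  change c.γ' i u • f (c.γ i u) = c.γ' i u • g (c.γ i u)
  rw [h _ (c.mem_carrier hu)]

theorem oint_apply {f : ℂ → H →L[ℂ] H} (hf : ContinuousOn f c.carrier) (y : H) :
    c.oint f y = c.oint (fun z => f z y) :=
  (c.oint_clm (ContinuousLinearMap.apply ℂ H y) hf).symm

theorem contOn_cauchy (hf : ContinuousOn f c.carrier) {z : ℂ} (hz : z ∉ c.carrier) :
    ContinuousOn (fun l => (l - z)⁻¹ • f l) c.carrier := by
  refine ContinuousOn.smul (ContinuousOn.inv₀ (by fun_prop) ?_) hf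
  intro l hl h
  rw [sub_eq_zero] at h
  exact hz (h ▸ hl)

theorem differentiableAt_cauchy (hf : ContinuousOn f c.carrier) {z : ℂ} (hz : z ∉ c.carrier) :
    DifferentiableAt ℂ (fun w => c.oint (fun l => (l - w)⁻¹ • f l)) z := by
  unfold oint
  have hop : IsOpen c.carrierᶜ := c.isCompact_carrier.isClosed.isOpen_compl
  obtain ⟨ε, hε, hball⟩ := Metric.isOpen_iff.mp hop z hz
  refine DifferentiableAt.fun_sum fun i _ => ?_
  have key := intervalIntegral.hasDerivAt_integral_of_dominated_loc_of_deriv_le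
    (𝕜 := ℂ) (μ := MeasureTheory.volume) (a := c.s i) (b := c.t i) (x₀ := z)
    (s := Metric.ball z (ε / 2))
    (F := fun w u => c.γ' i u • ((c.γ i u - w)⁻¹ • f (c.γ i u)))
    (F' := fun w u => c.γ' i u • (((c.γ i u - w) ^ 2)⁻¹ • f (c.γ i u)))
    (bound := fun u => (4 / ε ^ 2) * ‖c.γ' i u • f (c.γ i u)‖)
    (Metric.ball_mem_nhds z (by positivity)) ?_ ?_ ?_ ?_ ?_ ?_
  · exact key.2.differentiableAt
  · filter_upwards [hop.mem_nhds hz] with w hw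
    exact ((c.contOn (c.contOn_cauchy hf hw) i).mono Set.uIoc_subset_uIcc).aestronglyMeasurable
      measurableSet_uIoc
  · exact c.intble (c.contOn_cauchy hf hz) i
  · have : ContinuousOn (fun l => ((l - z) ^ 2)⁻¹ • f l) c.carrier := by
      refine ContinuousOn.smul (ContinuousOn.inv₀ (by fun_prop) ?_) hf
      intro l hl h
      rw [sq_eq_zero_iff, sub_eq_zero] at h
      exact hz (h ▸ hl)
    exact ((c.contOn this i).mono Set.uIoc_subset_uIcc).aestronglyMeasurable
      measurableSet_uIoc
  · refine MeasureTheory.ae_of_all _ fun u hu w hw => ?_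
    have hl := c.mem_carrier (Set.uIoc_subset_uIcc hu)
    rw [smul_comm, norm_smul]
    refine mul_le_mul_of_nonneg_right ?_ (norm_nonneg _)
    have h1 : ε ≤ ‖c.γ i u - z‖ := by
      by_contra hlt
      exact hball (by rw [Metric.mem_ball, dist_eq_norm]; exact not_le.mp hlt) hl
    have h2 : ‖w - z‖ < ε / 2 := by rwa [Metric.mem_ball, dist_eq_norm] at hw
    have h3 : ε / 2 ≤ ‖c.γ i u - w‖ := by
      have : ‖c.γ i u - z‖ ≤ ‖c.γ i u - w‖ + ‖w - z‖ := by
        simpa using norm_add_le (c.γ i u - w) (w - z)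
      linarith
    rw [norm_inv, norm_pow]
    calc (‖c.γ i u - w‖ ^ 2)⁻¹ ≤ ((ε / 2) ^ 2)⁻¹ := by gcongr
      _ = 4 / ε ^ 2 := by field_simp; norm_num
  · exact ((c.intble hf i).norm.const_mul _)
  · refine MeasureTheory.ae_of_all _ fun u hu w hw => ?_
    have hl := c.mem_carrier (Set.uIoc_subset_uIcc hu)
    have hne : c.γ i u - w ≠ 0 := by
      intro h
      rw [sub_eq_zero] at h
      refine hball (Metric.ball_subset_ball (by linarith) hw) (h ▸ hl)
    have h1 : HasDerivAt (fun w : ℂ => (c.γ i u - w)⁻¹) (((c.γ i u - w) ^ 2)⁻¹) w := by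
      have := ((hasDerivAt_id w).const_sub (c.γ i u)).fun_inv hne
      simpa using this
    exact (h1.smul_const (f (c.γ i u))).const_smul (c.γ' i u)

end
end Chain

section
variable {ι : Type} [Fintype ι] (c : Chain ι) {A : H →ₗ.[ℂ] H} {U : Set ℂ}

/-- Contour integral projection. -/
def Chain.proj (A : H →ₗ.[ℂ] H) : H →L[ℂ] H :=
  -(2 * Real.pi * Complex.I : ℂ)⁻¹ • c.oint (res A)

def Chain.psi (A : H →ₗ.[ℂ] H) (z : ℂ) : H →L[ℂ] H :=
  -(2 * Real.pi * Complex.I : ℂ)⁻¹ • c.oint (fun l => (l - z)⁻¹ • res A l)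

theorem commutes_of_res {S : H →L[ℂ] H} {z : ℂ} (hz : z ∈ pmResolventSet A)
    (hS : ∀ y, S (res A z y) = res A z (S y)) (x : A.domain) :
    ∃ h : S (x : H) ∈ A.domain, A ⟨S (x : H), h⟩ = S (A x) := by
  have h1 : S (x : H) = res A z (S (A x - z • (x : H))) := by
    rw [← hS, res_apply_sub hz]
  have hd : S (x : H) ∈ A.domain := by rw [h1]; exact res_mem hz _
  refine ⟨hd, ?_⟩
  have h2 : A ⟨S (x : H), hd⟩ = A ⟨_, res_mem hz (S (A x - z • (x : H)))⟩ := by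
    congr 1; ext; exact h1
  rw [h2, apply_res hz, ← h1, map_sub, map_smul]
  abel

theorem Chain.cont_res (hK : c.carrier ⊆ pmResolventSet A) : ContinuousOn (res A) c.carrier :=
  (continuousOn_res A).mono hK

theorem Chain.oint_comm (hK : c.carrier ⊆ pmResolventSet A) {S : H →L[ℂ] H}
    (hS : ∀ z ∈ c.carrier, ∀ y, S (res A z y) = res A z (S y)) {g : ℂ → ℂ}
    (hg : ContinuousOn (fun l => g l • res A l) c.carrier) (y : H) :
    S (c.oint (fun l => g l • res A l) y) = c.oint (fun l => g l • res A l) (S y) := by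
  rw [c.oint_apply hg, c.oint_apply hg]
  rw [← c.oint_clm S (hg.clm_apply continuousOn_const)]
  refine c.oint_congr fun z hz => ?_
  simp [hS z hz]

theorem Chain.psi_comm (hK : c.carrier ⊆ pmResolventSet A) {S : H →L[ℂ] H}
    (hS : ∀ z ∈ c.carrier, ∀ y, S (res A z y) = res A z (S y)) {z : ℂ} (hz : z ∉ c.carrier)
    (y : H) : S (c.psi A z y) = c.psi A z (S y) := by
  simp only [Chain.psi, ContinuousLinearMap.smul_apply, map_smul]
  rw [c.oint_comm hK hS (c.contOn_cauchy (c.cont_res hK) hz)]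

theorem Chain.proj_comm (hK : c.carrier ⊆ pmResolventSet A) {S : H →L[ℂ] H}
    (hS : ∀ z ∈ c.carrier, ∀ y, S (res A z y) = res A z (S y))
    (y : H) : S (c.proj A y) = c.proj A (S y) := by
  have := c.oint_comm hK hS (g := fun _ => 1) (by simpa using c.cont_res hK) y
  simp only [one_smul] at this
  simp only [Chain.proj, ContinuousLinearMap.smul_apply, map_smul]
  rw [this]

theorem Chain.psi_spec (hK : c.carrier ⊆ pmResolventSet A) {z : ℂ} (hz : z ∉ c.carrier)
    {z₀ : ℂ} (hz₀ : z₀ ∈ pmResolventSet A) (y : H) :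
    ∃ h : c.psi A z y ∈ A.domain, A ⟨c.psi A z y, h⟩ - z • c.psi A z y =
      c.proj A y - ((2 * Real.pi * Complex.I : ℂ)⁻¹ * c.oint (fun l => (l - z)⁻¹)) • y := by
  set κ : ℂ := (2 * Real.pi * Complex.I : ℂ)⁻¹ with hκ
  have hR := c.cont_res hK
  have hCR := c.contOn_cauchy hR hz
  have hne : ∀ l ∈ c.carrier, l - z ≠ 0 := fun l hl h => hz (sub_eq_zero.mp h ▸ hl)
  have hinv : ContinuousOn (fun l : ℂ => (l - z)⁻¹) c.carrier :=
    ContinuousOn.inv₀ (by fun_prop) hne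
  set Y : H := c.proj A y - (κ * c.oint (fun l => (l - z)⁻¹)) • y + (z - z₀) • c.psi A z y
    with hY
  have c1 : ContinuousOn (fun l => res A l y) c.carrier := hR.clm_apply continuousOn_const
  have c2 : ContinuousOn (fun l => (l - z)⁻¹ • res A l y) c.carrier := hinv.smul c1
  have c3 : ContinuousOn (fun l => (l - z)⁻¹ • y) c.carrier := hinv.smul continuousOn_const
  have c4 : ContinuousOn (fun l => (z - z₀) • (l - z)⁻¹ • res A l y) c.carrier :=
    continuousOn_const.smul c2
  have hYe : Y = -κ • c.oint (fun l => res A l y + ((l - z)⁻¹ • y +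
      (z - z₀) • (l - z)⁻¹ • res A l y)) := by
    rw [c.oint_add c1 (c3.fun_add c4), c.oint_add c3 c4]
    have e1 : c.oint (fun l => (l - z)⁻¹ • y) = c.oint (fun l => (l - z)⁻¹) • y :=
      c.oint_clm ((1 : ℂ →L[ℂ] ℂ).smulRight y) hinv
    have e2 : c.oint (fun l => (z - z₀) • (l - z)⁻¹ • res A l y) =
        (z - z₀) • c.oint (fun l => (l - z)⁻¹ • res A l y) :=
      c.oint_clm ((z - z₀) • (1 : H →L[ℂ] H)) c2
    rw [e1, e2, hY, Chain.proj, Chain.psi, ContinuousLinearMap.smul_apply,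
      ContinuousLinearMap.smul_apply, c.oint_apply hR, c.oint_apply hCR]
    simp only [ContinuousLinearMap.smul_apply]
    rw [← hκ]
    module
  have hpsi : c.psi A z y = res A z₀ Y := by
    rw [hYe, map_smul, ← c.oint_clm (res A z₀) (c1.fun_add (c3.fun_add c4)), Chain.psi,
      ContinuousLinearMap.smul_apply, c.oint_apply hCR]
    congr 1
    refine c.oint_congr fun l hl => ?_
    simp only [ContinuousLinearMap.smul_apply, map_add, map_smul]
    have h1 := res_identity (hK hl) hz₀ y
    have h2 : res A l y = res A z₀ y + (l - z₀) • res A z₀ (res A l y) := by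
      rw [← sub_eq_iff_eq_add', h1, res_comm (hK hl) hz₀]
    have h3 : res A z₀ (res A l y) = (l - z)⁻¹ • (l - z) • res A z₀ (res A l y) := by
      rw [smul_smul, inv_mul_cancel₀ (hne l hl), one_smul]
    nth_rewrite 1 [h2]
    nth_rewrite 2 [h3]
    module
  have hd : c.psi A z y ∈ A.domain := by rw [hpsi]; exact res_mem hz₀ _
  refine ⟨hd, ?_⟩
  have h2 : A ⟨c.psi A z y, hd⟩ = A ⟨_, res_mem hz₀ Y⟩ := by
    congr 1; ext; exact hpsi
  rw [h2, apply_res hz₀, ← hpsi, hY]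
  module

open Classical in
/-- Contour integrals define Riesz projections. -/
theorem Chain.isRiesz (hL : LProp A) (hK : c.carrier ⊆ pmResolventSet A)
    (hf : frontier U ⊆ pmResolventSet A) {z₀ : ℂ} (hz₀ : z₀ ∈ pmResolventSet A)
    (hin : ∀ z ∈ U, z ∉ c.carrier → c.oint (fun l => (l - z)⁻¹) = 2 * Real.pi * Complex.I)
    (hout : ∀ z ∉ U, z ∉ c.carrier → c.oint (fun l => (l - z)⁻¹) = 0) :
    IsRieszProjFor A U (c.proj A) := by
  set Q := c.proj A with hQ
  have h2pi : (2 * Real.pi * Complex.I : ℂ) ≠ 0 := Complex.two_pi_I_ne_zero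
  have hresQ : ∀ z ∈ pmResolventSet A, ∀ y, Q (res A z y) = res A z (Q y) := fun z hz y =>
    (c.proj_comm hK (fun w hw y => res_comm hz (hK hw) y) y).symm
  have hresP : ∀ w, w ∉ c.carrier → ∀ z ∈ pmResolventSet A, ∀ y,
      c.psi A w (res A z y) = res A z (c.psi A w y) := fun w hw z hz y =>
    (c.psi_comm hK (fun w hw y => res_comm hz (hK hw) y) hw y).symm
  have hPQ : ∀ w, w ∉ c.carrier → ∀ y, Q (c.psi A w y) = c.psi A w (Q y) := fun w hw y =>
    c.psi_comm hK (fun z hz y => hresQ z (hK hz) y) hw y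
  have sp_out : ∀ z ∉ U, z ∉ c.carrier → ∀ y, ∃ h : c.psi A z y ∈ A.domain,
      A ⟨c.psi A z y, h⟩ - z • c.psi A z y = Q y := by
    intro z h1 h2 y
    obtain ⟨hd, he⟩ := c.psi_spec hK h2 hz₀ y
    rw [hout z h1 h2, mul_zero, zero_smul, sub_zero] at he
    exact ⟨hd, he⟩
  have sp_in : ∀ z ∈ U, z ∉ c.carrier → ∀ y, ∃ h : c.psi A z y ∈ A.domain,
      A ⟨c.psi A z y, h⟩ - z • c.psi A z y = Q y - y := by
    intro z h1 h2 y
    obtain ⟨hd, he⟩ := c.psi_spec hK h2 hz₀ y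
    rw [hin z h1 h2, inv_mul_cancel₀ h2pi, one_smul] at he
    exact ⟨hd, he⟩
  have hcomQ := fun x : A.domain => commutes_of_res hz₀ (hresQ z₀ hz₀) x
  have hcomP := fun w (hw : w ∉ c.carrier) (x : A.domain) =>
    commutes_of_res hz₀ (hresP w hw z₀ hz₀) x
  have hdiff : ∀ w, w ∉ c.carrier → ∀ y, DifferentiableAt ℂ (fun z => c.psi A z y) w := by
    intro w hw y
    have := (c.differentiableAt_cauchy (c.cont_res hK) hw).const_smul
      (-(2 * Real.pi * Complex.I : ℂ)⁻¹)
    exact this.clm_apply (differentiableAt_const y)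
  have hQQ : ∀ x, Q (Q x) = Q x := by
    intro x
    have h0 : Q (x - Q x) = 0 := by
      apply hL _ (fun z => if z ∈ pmResolventSet A then res A z (Q (x - Q x)) else
        if z ∈ U then -Q (c.psi A z x) else c.psi A z (x - Q x))
      · intro z hz; rw [if_pos hz]
      · intro z hz
        have hzK : z ∉ c.carrier := fun h => hz (hK h)
        have nK : c.carrierᶜ ∈ 𝓝 z := c.isCompact_carrier.isClosed.isOpen_compl.mem_nhds hzK
        by_cases hzU : z ∈ U
        · have n1 := (mem_nhds_or_of_frontier fun h3 => hz (hf h3)).1 hzU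
          have hd : DifferentiableAt ℂ (fun z => -Q (c.psi A z x)) z :=
            ((Q.differentiableAt).comp z (hdiff z hzK x)).neg
          refine (EventuallyEq.differentiableAt_iff ?_).mpr hd
          filter_upwards [n1, nK] with w hw1 hw2
          by_cases hw : w ∈ pmResolventSet A
          · rw [if_pos hw]
            obtain ⟨d1, e1⟩ := sp_in w hw1 hw2 x
            obtain ⟨d2, e2⟩ := hcomQ ⟨_, d1⟩
            have hd : -Q (c.psi A w x) ∈ A.domain := A.domain.neg_mem d2
            refine eq_res hw hd ?_
            have : (⟨-Q (c.psi A w x), hd⟩ : A.domain) = -⟨_, d2⟩ := by ext; rfl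
            rw [this, LinearPMap.map_neg, e2, smul_neg]
            have := congrArg Q e1
            simp only [map_sub, map_smul] at this
            rw [map_sub, ← neg_sub (Q (Q x)) (Q x), ← this]
            abel
          · rw [if_neg hw, if_pos hw1]
        · have n1 := (mem_nhds_or_of_frontier fun h3 => hz (hf h3)).2 hzU
          refine (EventuallyEq.differentiableAt_iff ?_).mpr (hdiff z hzK (x - Q x))
          filter_upwards [n1, nK] with w hw1 hw2
          by_cases hw : w ∈ pmResolventSet A
          · rw [if_pos hw]
            obtain ⟨d1, e1⟩ := sp_out w hw1 hw2 (x - Q x)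
            exact eq_res hw d1 e1
          · rw [if_neg hw, if_neg hw1]
    rw [map_sub, sub_eq_zero] at h0
    exact h0.symm
  refine ⟨by ext x; exact hQQ x, hcomQ, ?_, ?_⟩
  · intro z hz
    by_cases hzK : z ∈ c.carrier
    · refine ⟨res A z, ?_, fun x _ => res_apply_sub (hK hzK) x,
        fun y _ => (res_spec (hK hzK)).2 y⟩
      rintro _ ⟨y, rfl⟩
      exact ⟨res A z y, hresQ z (hK hzK) y⟩
    · refine ⟨c.psi A z, ?_, ?_, ?_⟩
      · rintro _ ⟨y, rfl⟩
        exact ⟨c.psi A z y, hPQ z hzK y⟩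
      · rintro x ⟨y, hy⟩
        obtain ⟨d1, e1⟩ := hcomP z hzK x
        obtain ⟨d2, e2⟩ := sp_out z hz hzK x
        rw [map_sub, map_smul, ← e1, e2, ← hy]
        exact hQQ y
      · rintro _ ⟨y, rfl⟩
        obtain ⟨d2, e2⟩ := sp_out z hz hzK (Q y)
        rw [hQQ] at e2
        exact ⟨d2, e2⟩
  · intro z hz
    by_cases hzK : z ∈ c.carrier
    · refine ⟨res A z, ?_, fun x _ => res_apply_sub (hK hzK) x,
        fun y _ => (res_spec (hK hzK)).2 y⟩
      intro y hy
      have hy' : Q y = 0 := hy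
      change Q (res A z y) = 0
      rw [hresQ z (hK hzK), hy', map_zero]
    · refine ⟨-c.psi A z, ?_, ?_, ?_⟩
      · intro y hy
        have hy' : Q y = 0 := hy
        change Q (-c.psi A z y) = 0
        rw [map_neg, hPQ z hzK, hy', map_zero, neg_zero]
      · intro x hx
        have hy' : Q x = 0 := hx
        obtain ⟨d1, e1⟩ := hcomP z hzK x
        obtain ⟨d2, e2⟩ := sp_in z hz hzK x
        rw [ContinuousLinearMap.neg_apply, map_sub, map_smul, ← e1, e2, hy']
        simp
      · intro y hy
        have hy' : Q y = 0 := hy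
        obtain ⟨d2, e2⟩ := sp_in z hz hzK y
        have hd : (-c.psi A z) y ∈ A.domain := A.domain.neg_mem d2
        refine ⟨hd, ?_⟩
        have : (⟨(-c.psi A z) y, hd⟩ : A.domain) = -⟨_, d2⟩ := by ext; rfl
        rw [this, LinearPMap.map_neg, ContinuousLinearMap.neg_apply, smul_neg]
        rw [hy', zero_sub] at e2
        rw [← neg_inj, ← e2]
        abel

end
end PM

namespace PM
open Filter Topology

theorem log_piece {γ γ' : ℝ → ℂ} {s t : ℝ} (hd : ∀ u ∈ Set.uIcc s t, HasDerivAt γ (γ' u) u)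
    (hc : ContinuousOn γ' (Set.uIcc s t)) {z w : ℂ} (hw : w ≠ 0)
    (hs : ∀ u ∈ Set.uIcc s t, w * (γ u - z) ∈ Complex.slitPlane) :
    ∫ u in s..t, γ' u • (γ u - z)⁻¹ =
      Complex.log (w * (γ t - z)) - Complex.log (w * (γ s - z)) := by
  refine intervalIntegral.integral_eq_sub_of_hasDerivAt
    (f := fun u => Complex.log (w * (γ u - z))) (fun u hu => ?_) ?_
  · have h1 := (((hd u hu).sub_const z).const_mul w).clog_real (hs u hu)
    have : γ u - z ≠ 0 := by
      intro h0
      have := hs u hu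
      rw [h0, mul_zero] at this
      exact Complex.slitPlane_ne_zero this rfl
    have e : w * γ' u / (w * (γ u - z)) = γ' u • (γ u - z)⁻¹ := by
      rw [smul_eq_mul]
      field_simp
    rw [← e]
    exact h1
  · apply ContinuousOn.intervalIntegrable
    refine ContinuousOn.smul hc (ContinuousOn.inv₀ ?_ ?_)
    · exact ContinuousOn.sub (fun u hu => (hd u hu).continuousAt.continuousWithinAt)
        continuousOn_const
    · intro u hu h0
      have := hs u hu
      rw [h0, mul_zero] at this
      exact Complex.slitPlane_ne_zero this rfl

theorem log_I_mul {u : ℂ} (hu : 0 < u.re) :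
    Complex.log (Complex.I * u) = Complex.log u + Real.pi / 2 * Complex.I := by
  have hne : u ≠ 0 := by rintro rfl; simp at hu
  have h1 := (Complex.abs_arg_lt_pi_div_two_iff.mpr (Or.inl hu))
  rw [abs_lt] at h1
  rw [Complex.log_mul_eq_add_log_iff Complex.I_ne_zero hne |>.mpr]
  · rw [Complex.log_I]; ring
  · rw [Complex.arg_I]
    constructor <;> linarith [h1.1, h1.2, Real.pi_pos]

theorem log_negI_mul {u : ℂ} (hu : 0 < u.re) :
    Complex.log (-Complex.I * u) = Complex.log u - Real.pi / 2 * Complex.I := by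
  have hne : u ≠ 0 := by rintro rfl; simp at hu
  have h1 := (Complex.abs_arg_lt_pi_div_two_iff.mpr (Or.inl hu))
  rw [abs_lt] at h1
  rw [Complex.log_mul_eq_add_log_iff (neg_ne_zero.mpr Complex.I_ne_zero) hne |>.mpr]
  · rw [Complex.log_neg_I]; ring
  · rw [Complex.arg_neg_I]
    constructor <;> linarith [h1.1, h1.2, Real.pi_pos]

/-- Data of a curvilinear trapezoid `a ≤ x ≤ b`, `|y| ≤ g x`. -/
structure TrapData where
  a : ℝ
  b : ℝ
  g : ℝ → ℝ
  g' : ℝ → ℝ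
  hab : a ≤ b
  hg : ∀ x ∈ Set.Icc a b, HasDerivAt g (g' x) x
  hg' : ContinuousOn g' (Set.Icc a b)
  pos : ∀ x ∈ Set.Icc a b, 0 < g x

namespace TrapData
variable (d : TrapData)

/-- The region. -/
def region : Set ℂ := {z | d.a ≤ z.re ∧ z.re ≤ d.b ∧ |z.im| ≤ d.g z.re}

def gam : Fin 4 → ℝ → ℂ :=
  ![fun x => x - Complex.I * d.g x, fun y => d.b + Complex.I * y,
    fun x => x + Complex.I * d.g x, fun y => d.a + Complex.I * y]
def gam' : Fin 4 → ℝ → ℂ :=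
  ![fun x => 1 - Complex.I * d.g' x, fun y => Complex.I,
    fun x => 1 + Complex.I * d.g' x, fun y => Complex.I]
def sI : Fin 4 → ℝ := ![d.a, -d.g d.b, d.b, d.g d.a]
def tI : Fin 4 → ℝ := ![d.b, d.g d.b, d.a, -d.g d.a]

theorem hder (i : Fin 4) : ∀ u ∈ Set.uIcc (d.sI i) (d.tI i), HasDerivAt (d.gam i) (d.gam' i u) u := by
  have hx : ∀ u : ℝ, HasDerivAt (fun x : ℝ => (x : ℂ)) 1 u := fun u => (hasDerivAt_id u).ofReal_comp
  intro u hu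
  fin_cases i
  · have hu' : u ∈ Set.Icc d.a d.b := by rwa [← Set.uIcc_of_le d.hab]
    exact (hx u).sub ((d.hg u hu').ofReal_comp.const_mul Complex.I)
  · simpa [gam, gam'] using ((hx u).const_mul Complex.I).const_add (d.b : ℂ)
  · have hu' : u ∈ Set.Icc d.a d.b := by rw [← Set.uIcc_of_le d.hab, Set.uIcc_comm]; exact hu
    exact (hx u).add ((d.hg u hu').ofReal_comp.const_mul Complex.I)
  · simpa [gam, gam'] using ((hx u).const_mul Complex.I).const_add (d.a : ℂ)

theorem hcont' (i : Fin 4) : ContinuousOn (d.gam' i) (Set.uIcc (d.sI i) (d.tI i)) := by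
  have h1 : ContinuousOn (fun x : ℝ => (d.g' x : ℂ)) (Set.Icc d.a d.b) :=
    Complex.continuous_ofReal.comp_continuousOn d.hg'
  fin_cases i
  · change ContinuousOn (fun x : ℝ => 1 - Complex.I * (d.g' x : ℂ)) (Set.uIcc d.a d.b)
    rw [Set.uIcc_of_le d.hab]
    exact continuousOn_const.sub (continuousOn_const.mul h1)
  · exact continuousOn_const
  · change ContinuousOn (fun x : ℝ => 1 + Complex.I * (d.g' x : ℂ)) (Set.uIcc d.b d.a)
    rw [Set.uIcc_comm, Set.uIcc_of_le d.hab]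
    exact continuousOn_const.add (continuousOn_const.mul h1)
  · exact continuousOn_const

/-- The boundary chain of the trapezoid. -/
def chain : Chain (Fin 4) where
  γ := d.gam
  γ' := d.gam'
  s := d.sI
  t := d.tI
  cont := fun i u hu => (d.hder i u hu).continuousAt.continuousWithinAt
  cont' := d.hcont'

theorem ma : d.a ∈ Set.Icc d.a d.b := ⟨le_rfl, d.hab⟩
theorem mb : d.b ∈ Set.Icc d.a d.b := ⟨d.hab, le_rfl⟩

theorem pieces {P : ℂ → Prop}
    (h0 : ∀ x ∈ Set.Icc d.a d.b, P (x - Complex.I * d.g x))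
    (h1 : ∀ y ∈ Set.Icc (-d.g d.b) (d.g d.b), P (d.b + Complex.I * y))
    (h2 : ∀ x ∈ Set.Icc d.a d.b, P (x + Complex.I * d.g x))
    (h3 : ∀ y ∈ Set.Icc (-d.g d.a) (d.g d.a), P (d.a + Complex.I * y)) (i : Fin 4) :
    ∀ u ∈ Set.uIcc (d.sI i) (d.tI i), P (d.gam i u) := by
  have pa := d.pos _ d.ma
  have pb := d.pos _ d.mb
  fin_cases i
  · intro u hu
    exact h0 u (by rwa [← Set.uIcc_of_le d.hab])
  · intro u hu
    exact h1 u (by rwa [← Set.uIcc_of_le (by linarith)])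
  · intro u hu
    exact h2 u (by rw [← Set.uIcc_of_le d.hab, Set.uIcc_comm]; exact hu)
  · intro u hu
    exact h3 u (by rw [← Set.uIcc_of_le (by linarith), Set.uIcc_comm]; exact hu)

theorem carrier_subset {S : Set ℂ}
    (h0 : ∀ z : ℂ, d.a ≤ z.re → z.re ≤ d.b → |z.im| = d.g z.re → z ∈ S)
    (h1 : ∀ z : ℂ, z.re = d.a → |z.im| ≤ d.g d.a → z ∈ S)
    (h2 : ∀ z : ℂ, z.re = d.b → |z.im| ≤ d.g d.b → z ∈ S) : d.chain.carrier ⊆ S := by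
  intro z hz
  obtain ⟨i, u, hu, rfl⟩ := Set.mem_iUnion.mp hz
  refine d.pieces (P := fun z => z ∈ S) ?_ ?_ ?_ ?_ i u hu
  · intro x hx
    exact h0 _ (by simpa using hx.1) (by simpa using hx.2) (by simp [abs_of_pos (d.pos x hx)])
  · intro y hy
    exact h2 _ (by simp) (by simpa [abs_le] using hy)
  · intro x hx
    exact h0 _ (by simpa using hx.1) (by simpa using hx.2) (by simp [abs_of_pos (d.pos x hx)])
  · intro y hy
    exact h1 _ (by simp) (by simpa [abs_le] using hy)

theorem mem_carrier_iff {z : ℂ} : z ∈ d.chain.carrier ↔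
    (d.a ≤ z.re ∧ z.re ≤ d.b ∧ |z.im| = d.g z.re) ∨ (z.re = d.a ∧ |z.im| ≤ d.g d.a) ∨
      (z.re = d.b ∧ |z.im| ≤ d.g d.b) := by
  constructor
  · intro hz
    exact d.carrier_subset (S := {z | (d.a ≤ z.re ∧ z.re ≤ d.b ∧ |z.im| = d.g z.re) ∨
      (z.re = d.a ∧ |z.im| ≤ d.g d.a) ∨ (z.re = d.b ∧ |z.im| ≤ d.g d.b)})
      (fun z h1 h2 h3 => Or.inl ⟨h1, h2, h3⟩) (fun z h1 h2 => Or.inr (Or.inl ⟨h1, h2⟩))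
      (fun z h1 h2 => Or.inr (Or.inr ⟨h1, h2⟩)) hz
  · have pa := d.pos _ d.ma
    have pb := d.pos _ d.mb
    rintro (⟨h1, h2, h3⟩ | ⟨h1, h2⟩ | ⟨h1, h2⟩)
    · have hx : z.re ∈ Set.Icc d.a d.b := ⟨h1, h2⟩
      rcases abs_eq (d.pos _ hx).le |>.mp h3 with h4 | h4
      · refine Set.mem_iUnion.mpr ⟨2, z.re, ?_, ?_⟩
        · change z.re ∈ Set.uIcc d.b d.a
          rw [Set.uIcc_comm, Set.uIcc_of_le d.hab]; exact hx
        · change (z.re : ℂ) + Complex.I * d.g z.re = z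
          apply Complex.ext <;> simp [h4]
      · refine Set.mem_iUnion.mpr ⟨0, z.re, ?_, ?_⟩
        · change z.re ∈ Set.uIcc d.a d.b
          rw [Set.uIcc_of_le d.hab]; exact hx
        · change (z.re : ℂ) - Complex.I * d.g z.re = z
          apply Complex.ext <;> simp [h4]
    · refine Set.mem_iUnion.mpr ⟨3, z.im, ?_, ?_⟩
      · change z.im ∈ Set.uIcc (d.g d.a) (-d.g d.a)
        rw [Set.uIcc_comm, Set.uIcc_of_le (by linarith)]; exact abs_le.mp h2
      · change (d.a : ℂ) + Complex.I * z.im = z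
        apply Complex.ext <;> simp [h1]
    · refine Set.mem_iUnion.mpr ⟨1, z.im, ?_, ?_⟩
      · change z.im ∈ Set.uIcc (-d.g d.b) (d.g d.b)
        rw [Set.uIcc_of_le (by linarith)]; exact abs_le.mp h2
      · change (d.b : ℂ) + Complex.I * z.im = z
        apply Complex.ext <;> simp [h1]

theorem wind_zero {z w : ℂ} (hw : w ≠ 0) (hs : ∀ i, ∀ u ∈ Set.uIcc (d.sI i) (d.tI i),
    w * (d.gam i u - z) ∈ Complex.slitPlane) : d.chain.oint (fun l => (l - z)⁻¹) = 0 := by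
  have := fun i => log_piece (d.hder i) (d.hcont' i) hw (hs i)
  change ∑ i, ∫ u in (d.sI i)..(d.tI i), d.gam' i u • (d.gam i u - z)⁻¹ = 0
  simp only [this, Fin.sum_univ_four]
  simp only [gam, sI, tI, Matrix.cons_val]
  push_cast
  have e : ∀ x : ℂ, (d.b : ℂ) + Complex.I * -x = d.b - Complex.I * x := fun x => by ring
  have e' : ∀ x : ℂ, (d.a : ℂ) + Complex.I * -x = d.a - Complex.I * x := fun x => by ring
  simp only [e, e']
  ring

theorem wind_in {z : ℂ} (hz : z ∈ d.region) (hzc : z ∉ d.chain.carrier) :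
    d.chain.oint (fun l => (l - z)⁻¹) = 2 * Real.pi * Complex.I := by
  rw [mem_carrier_iff] at hzc
  push Not at hzc
  obtain ⟨h1, h2, h3⟩ := hz
  obtain ⟨c1, c2, c3⟩ := hzc
  have ha : d.a < z.re := by
    refine lt_of_le_of_ne h1 fun h => ?_
    have := c2 h.symm
    rw [← h] at h3
    linarith
  have hb : z.re < d.b := by
    refine lt_of_le_of_ne h2 fun h => ?_
    have := c3 h
    rw [h] at h3
    linarith
  have hg : |z.im| < d.g z.re := lt_of_le_of_ne h3 (c1 h1 h2)
  rw [abs_lt] at hg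
  change ∑ i, ∫ u in (d.sI i)..(d.tI i), d.gam' i u • (d.gam i u - z)⁻¹ = _
  rw [Fin.sum_univ_four]
  have k0 := log_piece (d.hder 0) (d.hcont' 0) (z := z) (w := Complex.I) Complex.I_ne_zero (by
    intro u hu
    rw [Complex.mem_slitPlane_iff]
    by_cases hux : u = z.re
    · left
      subst hux
      simp [gam]; linarith
    · right
      simp [gam, sub_eq_zero, hux, Ne.symm hux, eq_comm])
  have k1 := log_piece (d.hder 1) (d.hcont' 1) (z := z) (w := 1) one_ne_zero (by
    intro u hu
    rw [Complex.mem_slitPlane_iff]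
    left
    simp [gam]; linarith)
  have k2 := log_piece (d.hder 2) (d.hcont' 2) (z := z) (w := -Complex.I)
    (neg_ne_zero.mpr Complex.I_ne_zero) (by
    intro u hu
    rw [Complex.mem_slitPlane_iff]
    by_cases hux : u = z.re
    · left
      subst hux
      simp [gam]; linarith
    · right
      simp [gam, sub_eq_zero, hux, Ne.symm hux, eq_comm])
  have k3 := log_piece (d.hder 3) (d.hcont' 3) (z := z) (w := -1) (by norm_num) (by
    intro u hu
    rw [Complex.mem_slitPlane_iff]
    left
    simp [gam]; linarith)
  rw [k0, k1, k2, k3]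
  simp only [gam, sI, tI, Matrix.cons_val]
  push_cast
  have e : ∀ x : ℂ, (d.b : ℂ) + Complex.I * -x = d.b - Complex.I * x := fun x => by ring
  have e' : ∀ x : ℂ, (d.a : ℂ) + Complex.I * -x = d.a - Complex.I * x := fun x => by ring
  simp only [e, e']
  have q1 := log_I_mul (u := (d.b - Complex.I * d.g d.b - z)) (by simpa using hb)
  have q2 := log_negI_mul (u := (d.b + Complex.I * d.g d.b - z)) (by simpa using hb)
  have q3 := log_I_mul (u := -(d.a + Complex.I * d.g d.a - z)) (by simpa using ha)
  have q4 := log_negI_mul (u := -(d.a - Complex.I * d.g d.a - z)) (by simpa using ha)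
  rw [show Complex.I * -(d.a + Complex.I * d.g d.a - z) =
    -Complex.I * (d.a + Complex.I * d.g d.a - z) by ring] at q3
  rw [show -Complex.I * -(d.a - Complex.I * d.g d.a - z) =
    Complex.I * (d.a - Complex.I * d.g d.a - z) by ring] at q4
  rw [q1, q2, q3, q4, one_mul, one_mul, neg_one_mul, neg_one_mul]
  ring

theorem wind_out {z : ℂ} (hz : z ∉ d.region) :
    d.chain.oint (fun l => (l - z)⁻¹) = 0 := by
  have pa := d.pos _ d.ma
  have pb := d.pos _ d.mb
  by_cases h1 : z.re < d.a
  · refine d.wind_zero (w := 1) one_ne_zero (d.pieces (P := fun l => (1 : ℂ) * (l - z) ∈ Complex.slitPlane) ?_ ?_ ?_ ?_)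
    · intro x hx
      left; simp; linarith [hx.1]
    · intro x hx
      left; simp; linarith [d.hab]
    · intro x hx
      left; simp; linarith [hx.1]
    · intro x hx
      left; simp; linarith
  by_cases h2 : d.b < z.re
  · refine d.wind_zero (w := -1) (by norm_num) (d.pieces (P := fun l => (-1 : ℂ) * (l - z) ∈ Complex.slitPlane) ?_ ?_ ?_ ?_)
    · intro x hx
      left; simp; linarith [hx.2]
    · intro x hx
      left; simp; linarith [d.hab]
    · intro x hx
      left; simp; linarith [hx.2]
    · intro x hx
      left; simp; linarith [d.hab]
  push Not at h1 h2
  have h3 : d.g z.re < |z.im| := by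
    by_contra h
    exact hz ⟨h1, h2, not_lt.mp h⟩
  rcases lt_abs.mp h3 with h4 | h4
  · refine d.wind_zero (w := Complex.I) Complex.I_ne_zero (d.pieces (P := fun l => (Complex.I : ℂ) * (l - z) ∈ Complex.slitPlane) ?_ ?_ ?_ ?_)
    · intro x hx
      by_cases hux : x = z.re
      · subst hux; left; simp; linarith [d.pos _ hx]
      · right; simp [sub_eq_zero, hux, Ne.symm hux]
    · intro y hy
      by_cases hux : d.b = z.re
      · left; rw [← hux] at h4; simp; linarith [hy.2]
      · right; simp [sub_eq_zero, hux, Ne.symm hux]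
    · intro x hx
      by_cases hux : x = z.re
      · subst hux; left; simp; linarith [d.pos _ hx]
      · right; simp [sub_eq_zero, hux, Ne.symm hux]
    · intro y hy
      by_cases hux : d.a = z.re
      · left; rw [← hux] at h4; simp; linarith [hy.2]
      · right; simp [sub_eq_zero, hux, Ne.symm hux]
  · refine d.wind_zero (w := -Complex.I) (neg_ne_zero.mpr Complex.I_ne_zero)
      (d.pieces (P := fun l => (-Complex.I : ℂ) * (l - z) ∈ Complex.slitPlane) ?_ ?_ ?_ ?_)
    · intro x hx
      by_cases hux : x = z.re
      · subst hux; left; simp; linarith [d.pos _ hx]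
      · right; simp [sub_eq_zero, hux, Ne.symm hux]
    · intro y hy
      by_cases hux : d.b = z.re
      · left; rw [← hux] at h4; simp; linarith [hy.1]
      · right; simp [sub_eq_zero, hux, Ne.symm hux]
    · intro x hx
      by_cases hux : x = z.re
      · subst hux; left; simp; linarith [d.pos _ hx]
      · right; simp [sub_eq_zero, hux, Ne.symm hux]
    · intro y hy
      by_cases hux : d.a = z.re
      · left; rw [← hux] at h4; simp; linarith [hy.1]
      · right; simp [sub_eq_zero, hux, Ne.symm hux]

theorem isRiesz {A : H →ₗ.[ℂ] H} (hL : LProp A) (hK : d.chain.carrier ⊆ pmResolventSet A)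
    (hf : frontier d.region ⊆ pmResolventSet A) :
    IsRieszProjFor A d.region (d.chain.proj A) := by
  refine d.chain.isRiesz hL hK hf (z₀ := d.a + Complex.I * d.g d.a) (hK ?_)
    (fun z hz hzc => d.wind_in hz hzc) (fun z hz _ => d.wind_out hz)
  rw [mem_carrier_iff]
  right; left
  simp [abs_of_pos (d.pos _ d.ma)]

end TrapData
end PM

namespace PM
open Filter Topology

theorem lprop_of {A : H →ₗ.[ℂ] H} {C : ℝ} (hC : 0 < C)
    (h1 : ∀ X : ℝ, ∃ c > X, ∀ y : ℝ, (c + Complex.I * y) ∈ pmResolventSet A ∧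
      ‖res A (c + Complex.I * y)‖ ≤ C)
    (h2 : ∀ X : ℝ, ∃ c < X, ∀ y : ℝ, (c + Complex.I * y) ∈ pmResolventSet A ∧
      ‖res A (c + Complex.I * y)‖ ≤ C)
    (h3 : ∀ a b : ℝ, ∃ Y > 0, ∀ z : ℂ, a ≤ z.re → z.re ≤ b → Y ≤ |z.im| →
      z ∈ pmResolventSet A ∧ ‖res A z‖ ≤ C / |z.im|) : LProp A := by
  intro v Φ hΦ hd
  have hdiff : Differentiable ℂ Φ := by
    intro z
    by_cases hz : z ∈ pmResolventSet A
    · have : Φ =ᶠ[𝓝 z] fun w => res A w v := by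
        filter_upwards [(isOpen_rho A).mem_nhds hz] with w hw using hΦ w hw
      rw [this.differentiableAt_iff]
      exact (differentiableAt_res hz).clm_apply (differentiableAt_const v)
    · exact hd z hz
  have hb : ∀ z, ‖Φ z‖ ≤ C * ‖v‖ := by
    intro z
    have hpt : ∀ w, w ∈ pmResolventSet A → ‖res A w‖ ≤ C → ‖Φ w‖ ≤ C * ‖v‖ := by
      intro w hw hw'
      rw [hΦ w hw]
      exact (ContinuousLinearMap.le_opNorm _ _).trans
        (mul_le_mul_of_nonneg_right hw' (norm_nonneg _))
    obtain ⟨c, hc, hcl⟩ := h1 z.re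
    obtain ⟨d, hd, hdl⟩ := h2 z.re
    obtain ⟨Y, hY, hYl⟩ := h3 d c
    set Y' := max Y (max 1 (|z.im| + 1)) with hY'
    have hY1 : Y ≤ Y' := le_max_left _ _
    have hY2 : 1 ≤ Y' := (le_max_left _ _).trans (le_max_right _ _)
    have hY3 : |z.im| + 1 ≤ Y' := (le_max_right _ _).trans (le_max_right _ _)
    have hdc : d ≠ c := by intro h; linarith
    refine Complex.norm_le_of_forall_mem_frontier_norm_le (U := Set.Ioo d c ×ℂ Set.Ioo (-Y') Y')
      ((Metric.isBounded_Ioo d c).reProdIm (Metric.isBounded_Ioo _ _)) hdiff.diffContOnCl ?_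
      (subset_closure ?_)
    · intro w hw
      rw [Complex.frontier_reProdIm, closure_Ioo hdc, closure_Ioo (by intro h; linarith),
        frontier_Ioo (by linarith), frontier_Ioo (by linarith)] at hw
      rcases hw with ⟨⟨q1, q2⟩, q3⟩ | ⟨q1, q2⟩
      · have : |w.im| = Y' := by
          rcases q3 with q | q
          · have : w.im = -Y' := q
            rw [this, abs_neg, abs_of_pos (by linarith)]
          · have : w.im = Y' := q
            rw [this, abs_of_pos (by linarith)]
        obtain ⟨g1, g2⟩ := hYl w q1 q2 (by rw [this]; exact hY1)
        refine hpt w g1 (g2.trans ?_)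
        rw [this]
        exact div_le_self hC.le hY2
      · have hwe : w = w.re + Complex.I * w.im := by
          apply Complex.ext <;> simp
        rcases q1 with q | q
        · have q' : w.re = d := q
          rw [hwe, q']
          exact hpt _ (hdl _).1 (hdl _).2
        · have q' : w.re = c := q
          rw [hwe, q']
          exact hpt _ (hcl _).1 (hcl _).2
    · have := abs_lt.mp (show |z.im| < Y' by linarith)
      exact ⟨⟨hd, hc⟩, this⟩
  have hconst : ∀ z w, Φ z = Φ w := by
    apply hdiff.apply_eq_apply_of_bounded
    rw [isBounded_iff_forall_norm_le]
    exact ⟨C * ‖v‖, by rintro _ ⟨z, rfl⟩; exact hb z⟩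
  obtain ⟨Y, hY, hYl⟩ := h3 0 0
  have hpos : ∀ y : ℝ, Y ≤ y → (Complex.I * y) ∈ pmResolventSet A ∧
      ‖res A (Complex.I * y)‖ ≤ C / y := by
    intro y hy
    have h0 : 0 < y := by linarith
    have := hYl (Complex.I * y) (by simp) (by simp) (by simpa [abs_of_pos h0] using hy)
    simpa [abs_of_pos h0] using this
  have hzero : Φ 0 = 0 := by
    rw [← norm_le_zero_iff]
    have ht : Tendsto (fun y : ℝ => C / y * ‖v‖) atTop (𝓝 (0 * ‖v‖)) :=
      (tendsto_const_nhds.div_atTop tendsto_id).mul_const _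
    rw [zero_mul] at ht
    refine ge_of_tendsto ht ?_
    filter_upwards [eventually_ge_atTop Y] with y hy
    obtain ⟨g1, g2⟩ := hpos y hy
    rw [hconst 0 (Complex.I * y), hΦ _ g1]
    exact (ContinuousLinearMap.le_opNorm _ _).trans
        (mul_le_mul_of_nonneg_right g2 (norm_nonneg _))
  obtain ⟨g1, g2⟩ := hpos Y le_rfl
  have h0 : res A (Complex.I * Y) v = 0 := by rw [← hΦ _ g1, hconst _ 0, hzero]
  have h1 := apply_res g1 v (res_mem g1 v)
  have h2 : A ⟨res A (Complex.I * Y) v, res_mem g1 v⟩ = A 0 := by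
    congr 1; ext; exact h0
  rw [h2, LinearPMap.map_zero, h0, smul_zero, add_zero] at h1
  exact h1.symm

theorem riesz_res_comm {A : H →ₗ.[ℂ] H} {U : Set ℂ} {Q : H →L[ℂ] H} (h : IsRieszProjFor A U Q)
    {z : ℂ} (hz : z ∈ pmResolventSet A) (y : H) : Q (res A z y) = res A z (Q y) := by
  obtain ⟨hd, he⟩ := h.2.1 ⟨_, res_mem hz y⟩
  refine (eq_res hz hd ?_).symm
  rw [he, apply_res hz, map_add, map_smul]; simp

theorem riesz_congr {A : H →ₗ.[ℂ] H} {U U' : Set ℂ} {Q : H →L[ℂ] H} (h : IsRieszProjFor A U Q)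
    (hU : ∀ z ∉ pmResolventSet A, (z ∈ U ↔ z ∈ U')) : IsRieszProjFor A U' Q := by
  refine ⟨h.1, h.2.1, ?_, ?_⟩
  · intro z hz
    by_cases hr : z ∈ pmResolventSet A
    · refine ⟨res A z, ?_, fun x _ => res_apply_sub hr x, fun y _ => (res_spec hr).2 y⟩
      rintro _ ⟨y, rfl⟩
      exact ⟨res A z y, riesz_res_comm h hr y⟩
    · exact h.2.2.1 z (by rwa [hU z hr])
  · intro z hz
    by_cases hr : z ∈ pmResolventSet A
    · refine ⟨res A z, ?_, fun x _ => res_apply_sub hr x, fun y _ => (res_spec hr).2 y⟩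
      intro y hy
      have hy' : Q y = 0 := hy
      change Q (res A z y) = 0
      rw [riesz_res_comm h hr, hy', map_zero]
    · exact h.2.2.2 z (by rwa [hU z hr])

open Classical in
theorem riesz_complete {A : H →ₗ.[ℂ] H} (hL : LProp A) {κ : Type*} {U : κ → Set ℂ}
    {Q : κ → H →L[ℂ] H} (hR : ∀ k, IsRieszProjFor A (U k) (Q k))
    (hf : ∀ k, frontier (U k) ⊆ pmResolventSet A)
    (hdis : ∀ j k, j ≠ k → U j ∩ U k ⊆ pmResolventSet A)
    (hcov : ∀ z, ∃ k, z ∈ U k) {v : H} (hv : ∀ k, Q k v = 0) : v = 0 := by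
  choose idx hidx using hcov
  apply hL v (fun z => if z ∈ pmResolventSet A then res A z v else
    resPart A (LinearMap.range ((1 - Q (idx z) : H →L[ℂ] H) : H →ₗ[ℂ] H)) z
      ((1 - Q (idx z)) v))
  · intro z hz; rw [if_pos hz]
  · intro z hz
    have n1 := (mem_nhds_or_of_frontier fun h3 => hz (hf (idx z) h3)).1 (hidx z)
    refine (EventuallyEq.differentiableAt_iff ?_).mpr
      (riesz_diffAt (IsRieszProjFor.compl (hR (idx z))) (by rwa [compl_compl]) v)
    filter_upwards [n1] with w hw
    by_cases hwr : w ∈ pmResolventSet A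
    · rw [if_pos hwr]
      have := resPart_eq_res (v := (1 - Q (idx z)) v)
        ((IsRieszProjFor.compl (hR (idx z))).2.2.1 w (by simpa using hw)) hwr
        (LinearMap.mem_range_self ((1 - Q (idx z) : H →L[ℂ] H) : H →ₗ[ℂ] H) v)
      rw [this]; simp [hv]
    · rw [if_neg hwr]
      have : idx w = idx z := by
        by_contra hne
        exact hwr (hdis _ _ hne ⟨hidx w, hw⟩)
      rw [this]

theorem hasSum_of_bessel {κ : Type*} {Q : κ → H →L[ℂ] H} {C : ℝ}
    (hQ : ∀ k x, Q k (Q k x) = Q k x) (hQ' : ∀ j k, j ≠ k → ∀ x, Q j (Q k x) = 0)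
    (hb : ∀ (F : Finset κ) x, ∑ k ∈ F, ‖Q k x‖ ^ 2 ≤ C * ‖x‖ ^ 2)
    (hb' : ∀ (F : Finset κ) x, ∑ k ∈ F, ‖ContinuousLinearMap.adjoint (Q k) x‖ ^ 2 ≤ C * ‖x‖ ^ 2)
    (hcomp : ∀ v, (∀ k, Q k v = 0) → v = 0) (x : H) : HasSum (fun k => Q k x) x := by
  have key : ∀ F : Finset κ, ‖∑ k ∈ F, Q k x‖ ^ 2 ≤ C * ∑ k ∈ F, ‖Q k x‖ ^ 2 := by
    intro F
    set w := ∑ k ∈ F, Q k x with hw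
    set S := ∑ k ∈ F, ‖Q k x‖ ^ 2 with hS
    have hS0 : 0 ≤ S := Finset.sum_nonneg fun _ _ => by positivity
    have h1 : ‖w‖ ^ 2 ≤ ∑ k ∈ F, ‖ContinuousLinearMap.adjoint (Q k) w‖ * ‖Q k x‖ := by
      have e1 : inner ℂ w w = ∑ k ∈ F, inner ℂ (ContinuousLinearMap.adjoint (Q k) w) (Q k x) := by
        conv_lhs => rw [hw, inner_sum]
        refine Finset.sum_congr rfl fun k _ => ?_
        rw [ContinuousLinearMap.adjoint_inner_left, hQ]
      have e2 : ‖w‖ ^ 2 = ‖inner ℂ w w‖ := by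
        rw [inner_self_eq_norm_sq_to_K]; simp
      rw [e2, e1]
      exact (norm_sum_le _ _).trans (Finset.sum_le_sum fun k _ => norm_inner_le_norm _ _)
    have h2 := Finset.sum_mul_sq_le_sq_mul_sq F
      (fun k => ‖ContinuousLinearMap.adjoint (Q k) w‖) (fun k => ‖Q k x‖)
    have h3 : (‖w‖ ^ 2) ^ 2 ≤ (C * ‖w‖ ^ 2) * S := by
      calc (‖w‖ ^ 2) ^ 2 ≤ (∑ k ∈ F, ‖ContinuousLinearMap.adjoint (Q k) w‖ * ‖Q k x‖) ^ 2 := by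
            gcongr
        _ ≤ _ := h2
        _ ≤ _ := by gcongr; exact hb' F w
    rcases eq_or_lt_of_le (norm_nonneg w) with h0 | h0
    · rw [← h0]
      have : 0 ≤ C * S := by
        by_cases hx : S = 0
        · simp [hx]
        · have hSpos : 0 < S := lt_of_le_of_ne hS0 (Ne.symm hx)
          have hC : 0 ≤ C := by
            by_contra hneg
            push Not at hneg
            have := hb F x
            have : C * ‖x‖ ^ 2 ≤ 0 := mul_nonpos_of_nonpos_of_nonneg hneg.le (by positivity)
            linarith [hb F x]
          positivity
      simpa using this
    · have h4 : 0 < ‖w‖ ^ 2 := by positivity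
      have : ‖w‖ ^ 2 * ‖w‖ ^ 2 ≤ ‖w‖ ^ 2 * (C * S) := by nlinarith
      exact le_of_mul_le_mul_left this h4
  have hsq : Summable (fun k => ‖Q k x‖ ^ 2) :=
    summable_of_sum_le (fun k => by positivity) (fun F => hb F x)
  have hsum : Summable (fun k => Q k x) := by
    rw [summable_iff_vanishing_norm]
    intro ε hε
    obtain ⟨s, hs⟩ := summable_iff_vanishing_norm.mp hsq (ε ^ 2 / (|C| + 1)) (by positivity)
    refine ⟨s, fun t ht => ?_⟩
    have h1 := hs t ht
    rw [Real.norm_of_nonneg (Finset.sum_nonneg fun _ _ => by positivity)] at h1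
    have h2 := key t
    have hS0 : 0 ≤ ∑ k ∈ t, ‖Q k x‖ ^ 2 := Finset.sum_nonneg fun _ _ => by positivity
    have h3 : C * ∑ k ∈ t, ‖Q k x‖ ^ 2 < ε ^ 2 := by
      rw [lt_div_iff₀ (by positivity)] at h1
      have := le_abs_self C
      nlinarith
    exact lt_of_pow_lt_pow_left₀ 2 hε.le (h2.trans_lt h3)
  have hx := hsum.hasSum
  suffices h : x - ∑' k, Q k x = 0 by
    rw [sub_eq_zero] at h
    rwa [← h] at hx
  refine hcomp _ fun j => ?_
  rw [map_sub, (Q j).map_tsum hsum, tsum_eq_single j fun k hk => hQ' j k hk.symm x, hQ, sub_self]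

/-- From a bilinear bound to square function bounds. -/
theorem bessel_of_bilinear {κ : Type*} {D : κ → H →L[ℂ] H} {a : κ → H → ℝ} {C : ℝ} (hC : 0 ≤ C)
    (ha0 : ∀ k x, 0 ≤ a k x) (hah : ∀ k (t : ℝ) x, a k ((t : ℂ) • x) = t ^ 2 * a k x)
    (hsum : ∀ (F : Finset κ) x, ∑ k ∈ F, a k x ≤ C * ‖x‖ ^ 2)
    (hD : ∀ k x y, ‖inner ℂ y (D k x)‖ ≤ a k x + a k y) :
    (∀ (F : Finset κ) x, ∑ k ∈ F, ‖D k x‖ ^ 2 ≤ 4 * C ^ 2 * ‖x‖ ^ 2) ∧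
    (∀ (F : Finset κ) x, ∑ k ∈ F, ‖ContinuousLinearMap.adjoint (D k) x‖ ^ 2
      ≤ 4 * C ^ 2 * ‖x‖ ^ 2) := by
  have hle : ∀ k x, a k x ≤ C * ‖x‖ ^ 2 := fun k x => by simpa using hsum {k} x
  -- one application at a time
  have hD' : ∀ k x y (t : ℝ), ‖inner ℂ y (D k x)‖ * t ≤ t ^ 2 * a k x + a k y := by
    intro k x y t
    have := hD k ((t : ℂ) • x) y
    rw [map_smul, inner_smul_right, norm_mul, hah] at this
    have h2 : t ≤ ‖(t : ℂ)‖ := by simpa using le_abs_self t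
    nlinarith [norm_nonneg (inner ℂ y (D k x))]
  have hquad : ∀ k x y, ‖inner ℂ y (D k x)‖ ^ 2 ≤ 4 * a k x * a k y := by
    intro k x y
    have h1 := discrim_le_zero (a := a k x) (b := -‖inner ℂ y (D k x)‖) (c := a k y)
      (fun t => by nlinarith [hD' k x y t])
    rw [discrim] at h1
    nlinarith
  have hsq : ∀ w : H, ‖inner ℂ w w‖ = ‖w‖ ^ 2 := fun w => by
    rw [inner_self_eq_norm_sq_to_K]; simp
  have fin : ∀ (F : Finset κ) (x : H) (f : κ → H),
      (∀ k, (‖f k‖ ^ 2) ^ 2 ≤ 4 * a k x * a k (f k)) →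
      ∑ k ∈ F, ‖f k‖ ^ 2 ≤ 4 * C ^ 2 * ‖x‖ ^ 2 := by
    intro F x f hf
    have : ∀ k, ‖f k‖ ^ 2 ≤ 4 * C * a k x := by
      intro k
      have h1 := hf k
      have h2 := hle k (f k)
      have h3 := ha0 k x
      rcases eq_or_lt_of_le (norm_nonneg (f k)) with h0 | h0
      · rw [← h0]; simp; positivity
      · have h4 : 0 < ‖f k‖ ^ 2 := by positivity
        have : ‖f k‖ ^ 2 * ‖f k‖ ^ 2 ≤ ‖f k‖ ^ 2 * (4 * C * a k x) := by nlinarith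
        exact le_of_mul_le_mul_left this h4
    calc ∑ k ∈ F, ‖f k‖ ^ 2 ≤ ∑ k ∈ F, 4 * C * a k x := Finset.sum_le_sum fun k _ => this k
      _ = 4 * C * ∑ k ∈ F, a k x := by rw [Finset.mul_sum]
      _ ≤ 4 * C * (C * ‖x‖ ^ 2) := by gcongr; exact hsum F x
      _ = _ := by ring
  constructor
  · intro F x
    refine fin F x (fun k => D k x) fun k => ?_
    rw [← hsq]
    exact hquad k x (D k x)
  · intro F x
    refine fin F x (fun k => ContinuousLinearMap.adjoint (D k) x) fun k => ?_
    have := hquad k (ContinuousLinearMap.adjoint (D k) x) x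
    rw [← ContinuousLinearMap.adjoint_inner_left, hsq] at this
    linarith

end PM

namespace PM
open Filter Topology

/-- Symmetric operators with real spectrum. -/
structure IsSA (T : H →ₗ.[ℂ] H) : Prop where
  sym : ∀ x y : T.domain, inner ℂ (T x) (y : H) = inner ℂ (x : H) (T y)
  real : ∀ z : ℂ, z.im ≠ 0 → z ∈ pmResolventSet T

theorem isSA_of {T : H →ₗ.[ℂ] H} (h : IsSelfAdjoint T)
    (hr : ∀ z : ℂ, z.im ≠ 0 → z ∈ pmResolventSet T) : IsSA T := by
  refine ⟨?_, hr⟩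
  have h1 := LinearPMap.adjoint_isFormalAdjoint (IsSelfAdjoint.dense_domain h)
  rw [LinearPMap.isSelfAdjoint_def.mp h] at h1
  exact fun x y => h1 x y

section sa
variable {T : H →ₗ.[ℂ] H}

theorem IsSA.conj_mem (hT : IsSA T) {z : ℂ} (hz : z ∈ pmResolventSet T) :
    (starRingEnd ℂ) z ∈ pmResolventSet T := by
  by_cases h : z.im = 0
  · have : (starRingEnd ℂ) z = z := Complex.conj_eq_iff_im.mpr h
    rwa [this]
  · exact hT.real _ (by simpa using h)

theorem IsSA.inner_res (hT : IsSA T) {z : ℂ} (hz : z ∈ pmResolventSet T) (x y : H) :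
    inner ℂ (res T z x) y = inner ℂ x (res T ((starRingEnd ℂ) z) y) := by
  have hz' := hT.conj_mem hz
  have h := hT.sym ⟨_, res_mem hz x⟩ ⟨_, res_mem hz' y⟩
  rw [apply_res hz, apply_res hz'] at h
  simp only [inner_add_left, inner_add_right, inner_smul_left, inner_smul_right] at h
  have h2 := add_right_cancel h
  exact h2.symm

theorem IsSA.adjoint_res (hT : IsSA T) {z : ℂ} (hz : z ∈ pmResolventSet T) :
    ContinuousLinearMap.adjoint (res T z) = res T ((starRingEnd ℂ) z) := by
  symm
  rw [ContinuousLinearMap.eq_adjoint_iff]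
  intro x y
  rw [hT.inner_res (hT.conj_mem hz)]
  simp

theorem IsSA.im_inner (hT : IsSA T) (x : T.domain) : (inner ℂ (T x) (x : H)).im = 0 := by
  have h := hT.sym x x
  have h2 := inner_conj_symm (𝕜 := ℂ) (x : H) (T x)
  rw [← h] at h2
  exact Complex.conj_eq_iff_im.mp h2

theorem IsSA.im_mul_res_le (hT : IsSA T) {z : ℂ} (hz : z ∈ pmResolventSet T) (y : H) :
    |z.im| * ‖res T z y‖ ≤ ‖y‖ := by
  set x := res T z y with hx
  have h0 := hT.im_inner ⟨x, res_mem hz y⟩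
  rw [apply_res hz] at h0
  simp only [inner_add_left, inner_smul_left, ← hx] at h0
  rw [inner_self_eq_norm_sq_to_K] at h0
  have h1 : |(inner ℂ y x).im| = |z.im| * ‖x‖ ^ 2 := by
    have : (inner ℂ y x).im = z.im * ‖x‖ ^ 2 := by
      have e : ((starRingEnd ℂ) z * ((‖x‖ : ℂ)) ^ 2).im = - z.im * ‖x‖ ^ 2 := by
        rw [← Complex.ofReal_pow, Complex.im_mul_ofReal]; simp
      have h0' : (inner ℂ y x).im + ((starRingEnd ℂ) z * ((‖x‖ : ℂ)) ^ 2).im = 0 := by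
        simpa using h0
      rw [e] at h0'; linarith
    rw [this, abs_mul, abs_of_nonneg (sq_nonneg ‖x‖)]
  have h2 : |(inner ℂ y x).im| ≤ ‖y‖ * ‖x‖ :=
    (Complex.abs_im_le_norm _).trans (norm_inner_le_norm y x)
  rcases eq_or_ne ‖x‖ 0 with h | h
  · rw [h]; simp
  · have hp : 0 < ‖x‖ := lt_of_le_of_ne (norm_nonneg _) (Ne.symm h)
    nlinarith

/-- the normal operator `(T - i)⁻¹`. -/
def Gi (T : H →ₗ.[ℂ] H) : H →L[ℂ] H := res T Complex.I

theorem IsSA.I_mem (hT : IsSA T) : Complex.I ∈ pmResolventSet T := hT.real _ (by simp)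

theorem IsSA.normal (hT : IsSA T) : IsStarNormal (Gi T) := by
  refine ⟨?_⟩
  rw [ContinuousLinearMap.star_eq_adjoint, Gi, hT.adjoint_res hT.I_mem]
  ext y
  exact res_comm (hT.conj_mem hT.I_mem) hT.I_mem y

theorem IsSA.spec (hT : IsSA T) {s : ℂ} (hs : s ∈ spectrum ℂ (Gi T)) (h0 : s ≠ 0) :
    ∃ l : ℝ, (l : ℂ) ∉ pmResolventSet T ∧ s = ((l : ℂ) - Complex.I)⁻¹ := by
  have key : Complex.I + s⁻¹ ∉ pmResolventSet T := by
    intro hz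
    refine (spectrum.mem_iff.mp hs) ?_
    set z := Complex.I + s⁻¹ with hzd
    have hzI : z - Complex.I = s⁻¹ := by rw [hzd]; ring
    have e1 : ∀ y, res T z y - Gi T y = s⁻¹ • res T z (Gi T y) := by
      intro y; have := res_identity hz hT.I_mem y; rwa [hzI] at this
    have e2 : ∀ y, res T z (Gi T y) = Gi T (res T z y) := fun y => res_comm hz hT.I_mem y
    have e3 : ∀ y, res T z (Gi T y) = s • (res T z y - Gi T y) := by
      intro y; rw [e1, smul_smul, mul_inv_cancel₀ h0, one_smul]
    set V : H →L[ℂ] H := s⁻¹ • (1 + s⁻¹ • res T z) with hV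
    have a1 : (algebraMap ℂ (H →L[ℂ] H) s - Gi T) * V = 1 := by
      ext y
      have : (algebraMap ℂ (H →L[ℂ] H) s) = s • (1 : H →L[ℂ] H) :=
        Algebra.algebraMap_eq_smul_one s
      rw [this, hV]
      simp only [ContinuousLinearMap.mul_apply, ContinuousLinearMap.sub_apply,
        ContinuousLinearMap.smul_apply, ContinuousLinearMap.add_apply,
        ContinuousLinearMap.one_apply, map_smul, map_add]
      rw [← e2 y, e3 y]
      match_scalars <;> field_simp <;> ring
    have a2 : V * (algebraMap ℂ (H →L[ℂ] H) s - Gi T) = 1 := by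
      ext y
      have : (algebraMap ℂ (H →L[ℂ] H) s) = s • (1 : H →L[ℂ] H) :=
        Algebra.algebraMap_eq_smul_one s
      rw [this, hV]
      simp only [ContinuousLinearMap.mul_apply, ContinuousLinearMap.sub_apply,
        ContinuousLinearMap.smul_apply, ContinuousLinearMap.add_apply,
        ContinuousLinearMap.one_apply, map_smul, map_add, map_sub]
      rw [e3 y]
      match_scalars <;> field_simp <;> ring
    exact ⟨⟨_, V, a1, a2⟩, rfl⟩
  have him : (Complex.I + s⁻¹).im = 0 := by
    by_contra h; exact key (hT.real _ h)
  refine ⟨(Complex.I + s⁻¹).re, ?_, ?_⟩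
  · have : (((Complex.I + s⁻¹).re : ℝ) : ℂ) = Complex.I + s⁻¹ :=
      Complex.ext (by simp) (by simpa using him.symm)
    rwa [this]
  · have : (((Complex.I + s⁻¹).re : ℝ) : ℂ) = Complex.I + s⁻¹ :=
      Complex.ext (by simp) (by simpa using him.symm)
    rw [this]; simp

theorem sub_I_ne (l : ℝ) : (l : ℂ) - Complex.I ≠ 0 := by
  intro h; have := congrArg Complex.im h; simp at this

end sa

/-- bounded perturbation -/
def addB (A : H →ₗ.[ℂ] H) (S : H →L[ℂ] H) : H →ₗ.[ℂ] H :=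
  ⟨A.domain, A.toFun + (S : H →ₗ[ℂ] H).comp A.domain.subtype⟩

theorem addB_apply (A : H →ₗ.[ℂ] H) (S : H →L[ℂ] H) (x : H) (hx : x ∈ A.domain)
    (hx' : x ∈ (addB A S).domain) : addB A S ⟨x, hx'⟩ = A ⟨x, hx⟩ + S x := rfl

section sa2
variable {T : H →ₗ.[ℂ] H}

/-- master resolvent formula -/
theorem IsSA.res_addB (hT : IsSA T) (j : ℂ → ℂ) (hj : ContinuousOn j (spectrum ℂ (Gi T)))
    (z : ℂ) (d : ℝ) (hd : 0 < d)
    (hz : ∀ l : ℝ, (l : ℂ) ∉ pmResolventSet T →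
      d ≤ ‖(l : ℂ) + j (((l : ℂ) - Complex.I)⁻¹) - z‖) :
    IsResolventOf (addB T (cfc j (Gi T))) z
      (cfc (fun s => s / (1 + (Complex.I - z + j s) * s)) (Gi T)) ∧
    ‖cfc (fun s => s / (1 + (Complex.I - z + j s) * s)) (Gi T)‖ ≤ 1 / d ∧
    ContinuousOn (fun s => s / (1 + (Complex.I - z + j s) * s)) (spectrum ℂ (Gi T)) := by
  have hn := hT.normal
  set G := Gi T with hG
  have hne : ∀ s ∈ spectrum ℂ G, 1 + (Complex.I - z + j s) * s ≠ 0 := by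
    intro s hs
    by_cases h0 : s = 0
    · simp [h0]
    · obtain ⟨l, hl, rfl⟩ := hT.spec hs h0
      have h1 := sub_I_ne l
      have h2 := hz l hl
      intro h3
      have : (l : ℂ) + j (((l : ℂ) - Complex.I)⁻¹) - z = 0 := by
        have h4 := mul_inv_cancel₀ h1
        linear_combination ((l : ℂ) - Complex.I) * h3 -
          (Complex.I - z + j (((l : ℂ) - Complex.I)⁻¹)) * h4
      rw [this, norm_zero] at h2; linarith
  have hden : ContinuousOn (fun s => 1 + (Complex.I - z + j s) * s) (spectrum ℂ G) := by
    fun_prop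
  set w : ℂ → ℂ := fun s => (1 + (Complex.I - z + j s) * s)⁻¹ with hw
  have hwc : ContinuousOn w (spectrum ℂ G) := hden.inv₀ hne
  have hR : cfc (fun s => s / (1 + (Complex.I - z + j s) * s)) G = G * cfc w G := by
    have : (fun s => s / (1 + (Complex.I - z + j s) * s)) = fun s : ℂ => id s * w s := by
      funext s; simp [hw, div_eq_mul_inv]
    rw [this, cfc_mul id w G continuousOn_id hwc, cfc_id ℂ G]
  have hR' : G * cfc w G = cfc w G * G := by
    have := (cfc_commute_cfc (id : ℂ → ℂ) w G).eq
    rwa [cfc_id ℂ G] at this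
  have hE : cfc w G + (Complex.I - z) • (G * cfc w G) + cfc j G * (G * cfc w G) = 1 := by
    have e1 : G * cfc w G = cfc (fun s => s * w s) G := by
      have := cfc_mul id w G continuousOn_id hwc
      rw [cfc_id ℂ G] at this; exact this.symm
    have c1 : ContinuousOn (fun s : ℂ => s * w s) (spectrum ℂ G) := continuousOn_id.mul hwc
    rw [e1, ← cfc_mul j (fun s => s * w s) G hj c1,
      ← cfc_const_mul (Complex.I - z) (fun s => s * w s) G c1,
      ← cfc_add (a := G) (f := w) (hf := hwc) (hg := by fun_prop),
      ← cfc_add (a := G) (hf := by fun_prop) (hg := by fun_prop),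
      ← cfc_one ℂ G]
    apply cfc_congr
    intro s hs
    have := hne s hs
    simp only [hw, Pi.one_apply]
    field_simp
    ring
  have hjc : cfc j G * G = G * cfc j G := by
    have := (cfc_commute_cfc j (id : ℂ → ℂ) G).eq
    rwa [cfc_id ℂ G] at this
  have hjw : cfc j G * cfc w G = cfc w G * cfc j G := (cfc_commute_cfc j w G).eq
  have hdom : ∀ y, G y ∈ T.domain := fun y => res_mem hT.I_mem y
  have hTG : ∀ y, T ⟨G y, hdom y⟩ = y + Complex.I • G y := fun y => apply_res hT.I_mem y _
  refine ⟨?_, ?_, ?_⟩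
  · rw [hR]
    constructor
    · rintro ⟨x, hx⟩
      have hx' : x ∈ T.domain := hx
      have hGx := res_apply_sub hT.I_mem ⟨x, hx'⟩
      set y := T ⟨x, hx'⟩ - Complex.I • x with hy
      have hGx : G y = x := hGx
      have hTx : T ⟨x, hx'⟩ = y + Complex.I • x := by rw [hy]; abel
      rw [addB_apply T _ x hx' hx, hTx]
      have := congrArg (fun f : H →L[ℂ] H => G (f y)) hE
      simp only [ContinuousLinearMap.add_apply, ContinuousLinearMap.smul_apply,
        ContinuousLinearMap.mul_apply, ContinuousLinearMap.one_apply] at this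
      rw [hGx] at this
      change (G * cfc w G) (y + Complex.I • x + cfc j G x - z • x) = x
      refine Eq.trans ?_ this
      rw [hR']
      simp only [ContinuousLinearMap.mul_apply, map_add, map_sub, map_smul]
      have k1 : G (cfc w G y) = cfc w G (G y) := congrArg (fun f : H →L[ℂ] H => f y) hR'
      have k2 : ∀ v, G (cfc w G v) = cfc w G (G v) :=
        fun v => congrArg (fun f : H →L[ℂ] H => f v) hR'
      have k3 : ∀ v, cfc j G (G v) = G (cfc j G v) :=
        fun v => congrArg (fun f : H →L[ℂ] H => f v) hjc
      have k4 : ∀ v, cfc j G (cfc w G v) = cfc w G (cfc j G v) :=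
        fun v => congrArg (fun f : H →L[ℂ] H => f v) hjw
      simp only [k3, k4, k2, hGx]
      have : cfc j G x = G (cfc j G y) := by rw [← k3, hGx]
      rw [this]
      module
    · intro y
      refine ⟨hdom _, ?_⟩
      have := congrArg (fun f : H →L[ℂ] H => f y) hE
      simp only [ContinuousLinearMap.add_apply, ContinuousLinearMap.smul_apply,
        ContinuousLinearMap.mul_apply, ContinuousLinearMap.one_apply] at this
      have h2 := hTG (cfc w G y)
      change T ⟨G (cfc w G y), _⟩ + cfc j G (G (cfc w G y)) - z • G (cfc w G y) = y
      rw [h2]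
      conv_rhs => rw [← this]
      module
  · refine norm_cfc_le (by positivity) ?_
    intro s hs
    by_cases h0 : s = 0
    · simp [h0, hd.le]
    · obtain ⟨l, hl, rfl⟩ := hT.spec hs h0
      have h1 := sub_I_ne l
      have h2 := hz l hl
      have : ((l : ℂ) - Complex.I)⁻¹ / (1 + (Complex.I - z + j (((l : ℂ) - Complex.I)⁻¹)) *
          ((l : ℂ) - Complex.I)⁻¹) = ((l : ℂ) + j (((l : ℂ) - Complex.I)⁻¹) - z)⁻¹ := by
        have h3 : (1 + (Complex.I - z + j (((l : ℂ) - Complex.I)⁻¹)) *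
          ((l : ℂ) - Complex.I)⁻¹) = ((l : ℂ) + j (((l : ℂ) - Complex.I)⁻¹) - z) *
            ((l : ℂ) - Complex.I)⁻¹ := by
          have h4 := mul_inv_cancel₀ h1
          linear_combination -h4
        rw [h3, div_mul_cancel_right₀ (inv_ne_zero h1)]
      rw [this, norm_inv, one_div]
      exact inv_anti₀ hd h2
  · exact continuousOn_id.div hden hne

end sa2

end PM

namespace PM
open Filter Topology

section sa3
variable {T : H →ₗ.[ℂ] H}

theorem IsSA.chi_cont (hT : IsSA T) {ν : ℝ}
    (hiso : ∀ᶠ l : ℝ in 𝓝 ν, (l : ℂ) ∉ pmResolventSet T → l = ν) :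
    ContinuousOn (fun s : ℂ => if s = ((ν : ℂ) - Complex.I)⁻¹ then (1 : ℂ) else 0)
      (spectrum ℂ (Gi T)) := by
  intro s0 hs0
  by_cases h : s0 = ((ν : ℂ) - Complex.I)⁻¹
  · have hne : s0 ≠ 0 := by rw [h]; exact inv_ne_zero (sub_I_ne ν)
    have hc : ContinuousAt (fun s : ℂ => (Complex.I + s⁻¹).re) s0 :=
      Complex.continuous_re.continuousAt.comp (continuousAt_const.add (continuousAt_inv₀ hne))
    have hv : (Complex.I + s0⁻¹).re = ν := by rw [h]; simp
    have h1 : ∀ᶠ s in 𝓝 s0, ((((Complex.I + s⁻¹).re : ℝ) : ℂ) ∉ pmResolventSet T →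
        (Complex.I + s⁻¹).re = ν) := by
      have : Tendsto (fun s : ℂ => (Complex.I + s⁻¹).re) (𝓝 s0) (𝓝 ν) := by
        have := hc.tendsto; rwa [hv] at this
      exact this.eventually hiso
    have h2 : ∀ᶠ s in 𝓝[spectrum ℂ (Gi T)] s0, s = ((ν : ℂ) - Complex.I)⁻¹ := by
      filter_upwards [nhdsWithin_le_nhds h1, nhdsWithin_le_nhds (isOpen_ne.mem_nhds hne),
        self_mem_nhdsWithin] with s h1 h2 h3
      obtain ⟨l, hl, rfl⟩ := hT.spec h3 h2
      have e : (Complex.I + (((l : ℂ) - Complex.I)⁻¹)⁻¹).re = l := by simp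
      rw [e] at h1
      rw [h1 hl]
    refine (continuousWithinAt_const (b := (1 : ℂ))).congr_of_eventuallyEq ?_ ?_
    · filter_upwards [h2] with s hs; rw [if_pos hs]
    · rw [if_pos h]
  · refine (continuousWithinAt_const (b := (0 : ℂ))).congr_of_eventuallyEq ?_ ?_
    · filter_upwards [nhdsWithin_le_nhds (isOpen_ne.mem_nhds h)] with s hs; rw [if_neg hs]
    · rw [if_neg h]

theorem IsSA.specProj (hT : IsSA T) (F : Finset ℝ)
    (hiso : ∀ ν ∈ F, ∀ᶠ l : ℝ in 𝓝 ν, (l : ℂ) ∉ pmResolventSet T → l = ν) :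
    ∃ E : H →L[ℂ] H, (∀ x y, inner ℂ (E x) y = inner ℂ x (E y)) ∧ E.comp E = E ∧
      LinearMap.range (E : H →ₗ[ℂ] H) ≤ F.sup (fun ν : ℝ => pmEigenspace T (ν : ℂ)) ∧
      ∀ (σ z : ℂ) (d : ℝ), 0 < d →
        (∀ l : ℝ, (l : ℂ) ∉ pmResolventSet T → d ≤ ‖(l : ℂ) + (if l ∈ F then σ else 0) - z‖) →
        ∃ R, IsResolventOf (addB T (σ • E)) z R ∧ ‖R‖ ≤ 1 / d := by
  have hn := hT.normal
  set G := Gi T with hG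
  set χ : ℝ → ℂ → ℂ := fun ν s => if s = ((ν : ℂ) - Complex.I)⁻¹ then (1 : ℂ) else 0 with hχ
  have hχc : ∀ ν ∈ F, ContinuousOn (χ ν) (spectrum ℂ G) := fun ν hν => hT.chi_cont (hiso ν hν)
  have hinj : ∀ a b : ℝ, ((a : ℂ) - Complex.I)⁻¹ = ((b : ℂ) - Complex.I)⁻¹ ↔ a = b := by
    intro a b
    rw [inv_inj]
    simp
  set j : ℂ → ℂ := ∑ ν ∈ F, χ ν with hj
  have hjc : ContinuousOn j (spectrum ℂ G) := by
    rw [hj]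
    have : (∑ ν ∈ F, χ ν) = fun s => ∑ ν ∈ F, χ ν s := by ext; simp
    rw [this]
    exact continuousOn_finsetSum _ hχc
  have hjv : ∀ l : ℝ, j (((l : ℂ) - Complex.I)⁻¹) = if l ∈ F then 1 else 0 := by
    intro l
    simp only [hj, hχ, Finset.sum_apply, hinj]
    simp
  have hj01 : ∀ s, j s = 0 ∨ j s = 1 := by
    intro s
    by_cases h : ∃ ν ∈ F, s = ((ν : ℂ) - Complex.I)⁻¹
    · obtain ⟨ν, hν, rfl⟩ := h
      right; rw [hjv, if_pos hν]
    · left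
      push Not at h
      simp only [hj, Finset.sum_apply]
      exact Finset.sum_eq_zero fun ν hν => if_neg (h ν hν)
  refine ⟨cfc j G, ?_, ?_, ?_, ?_⟩
  · have hs : star (cfc j G) = cfc j G := by
      rw [← cfc_star]
      congr 1
      funext s
      rcases hj01 s with h | h <;> simp [h]
    intro x y
    rw [ContinuousLinearMap.star_eq_adjoint] at hs
    rw [← ContinuousLinearMap.adjoint_inner_right, hs]
  · change cfc j G * cfc j G = cfc j G
    rw [← cfc_mul j j G hjc hjc]
    congr 1
    funext s
    rcases hj01 s with h | h <;> simp [h]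
  · rintro _ ⟨y, rfl⟩
    have : cfc j G = ∑ ν ∈ F, cfc (χ ν) G := cfc_sum χ G F hχc
    change cfc j G y ∈ _
    rw [this, ContinuousLinearMap.sum_apply]
    refine Submodule.sum_mem _ fun ν hν => ?_
    refine (Finset.le_sup (f := fun ν : ℝ => pmEigenspace T (ν : ℂ)) hν) ?_
    have e1 : G * cfc (χ ν) G = ((ν : ℂ) - Complex.I)⁻¹ • cfc (χ ν) G := by
      rw [← cfc_const_mul _ _ G (hχc ν hν)]
      have := cfc_mul id (χ ν) G continuousOn_id (hχc ν hν)
      rw [cfc_id ℂ G] at this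
      rw [← this]
      congr 1
      funext s
      simp only [hχ, id]
      split_ifs with h
      · rw [h]
      · simp
    have e2 := congrArg (fun f : H →L[ℂ] H => f y) e1
    set u := cfc (χ ν) G y with hu
    have e2 : G u = ((ν : ℂ) - Complex.I)⁻¹ • u := e2
    have e3 : u = G (((ν : ℂ) - Complex.I) • u) := by
      rw [map_smul, e2, smul_smul, mul_inv_cancel₀ (sub_I_ne ν), one_smul]
    have hm : u ∈ T.domain := by rw [e3]; exact res_mem hT.I_mem _
    refine ⟨⟨u, hm⟩, ?_, rfl⟩
    have h5 : ∀ (v : H) (hv : v ∈ T.domain), v = G (((ν : ℂ) - Complex.I) • u) →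
        T ⟨v, hv⟩ = ((ν : ℂ) - Complex.I) • u + Complex.I • v := by
      rintro v hv rfl
      exact apply_res hT.I_mem _ _
    have h6 := h5 u hm e3
    change T ⟨u, hm⟩ - (ν : ℂ) • u = 0
    rw [h6]; module
  · intro σ z d hd h
    obtain ⟨h1, h2, -⟩ := hT.res_addB (fun s => σ * j s) (by fun_prop) z d hd (by
      intro l hl
      have := h l hl
      simp only [hjv]
      simpa using this)
    rw [cfc_const_mul _ _ _ hjc] at h1
    exact ⟨_, h1, h2⟩

theorem addB_zero (A : H →ₗ.[ℂ] H) : addB A 0 = A := by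
  refine LinearPMap.ext rfl ?_
  intro x y hx
  change A ⟨x, hx⟩ + (0 : H →L[ℂ] H) x = A ⟨x, hx⟩
  simp

theorem IsSA.res_eq_cfc (hT : IsSA T) {z : ℂ} (hz : z ∈ pmResolventSet T) :
    res T z = cfc (fun s => s / (1 + (Complex.I - z) * s)) (Gi T) ∧
    (∀ s ∈ spectrum ℂ (Gi T), 1 + (Complex.I - z) * s ≠ 0) := by
  have hn := hT.normal
  obtain ⟨d, hd, hball⟩ := Metric.isOpen_iff.mp (isOpen_rho T) z hz
  obtain ⟨h1, h2, h3⟩ := hT.res_addB (fun s => 0) continuousOn_const z d hd (by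
    intro l hl
    by_contra h
    push Not at h
    exact hl (hball (by simpa [dist_eq_norm] using h)))
  simp only [cfc_const_zero, addB_zero, add_zero] at h1
  refine ⟨eq_res_of_isResolventOf h1, ?_⟩
  intro s hs
  by_cases h0 : s = 0
  · simp [h0]
  obtain ⟨l, hl, rfl⟩ := hT.spec hs h0
  have h1 := sub_I_ne l
  intro h
  have : (l : ℂ) = z := by
    have h4 := mul_inv_cancel₀ h1
    linear_combination ((l : ℂ) - Complex.I) * h - (Complex.I - z) * h4
  exact hl (this ▸ hz)

theorem IsSA.norm_res_le (hT : IsSA T) {z : ℂ} {d : ℝ} (hd : 0 < d)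
    (h : ∀ l : ℝ, (l : ℂ) ∉ pmResolventSet T → d ≤ ‖(l : ℂ) - z‖) :
    z ∈ pmResolventSet T ∧ ‖res T z‖ ≤ 1 / d := by
  have hn := hT.normal
  obtain ⟨h1, h2, h3⟩ := hT.res_addB (fun s => 0) continuousOn_const z d hd (by
    intro l hl; simpa using h l hl)
  rw [cfc_const_zero, addB_zero] at h1
  exact ⟨⟨_, h1⟩, by rw [eq_res_of_isResolventOf h1]; exact h2⟩

/-- the square function estimate -/
theorem IsSA.square (hT : IsSA T) {ι : Type*} (F : Finset ι) (a b : ι → ℝ) (γ : ι → ℝ → ℂ)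
    (w : ι → ℝ → ℝ)
    (hγ : ∀ i ∈ F, ContinuousOn (γ i) (Set.Icc (a i) (b i)))
    (hw : ∀ i ∈ F, ContinuousOn (w i) (Set.Icc (a i) (b i)))
    (hw0 : ∀ i ∈ F, ∀ x ∈ Set.Icc (a i) (b i), 0 ≤ w i x)
    (hρ : ∀ i ∈ F, ∀ x ∈ Set.Icc (a i) (b i), γ i x ∈ pmResolventSet T)
    (C : ℝ) (hC0 : 0 ≤ C)
    (hC : ∀ l : ℝ, (l : ℂ) ∉ pmResolventSet T →
      ∑ i ∈ F, ∫ x in Set.Icc (a i) (b i), w i x / ‖(l : ℂ) - γ i x‖ ^ 2 ≤ C) (v : H) :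
    ∑ i ∈ F, ∫ x in Set.Icc (a i) (b i), w i x * ‖res T (γ i x) v‖ ^ 2 ≤ C * ‖v‖ ^ 2 := by
  have hn := hT.normal
  set G := Gi T with hG
  set φ : ι → ℝ → ℂ → ℂ := fun i x s => s / (1 + (Complex.I - γ i x) * s) with hφ
  set f : ι → ℝ → ℂ → ℂ := fun i x s => (w i x : ℂ) * (star (φ i x s) * φ i x s) with hf
  have hφc : ∀ i ∈ F, ContinuousOn (Function.uncurry (φ i))
      (Set.Icc (a i) (b i) ×ˢ spectrum ℂ G) := by
    intro i hi
    have h1 : ContinuousOn (fun q : ℝ × ℂ => γ i q.1) (Set.Icc (a i) (b i) ×ˢ spectrum ℂ G) :=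
      (hγ i hi).comp continuousOn_fst fun q hq => hq.1
    refine ContinuousOn.div continuousOn_snd ?_ ?_
    · exact continuousOn_const.add ((continuousOn_const.sub h1).mul continuousOn_snd)
    · rintro ⟨x, s⟩ ⟨hx, hs⟩
      exact (hT.res_eq_cfc (hρ i hi x hx)).2 s hs
  have hfc : ∀ i ∈ F, ContinuousOn (Function.uncurry (f i))
      (Set.Icc (a i) (b i) ×ˢ spectrum ℂ G) := by
    intro i hi
    have h1 : ContinuousOn (fun q : ℝ × ℂ => (w i q.1 : ℂ))
        (Set.Icc (a i) (b i) ×ˢ spectrum ℂ G) :=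
      Complex.continuous_ofReal.comp_continuousOn
        ((hw i hi).comp continuousOn_fst fun q hq => hq.1)
    exact h1.mul ((continuous_star.comp_continuousOn (hφc i hi)).mul (hφc i hi))
  have hK : ∀ i ∈ F, ∃ K, ∀ q ∈ Set.Icc (a i) (b i) ×ˢ spectrum ℂ G,
      ‖Function.uncurry (f i) q‖ ≤ K := fun i hi =>
    (isCompact_Icc.prod (spectrum.isCompact G)).exists_bound_of_continuousOn (hfc i hi)
  have hsl : ∀ i ∈ F, ∀ s ∈ spectrum ℂ G, ContinuousOn (fun x => f i x s)
      (Set.Icc (a i) (b i)) := fun i hi s hs =>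
    (hfc i hi).comp (f := fun x : ℝ => (x, s)) (by fun_prop) fun x hx => ⟨hx, hs⟩
  have hsr : ∀ i ∈ F, ∀ x ∈ Set.Icc (a i) (b i), ContinuousOn (f i x) (spectrum ℂ G) :=
    fun i hi x hx =>
    (hfc i hi).comp (f := fun s : ℂ => (x, s)) (by fun_prop) fun s hs => ⟨hx, hs⟩
  have hsr' : ∀ i ∈ F, ∀ x ∈ Set.Icc (a i) (b i), ContinuousOn (φ i x) (spectrum ℂ G) :=
    fun i hi x hx =>
    (hφc i hi).comp (f := fun s : ℂ => (x, s)) (by fun_prop) fun s hs => ⟨hx, hs⟩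
  -- the integrated functions
  set g : ι → ℂ → ℂ := fun i s => ∫ x in Set.Icc (a i) (b i), f i x s with hg
  have hgc : ∀ i ∈ F, ContinuousOn (g i) (spectrum ℂ G) := by
    intro i hi
    obtain ⟨K, hK⟩ := hK i hi
    refine MeasureTheory.continuousOn_of_dominated (bound := fun _ => K) ?_ ?_ ?_ ?_
    · intro s hs
      exact (hsl i hi s hs).aestronglyMeasurable measurableSet_Icc
    · intro s hs
      filter_upwards [MeasureTheory.ae_restrict_mem measurableSet_Icc] with x hx
      exact hK (x, s) ⟨hx, hs⟩
    · exact MeasureTheory.integrable_const _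
    · filter_upwards [MeasureTheory.ae_restrict_mem measurableSet_Icc] with x hx
      exact hsr i hi x hx
  have hcfc : ∀ i ∈ F, cfc (g i) G = ∫ x in Set.Icc (a i) (b i), cfc (f i x) G := by
    intro i hi
    obtain ⟨K, hK⟩ := hK i hi
    refine cfc_setIntegral measurableSet_Icc (f i) (fun _ => K) G (hfc i hi) ?_ ?_ hn
    · filter_upwards [MeasureTheory.ae_restrict_mem measurableSet_Icc] with x hx
      exact fun s hs => hK (x, s) ⟨hx, hs⟩
    · exact (MeasureTheory.integrable_const K).2
  have hval : ∀ i ∈ F, ∀ x ∈ Set.Icc (a i) (b i),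
      cfc (f i x) G = (w i x : ℂ) • (star (res T (γ i x)) * res T (γ i x)) := by
    intro i hi x hx
    have c1 := hsr' i hi x hx
    have c2 : ContinuousOn (fun s => star (φ i x s)) (spectrum ℂ G) :=
      continuous_star.comp_continuousOn c1
    rw [(hT.res_eq_cfc (hρ i hi x hx)).1]
    change cfc (fun s => (w i x : ℂ) * (star (φ i x s) * φ i x s)) G
      = (w i x : ℂ) • (star (cfc (φ i x) G) * cfc (φ i x) G)
    rw [cfc_const_mul _ (fun s => star (φ i x s) * φ i x s) G (c2.mul c1), cfc_mul _ _ G c2 c1, cfc_star]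
  have hint : ∀ i ∈ F, MeasureTheory.IntegrableOn (fun x => cfc (f i x) G)
      (Set.Icc (a i) (b i)) := by
    intro i hi
    have hr : ContinuousOn (fun x => res T (γ i x)) (Set.Icc (a i) (b i)) :=
      (continuousOn_res T).comp (hγ i hi) fun x hx => hρ i hi x hx
    have : ContinuousOn (fun x => (w i x : ℂ) • (star (res T (γ i x)) * res T (γ i x)))
        (Set.Icc (a i) (b i)) :=
      (Complex.continuous_ofReal.comp_continuousOn (hw i hi)).smul
        ((continuous_star.comp_continuousOn hr).mul hr)
    exact (this.congr (hval i hi)).integrableOn_compact isCompact_Icc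
  -- the functional
  set L : (H →L[ℂ] H) →L[ℝ] ℝ := Complex.reCLM.comp (((innerSL ℂ v).comp
    (ContinuousLinearMap.apply ℂ H v)).restrictScalars ℝ) with hL
  have hLv : ∀ S, L S = (inner ℂ v (S v)).re := fun S => rfl
  have e1 : ∀ i ∈ F, ∫ x in Set.Icc (a i) (b i), w i x * ‖res T (γ i x) v‖ ^ 2
      = L (cfc (g i) G) := by
    intro i hi
    rw [hcfc i hi, ← ContinuousLinearMap.integral_comp_comm L (hint i hi)]
    refine MeasureTheory.setIntegral_congr_fun measurableSet_Icc fun x hx => ?_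
    rw [hval i hi x hx, hLv]
    simp only [ContinuousLinearMap.smul_apply, ContinuousLinearMap.mul_apply, inner_smul_right]
    rw [ContinuousLinearMap.star_eq_adjoint, ContinuousLinearMap.adjoint_inner_right,
      inner_self_eq_norm_sq_to_K]
    rw [Complex.re_ofReal_mul]
    congr 1
    norm_cast
  rw [Finset.sum_congr rfl e1, ← map_sum, ← cfc_sum g G F hgc, hLv]
  have hnorm : ‖cfc (∑ i ∈ F, g i) G‖ ≤ C := by
    refine norm_cfc_le hC0 ?_
    intro s hs
    by_cases h0 : s = 0
    · have : ∀ i ∈ F, g i s = 0 := by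
        intro i hi
        simp [hg, hf, hφ, h0]
      rw [Finset.sum_apply, Finset.sum_eq_zero this, norm_zero]; exact hC0
    · obtain ⟨l, hl, hsl'⟩ := hT.spec hs h0
      have h1 := sub_I_ne l
      have key : ∀ i ∈ F, g i s =
          ((∫ x in Set.Icc (a i) (b i), w i x / ‖(l : ℂ) - γ i x‖ ^ 2 : ℝ) : ℂ) := by
        intro i hi
        refine Eq.trans ?_ (integral_ofReal (𝕜 := ℂ))
        refine MeasureTheory.setIntegral_congr_fun measurableSet_Icc fun x hx => ?_
        have e : φ i x s = ((l : ℂ) - γ i x)⁻¹ := by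
          have h3 : 1 + (Complex.I - γ i x) * s = ((l : ℂ) - γ i x) * s := by
            have h4 := mul_inv_cancel₀ h1
            rw [hsl']
            linear_combination -h4
          simp only [hφ]
          rw [h3, div_mul_cancel_right₀ h0]
        simp only [hf]
        rw [e]
        have : star ((l : ℂ) - γ i x)⁻¹ * ((l : ℂ) - γ i x)⁻¹
            = ((‖(l : ℂ) - γ i x‖ ^ 2 : ℝ) : ℂ)⁻¹ := by
          rw [star_inv₀, ← mul_inv]
          congr 1
          have := Complex.conj_mul' ((l : ℂ) - γ i x)
          push_cast
          exact this
        rw [this]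
        push_cast
        rfl
      rw [Finset.sum_apply, Finset.sum_congr rfl key, ← Complex.ofReal_sum, Complex.norm_real,
        Real.norm_eq_abs, abs_of_nonneg]
      · exact hC l hl
      · refine Finset.sum_nonneg fun i hi => ?_
        refine MeasureTheory.setIntegral_nonneg measurableSet_Icc fun x hx => ?_
        exact div_nonneg (hw0 i hi x hx) (by positivity)
  calc (inner ℂ v (cfc (∑ i ∈ F, g i) G v)).re ≤ ‖inner ℂ v (cfc (∑ i ∈ F, g i) G v)‖ :=
        Complex.re_le_norm _
    _ ≤ ‖v‖ * (‖cfc (∑ i ∈ F, g i) G‖ * ‖v‖) :=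
        (norm_inner_le_norm _ _).trans (by gcongr; exact ContinuousLinearMap.le_opNorm _ _)
    _ ≤ ‖v‖ * (C * ‖v‖) := by gcongr
    _ = C * ‖v‖ ^ 2 := by ring

end sa3

end PM

namespace PM
open Filter Topology

/-- perturbation by an operator defined on the domain -/
def addC (A : H →ₗ.[ℂ] H) (C : A.domain →ₗ[ℂ] H) : H →ₗ.[ℂ] H := ⟨A.domain, A.toFun + C⟩

theorem addC_apply (A : H →ₗ.[ℂ] H) (C : A.domain →ₗ[ℂ] H) (x : H) (hx : x ∈ A.domain)
    (hx' : x ∈ (addC A C).domain) : addC A C ⟨x, hx'⟩ = A ⟨x, hx⟩ + C ⟨x, hx⟩ := rfl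

/-- Neumann series perturbation. -/
theorem pert {A : H →ₗ.[ℂ] H} {z : ℂ} (hz : z ∈ pmResolventSet A) (C : A.domain →ₗ[ℂ] H)
    {q : ℝ} (hq0 : 0 ≤ q) (hq : q < 1) (hC : ∀ y, ‖C ⟨res A z y, res_mem hz y⟩‖ ≤ q * ‖y‖) :
    z ∈ pmResolventSet (addC A C) ∧ (∀ y, ∃ u, res (addC A C) z y = res A z u ∧
      ‖u‖ ≤ ‖y‖ / (1 - q)) := by
  set K : H →L[ℂ] H := LinearMap.mkContinuous
    { toFun := fun y => C ⟨res A z y, res_mem hz y⟩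
      map_add' := by
        intro x y
        rw [← map_add]; congr 1; ext; simp
      map_smul' := by
        intro c y
        rw [RingHom.id_apply, ← map_smul]; congr 1; ext; simp } q hC with hK
  have hKv : ∀ y, K y = C ⟨res A z y, res_mem hz y⟩ := fun y => rfl
  have hKn : ‖-K‖ < 1 := by
    rw [norm_neg]; exact (LinearMap.mkContinuous_norm_le _ hq0 _).trans_lt hq
  set U := Units.oneSub (-K) hKn with hU
  set S : H →L[ℂ] H := (↑(U⁻¹) : H →L[ℂ] H) with hS
  have hU' : (U : H →L[ℂ] H) = 1 + K := by
    rw [hU, Units.val_oneSub, sub_neg_eq_add]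
  have h1 : ∀ y, S y + K (S y) = y := by
    intro y
    have := congrArg (fun f : H →L[ℂ] H => f y) (U.mul_inv)
    simp only [ContinuousLinearMap.mul_apply, hU', ContinuousLinearMap.add_apply,
      ContinuousLinearMap.one_apply] at this
    exact this
  have h2 : ∀ y, S (y + K y) = y := by
    intro y
    have := congrArg (fun f : H →L[ℂ] H => f y) (U.inv_mul)
    simp only [ContinuousLinearMap.mul_apply, hU', ContinuousLinearMap.add_apply,
      ContinuousLinearMap.one_apply] at this
    exact this
  have hSn : ∀ y, ‖S y‖ ≤ ‖y‖ / (1 - q) := by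
    intro y
    rw [le_div_iff₀ (by linarith)]
    have a1 : ‖S y‖ ≤ ‖y‖ + ‖K (S y)‖ := by
      have : S y = y - K (S y) := by rw [eq_sub_iff_add_eq]; exact h1 y
      calc ‖S y‖ = ‖y - K (S y)‖ := by rw [← this]
        _ ≤ _ := norm_sub_le _ _
    have a2 : ‖K (S y)‖ ≤ q * ‖S y‖ := hC (S y)
    linarith
  have hR : IsResolventOf (addC A C) z ((res A z).comp S) := by
    constructor
    · rintro ⟨x, hx⟩
      have hx' : x ∈ A.domain := hx
      have hGx := res_apply_sub hz ⟨x, hx'⟩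
      set y := A ⟨x, hx'⟩ - z • x with hy
      have hGx : res A z y = x := hGx
      have hKy : K y = C ⟨x, hx'⟩ := by
        rw [hKv]; congr 1; ext; exact hGx
      change res A z (S (A ⟨x, hx'⟩ + C ⟨x, hx'⟩ - z • x)) = x
      have : A ⟨x, hx'⟩ + C ⟨x, hx'⟩ - z • x = y + K y := by rw [hKy, hy]; abel
      rw [this, h2, hGx]
    · intro y
      refine ⟨res_mem hz _, ?_⟩
      change A ⟨res A z (S y), _⟩ + C ⟨res A z (S y), _⟩ - z • res A z (S y) = y
      rw [apply_res hz (S y), ← hKv]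
      conv_rhs => rw [← h1 y]
      abel
  refine ⟨⟨_, hR⟩, fun y => ⟨S y, ?_, hSn y⟩⟩
  rw [eq_res_of_isResolventOf hR]; rfl

section fr
variable {m : ℕ}

/-- the perturbation matrix -/
def frM (A' : H →ₗ.[ℂ] H) (e : Fin m → H) (σ z : ℂ) : Matrix (Fin m) (Fin m) ℂ :=
  1 - σ • Matrix.of (fun i j => inner ℂ (e i) (res A' z (e j)))

/-- finite rank perturbation -/
theorem finrank_pert {A : H →ₗ.[ℂ] H} {E : H →L[ℂ] H} {e : Fin m → H}
    (hE : ∀ x, E x = ∑ i, inner ℂ (e i) x • e i) (he : ∀ i, ‖e i‖ ≤ 1) {σ z : ℂ}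
    (hz : z ∈ pmResolventSet (addB A (σ • E)))
    (hdet : (frM (addB A (σ • E)) e σ z).det ≠ 0) {L : ℝ}
    (hL : ∀ i j, ‖(frM (addB A (σ • E)) e σ z)⁻¹ i j‖ ≤ L) :
    z ∈ pmResolventSet A ∧ ∀ y, ∃ u, res A z y = res (addB A (σ • E)) z u ∧
      ‖u‖ ≤ (1 + ‖σ‖ * (m * (m * (L * ‖res (addB A (σ • E)) z‖)))) * ‖y‖ := by
  set A' := addB A (σ • E) with hA'
  set R' := res A' z with hR'
  set M : Matrix (Fin m) (Fin m) ℂ := Matrix.of (fun i j => inner ℂ (e i) (R' (e j))) with hM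
  set F := frM A' e σ z with hF
  have hFM : F = 1 - σ • M := rfl
  set N := F⁻¹ with hN
  have hFN : F * N = 1 := Matrix.mul_nonsing_inv F (Ne.isUnit hdet)
  have hNF : N * F = 1 := Matrix.nonsing_inv_mul F (Ne.isUnit hdet)
  set c : H → Fin m → ℂ := fun y j => inner ℂ (e j) (R' y) with hc
  set uu : H → H := fun y => y + σ • ∑ i, (N.mulVec (c y)) i • e i with huu
  have hdom : ∀ y, R' y ∈ A.domain := fun y => res_mem hz y
  have hAR : ∀ y, A ⟨R' y, hdom y⟩ = y + z • R' y - σ • E (R' y) := by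
    intro y
    have := apply_res hz y (res_mem hz y)
    change A ⟨R' y, hdom y⟩ + σ • E (R' y) = y + z • R' y at this
    rw [← this]; abel
  have hER : ∀ y, E (R' y) = ∑ i, c y i • e i := fun y => hE _
  have hcadd : ∀ y, c (uu y) = c y + σ • M.mulVec (N.mulVec (c y)) := by
    intro y
    funext j
    simp only [hc, huu, map_add, map_smul, map_sum, inner_add_right, inner_smul_right, inner_sum,
      Pi.add_apply, Pi.smul_apply, smul_eq_mul]
    congr 2
    simp only [Matrix.mulVec, dotProduct, hM, Matrix.of_apply]
    refine Finset.sum_congr rfl fun i _ => ?_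
    ring
  have hright : ∀ y, A ⟨R' (uu y), hdom _⟩ - z • R' (uu y) = y := by
    intro y
    rw [hAR, hER, hcadd]
    have e1 : N.mulVec (c y) - σ • M.mulVec (N.mulVec (c y)) = c y := by
      have : F.mulVec (N.mulVec (c y)) = c y := by
        rw [Matrix.mulVec_mulVec, hFN, Matrix.one_mulVec]
      rw [hFM, Matrix.sub_mulVec, Matrix.one_mulVec, Matrix.smul_mulVec] at this
      exact this
    have e2 : N.mulVec (c y) = c y + σ • M.mulVec (N.mulVec (c y)) := by
      rw [← sub_eq_iff_eq_add]; exact e1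
    rw [← e2]
    simp only [huu]
    abel
  have hinj : ∀ (x : H) (hx : x ∈ A.domain), A ⟨x, hx⟩ - z • x = 0 → x = 0 := by
    intro x hx h0
    have h1 : res A' z (σ • E x) = x := by
      refine eq_res hz (show x ∈ A'.domain from hx) ?_
      change A ⟨x, hx⟩ + σ • E x - z • x = σ • E x
      rw [sub_eq_zero.mp h0]; abel
    set a : Fin m → ℂ := fun i => inner ℂ (e i) x with ha
    have hEx : E x = ∑ i, a i • e i := hE x
    have h2 : a = σ • M.mulVec a := by
      funext i
      have : a i = inner ℂ (e i) (R' (σ • E x)) := by rw [hR', h1]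
      rw [this, hEx]
      simp only [map_smul, map_sum, inner_smul_right, inner_sum, Pi.smul_apply, smul_eq_mul,
        Matrix.mulVec, dotProduct, hM, Matrix.of_apply]
      congr 1
      exact Finset.sum_congr rfl fun i _ => by ring
    have h3 : F.mulVec a = 0 := by
      rw [hFM, Matrix.sub_mulVec, Matrix.one_mulVec, Matrix.smul_mulVec, ← h2, sub_self]
    have h4 : a = 0 := by
      have : N.mulVec (F.mulVec a) = a := by
        rw [Matrix.mulVec_mulVec, hNF, Matrix.one_mulVec]
      rw [← this, h3, Matrix.mulVec_zero]
    rw [← h1, hEx, h4]; simp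
  have hb : ∀ y, ‖uu y‖ ≤ (1 + ‖σ‖ * (m * (m * (L * ‖R'‖)))) * ‖y‖ := by
    intro y
    have hcb : ∀ j, ‖c y j‖ ≤ ‖R'‖ * ‖y‖ := by
      intro j
      calc ‖c y j‖ ≤ ‖e j‖ * ‖R' y‖ := norm_inner_le_norm _ _
        _ ≤ 1 * (‖R'‖ * ‖y‖) := by
          gcongr
          · exact he j
          · exact R'.le_opNorm y
        _ = _ := one_mul _
    have hs : ‖∑ i, (N.mulVec (c y)) i • e i‖ ≤ m * (m * (L * ‖R'‖)) * ‖y‖ := by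
      calc ‖∑ i, (N.mulVec (c y)) i • e i‖ ≤ ∑ i : Fin m, ‖(N.mulVec (c y)) i • e i‖ :=
            norm_sum_le _ _
        _ ≤ ∑ i : Fin m, (m * (L * (‖R'‖ * ‖y‖))) := by
          refine Finset.sum_le_sum fun i _ => ?_
          rw [norm_smul]
          have : ‖N.mulVec (c y) i‖ ≤ m * (L * (‖R'‖ * ‖y‖)) := by
            calc ‖N.mulVec (c y) i‖ ≤ ∑ j : Fin m, ‖N i j * c y j‖ :=
                  norm_sum_le Finset.univ (fun j => N i j * c y j)
              _ ≤ ∑ j : Fin m, L * (‖R'‖ * ‖y‖) := by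
                refine Finset.sum_le_sum fun j _ => ?_
                rw [norm_mul]
                exact mul_le_mul (hL i j) (hcb j) (norm_nonneg _) ((norm_nonneg _).trans (hL i j))
              _ = _ := by simp
          calc ‖N.mulVec (c y) i‖ * ‖e i‖ ≤ ‖N.mulVec (c y) i‖ * 1 := by gcongr; exact he i
            _ ≤ _ := by rw [mul_one]; exact this
        _ = _ := by simp; ring
    calc ‖uu y‖ ≤ ‖y‖ + ‖σ • ∑ i, (N.mulVec (c y)) i • e i‖ := norm_add_le _ _
      _ ≤ ‖y‖ + ‖σ‖ * (m * (m * (L * ‖R'‖)) * ‖y‖) := by rw [norm_smul]; gcongr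
      _ = _ := by ring
  -- the resolvent as a bounded operator
  have hlin : ∃ R : H →L[ℂ] H, ∀ y, R y = R' (uu y) := by
    refine ⟨LinearMap.mkContinuous
      { toFun := fun y => R' (uu y)
        map_add' := ?_
        map_smul' := ?_ } (‖R'‖ * (1 + ‖σ‖ * (m * (m * (L * ‖R'‖))))) ?_, fun y => rfl⟩
    · intro x y
      have : R' (uu (x + y)) - (R' (uu x) + R' (uu y)) = 0 := by
        refine hinj _ (A.domain.sub_mem (hdom _) (A.domain.add_mem (hdom _) (hdom _))) ?_
        have e1 := hright (x + y)
        have e2 := hright x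
        have e3 := hright y
        have : A ⟨R' (uu (x + y)) - (R' (uu x) + R' (uu y)),
            A.domain.sub_mem (hdom _) (A.domain.add_mem (hdom _) (hdom _))⟩
            = A ⟨_, hdom (uu (x + y))⟩ - (A ⟨_, hdom (uu x)⟩ + A ⟨_, hdom (uu y)⟩) := by
          rw [← LinearPMap.map_add, ← LinearPMap.map_sub]; rfl
        rw [this]
        rw [sub_eq_iff_eq_add] at e1 e2 e3
        rw [e1, e2, e3]; module
      exact sub_eq_zero.mp this
    · intro a y
      have : R' (uu (a • y)) - a • R' (uu y) = 0 := by
        refine hinj _ (A.domain.sub_mem (hdom _) (A.domain.smul_mem _ (hdom _))) ?_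
        have e1 := hright (a • y)
        have e2 := hright y
        have : A ⟨R' (uu (a • y)) - a • R' (uu y),
            A.domain.sub_mem (hdom _) (A.domain.smul_mem _ (hdom _))⟩
            = A ⟨_, hdom (uu (a • y))⟩ - a • A ⟨_, hdom (uu y)⟩ := by
          rw [← LinearPMap.map_smul, ← LinearPMap.map_sub]; rfl
        rw [this]
        rw [sub_eq_iff_eq_add] at e1 e2
        rw [e1, e2]; module
      exact sub_eq_zero.mp this
    · intro y
      calc ‖R' (uu y)‖ ≤ ‖R'‖ * ‖uu y‖ := R'.le_opNorm _
        _ ≤ ‖R'‖ * ((1 + ‖σ‖ * (m * (m * (L * ‖R'‖)))) * ‖y‖) := by gcongr; exact hb y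
        _ = _ := by ring
  obtain ⟨R, hR⟩ := hlin
  have hdomR : ∀ y, R y ∈ A.domain := fun y => by rw [hR]; exact hdom _
  have hrightR : ∀ y, A ⟨R y, hdomR y⟩ - z • R y = y := by
    intro y
    have : (⟨R y, hdomR y⟩ : A.domain) = ⟨R' (uu y), hdom _⟩ := by ext; exact hR y
    rw [this, hR]; exact hright y
  have hRes : IsResolventOf A z R := by
    refine ⟨?_, fun y => ⟨hdomR y, hrightR y⟩⟩
    intro x
    have : R (A x - z • (x : H)) - x = 0 := by
      refine hinj _ (A.domain.sub_mem (hdomR _) x.2) ?_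
      have e1 := hrightR (A x - z • (x : H))
      have : A ⟨R (A x - z • (x : H)) - x, A.domain.sub_mem (hdomR _) x.2⟩
          = A ⟨_, hdomR (A x - z • (x : H))⟩ - A x := by
        rw [← LinearPMap.map_sub]; rfl
      rw [this]
      rw [sub_eq_iff_eq_add] at e1
      rw [e1]; module
    exact sub_eq_zero.mp this
  refine ⟨⟨R, hRes⟩, fun y => ⟨uu y, ?_, hb y⟩⟩
  rw [eq_res_of_isResolventOf hRes, hR]

theorem frM_diff {A' : H →ₗ.[ℂ] H} (e : Fin m → H) (σ : ℂ) {z : ℂ}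
    (hz : z ∈ pmResolventSet A') : DifferentiableAt ℂ (fun z => (frM A' e σ z).det) z := by
  have h1 : ∀ i j, DifferentiableAt ℂ (fun z => frM A' e σ z i j) z := by
    intro i j
    have h2 : DifferentiableAt ℂ (fun z => inner ℂ (e i) (res A' z (e j))) z := by
      have h3 : DifferentiableAt ℂ (fun z => (innerSL ℂ (e i)) (res A' z (e j))) z :=
        (innerSL ℂ (e i)).differentiableAt.comp z
          ((differentiableAt_res hz).clm_apply (differentiableAt_const _))
      exact h3
    simp only [frM, Matrix.sub_apply, Matrix.smul_apply, Matrix.of_apply, smul_eq_mul]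
    exact (differentiableAt_const _).sub ((differentiableAt_const _).mul h2)
  simp only [Matrix.det_apply]
  refine DifferentiableAt.fun_sum fun τ _ => ?_
  have : DifferentiableAt ℂ (fun z => ∏ i, frM A' e σ z (τ i) i) z := by
    refine DifferentiableAt.fun_finsetProd ?_
    exact fun i _ => h1 _ _
  exact this.const_smul _

theorem frM_entry {A' : H →ₗ.[ℂ] H} {e : Fin m → H} (he : ∀ i, ‖e i‖ ≤ 1) (σ z : ℂ) (i j : Fin m) :
    ‖frM A' e σ z i j - (1 : Matrix (Fin m) (Fin m) ℂ) i j‖ ≤ ‖σ‖ * ‖res A' z‖ := by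
  have : frM A' e σ z i j - (1 : Matrix (Fin m) (Fin m) ℂ) i j
      = -(σ * inner ℂ (e i) (res A' z (e j))) := by
    simp [frM, Matrix.sub_apply]
  rw [this, norm_neg, norm_mul]
  gcongr
  calc ‖inner ℂ (e i) (res A' z (e j))‖ ≤ ‖e i‖ * ‖res A' z (e j)‖ := norm_inner_le_norm _ _
    _ ≤ 1 * (‖res A' z‖ * 1) := by
      gcongr
      · exact he i
      · exact ((res A' z).le_opNorm _).trans (by gcongr; exact he j)
    _ = _ := by ring

theorem matrix_facts (m : ℕ) (L : ℝ) :
    (∃ η > 0, ∀ F : Matrix (Fin m) (Fin m) ℂ, (∀ i j, ‖F i j - (1 : Matrix _ _ ℂ) i j‖ ≤ η) →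
      1 / 2 ≤ ‖F.det‖) ∧
    (∃ K, ∀ F : Matrix (Fin m) (Fin m) ℂ, (∀ i j, ‖F i j - (1 : Matrix _ _ ℂ) i j‖ ≤ L) →
      ‖F.det‖ ≤ K) ∧
    (∃ K, 0 ≤ K ∧ ∀ F : Matrix (Fin m) (Fin m) ℂ, (∀ i j, ‖F i j - (1 : Matrix _ _ ℂ) i j‖ ≤ L) →
      ∀ ε > 0, ε ≤ ‖F.det‖ → ∀ i j, ‖F⁻¹ i j‖ ≤ K / ε) := by
  have hcpt : IsCompact {F : Matrix (Fin m) (Fin m) ℂ |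
      ∀ i j, ‖F i j - (1 : Matrix _ _ ℂ) i j‖ ≤ L} := by
    have : {F : Matrix (Fin m) (Fin m) ℂ | ∀ i j, ‖F i j - (1 : Matrix _ _ ℂ) i j‖ ≤ L}
        = Set.univ.pi fun i => Set.univ.pi fun j =>
          Metric.closedBall ((1 : Matrix (Fin m) (Fin m) ℂ) i j) L := by
      ext F
      simp only [Set.mem_setOf_eq]
      constructor
      · intro h i _ j _
        rw [Metric.mem_closedBall, dist_eq_norm]; exact h i j
      · intro h i j
        have := h i trivial j trivial
        rw [Metric.mem_closedBall, dist_eq_norm] at this; exact this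
    rw [this]
    exact isCompact_univ_pi fun i => isCompact_univ_pi fun j => isCompact_closedBall _ _
  refine ⟨?_, ?_, ?_⟩
  · have hc : Continuous fun F : Matrix (Fin m) (Fin m) ℂ => ‖F.det‖ :=
      (continuous_id.matrix_det).norm
    have h1 : {F : Matrix (Fin m) (Fin m) ℂ | 1 / 2 < ‖F.det‖} ∈ 𝓝 (1 : Matrix _ _ ℂ) := by
      refine (isOpen_lt continuous_const hc).mem_nhds ?_
      simp only [Set.mem_setOf_eq, Matrix.det_one, norm_one]; norm_num
    have h2 : ∃ η > 0, ∀ F : Fin m → Fin m → ℂ,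
        dist F (fun i j => (1 : Matrix (Fin m) (Fin m) ℂ) i j) < η →
        1 / 2 < ‖(Matrix.of F).det‖ := by
      obtain ⟨η, hη, hb⟩ := Metric.mem_nhds_iff.mp
        (show {F : Fin m → Fin m → ℂ | 1 / 2 < ‖(Matrix.of F).det‖} ∈
          𝓝 (fun i j => (1 : Matrix (Fin m) (Fin m) ℂ) i j) from h1)
      exact ⟨η, hη, fun F hF => hb hF⟩
    obtain ⟨η, hη, hb⟩ := h2
    refine ⟨η / 2, by positivity, fun F hF => ?_⟩
    refine (hb (fun i j => F i j) ?_).le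
    refine lt_of_le_of_lt ?_ (half_lt_self hη)
    rw [dist_pi_le_iff (by positivity)]
    intro i
    rw [dist_pi_le_iff (by positivity)]
    intro j
    rw [dist_eq_norm]; exact hF i j
  · obtain ⟨K, hK⟩ := hcpt.exists_bound_of_continuousOn
      (f := fun F : Matrix (Fin m) (Fin m) ℂ => F.det) (continuous_id.matrix_det).continuousOn
    exact ⟨K, fun F hF => hK F hF⟩
  · have : ∀ i j : Fin m, ∃ K, ∀ F ∈ {F : Matrix (Fin m) (Fin m) ℂ |
      ∀ i j, ‖F i j - (1 : Matrix _ _ ℂ) i j‖ ≤ L}, ‖F.adjugate i j‖ ≤ K := by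
      intro i j
      exact hcpt.exists_bound_of_continuousOn
        (f := fun F : Matrix (Fin m) (Fin m) ℂ => F.adjugate i j)
        ((continuous_id.matrix_adjugate).matrix_elem i j).continuousOn
    choose K hK using this
    refine ⟨∑ i, ∑ j, |K i j|, by positivity, ?_⟩
    intro F hF ε hε hd i j
    rw [Matrix.inv_def, Matrix.smul_apply, smul_eq_mul, norm_mul, Ring.inverse_eq_inv', norm_inv,
      div_eq_mul_inv, mul_comm]
    have h1 : ‖F.adjugate i j‖ ≤ ∑ i, ∑ j, |K i j| := by
      calc ‖F.adjugate i j‖ ≤ |K i j| := (hK i j F hF).trans (le_abs_self _)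
        _ ≤ ∑ j, |K i j| := Finset.single_le_sum (f := fun j => |K i j|)
            (fun _ _ => abs_nonneg _) (Finset.mem_univ j)
        _ ≤ _ := Finset.single_le_sum (f := fun i => ∑ j, |K i j|)
            (fun _ _ => Finset.sum_nonneg fun _ _ => abs_nonneg _) (Finset.mem_univ i)
    exact mul_le_mul h1 (inv_anti₀ hε hd) (by positivity) (by positivity)

/-- orthogonal projections of small rank as a sum over `Fin m`. -/
theorem proj_expand {E : H →L[ℂ] H} (hs : ∀ x y, inner ℂ (E x) y = inner ℂ x (E y))
    (hi : E.comp E = E) {V : Submodule ℂ H} [FiniteDimensional ℂ V]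
    (hV : LinearMap.range (E : H →ₗ[ℂ] H) ≤ V) (hm : Module.finrank ℂ V ≤ m) :
    ∃ e : Fin m → H, (∀ i, ‖e i‖ ≤ 1) ∧ ∀ x, E x = ∑ i, inner ℂ (e i) x • e i := by
  set W := LinearMap.range (E : H →ₗ[ℂ] H) with hW
  haveI : FiniteDimensional ℂ W := Submodule.finiteDimensional_of_le hV
  have hd : Module.finrank ℂ W ≤ m := (Submodule.finrank_mono hV).trans hm
  set n := Module.finrank ℂ W with hn
  set bb := stdOrthonormalBasis ℂ W with hbb
  obtain ⟨k, hk⟩ := Nat.exists_eq_add_of_le hd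
  subst hk
  refine ⟨Fin.append (fun i => ((bb i : W) : H)) (fun _ => 0), ?_, ?_⟩
  · intro i
    refine Fin.addCases ?_ ?_ i
    · intro i
      rw [Fin.append_left]
      have := bb.orthonormal.1 i
      exact this.le
    · intro i; rw [Fin.append_right]; simp
  · intro x
    rw [Fin.sum_univ_add]
    simp only [Fin.append_left, Fin.append_right, smul_zero, Finset.sum_const_zero, add_zero]
    have hEx : E x ∈ W := LinearMap.mem_range_self (E : H →ₗ[ℂ] H) x
    have h1 := bb.sum_repr' ⟨E x, hEx⟩
    have h2 := congrArg (Subtype.val) h1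
    rw [← show ((⟨E x, hEx⟩ : W) : H) = E x from rfl, ← h1]
    rw [Submodule.coe_sum]
    refine Finset.sum_congr rfl fun i _ => ?_
    rw [Submodule.coe_smul]
    congr 1
    have hbi : E ((bb i : W) : H) = (bb i : W) := by
      obtain ⟨y, hy⟩ := (bb i).2
      rw [← hy]
      exact congrArg (fun f : H →L[ℂ] H => f y) hi
    rw [Submodule.coe_inner]
    change inner ℂ ((bb i : W) : H) (E x) = _
    rw [← hs, hbi]

end fr

end PM

namespace PM
open Filter Topology

lemma strip_lip {C δ1 δ' : ℝ} (h1 : δ1 < δ') {f : ℂ → ℂ}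
    (hf : ∀ ζ : ℂ, |ζ.re| < δ' → DifferentiableAt ℂ f ζ ∧ ‖f ζ‖ ≤ C) {z w : ℂ}
    (hz : |z.re| ≤ δ1) (hw : |w.re| ≤ δ1) :
    ‖f w - f z‖ ≤ C / ((δ' - δ1) / 2) * ‖w - z‖ := by
  have hconv : Convex ℝ {ζ : ℂ | |ζ.re| ≤ δ1} := by
    have : {ζ : ℂ | |ζ.re| ≤ δ1} = Complex.reLm ⁻¹' (Set.Icc (-δ1) δ1) := by
      ext ζ; simp [abs_le]
    rw [this]
    exact (convex_Icc _ _).linear_preimage _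
  have hR : 0 < (δ' - δ1) / 2 := by linarith
  refine hconv.norm_image_sub_le_of_norm_deriv_le (fun x hx => (hf x (lt_of_le_of_lt hx h1)).1)
    (fun x hx => ?_) hz hw
  have hx' : |x.re| ≤ δ1 := hx
  have key : ∀ y ∈ Metric.closedBall x ((δ' - δ1) / 2), |y.re| < δ' := by
    intro y hy
    have h2 : ‖y - x‖ ≤ (δ' - δ1) / 2 := by simpa [dist_eq_norm] using hy
    have h3 := (Complex.abs_re_le_norm (y - x)).trans h2
    have h4 : |y.re| ≤ |x.re| + |(y - x).re| := by
      have : y.re = x.re + (y - x).re := by simp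
      calc |y.re| = |x.re + (y - x).re| := by rw [← this]
        _ ≤ _ := abs_add_le _ _
    linarith
  refine Complex.norm_deriv_le_of_forall_mem_sphere_norm_le hR ?_ ?_
  · refine DifferentiableOn.diffContOnCl ?_
    rw [closure_ball _ hR.ne']
    intro y hy
    exact (hf y (key y hy)).1.differentiableWithinAt
  · intro y hy
    exact (hf y (key y (Metric.sphere_subset_closedBall hy))).2

lemma compact_line (C c Y0 h0 δ δ' : ℝ) (hc : 0 < c) (hδ : 0 < δ) (hδ' : δ < δ') :
    ∃ ε > 0, ∀ f : ℂ → ℂ, (∀ ζ : ℂ, |ζ.re| < δ' → DifferentiableAt ℂ f ζ ∧ ‖f ζ‖ ≤ C) →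
      c ≤ ‖f (Complex.I * (Y0 : ℂ))‖ →
      ∃ x : ℝ, |x| ≤ δ ∧ ∀ y : ℝ, |y| ≤ h0 → ε ≤ ‖f ((x : ℂ) + Complex.I * (y : ℂ))‖ := by
  by_contra hcon
  push Not at hcon
  have hcon' : ∀ n : ℕ, ∃ f : ℂ → ℂ,
      (∀ ζ : ℂ, |ζ.re| < δ' → DifferentiableAt ℂ f ζ ∧ ‖f ζ‖ ≤ C) ∧
      c ≤ ‖f (Complex.I * (Y0 : ℂ))‖ ∧ ∀ x : ℝ, |x| ≤ δ →
        ∃ y : ℝ, |y| ≤ h0 ∧ ‖f ((x : ℂ) + Complex.I * (y : ℂ))‖ < 1 / ((n : ℝ) + 1) :=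
    fun n => hcon _ (by positivity)
  choose f hf hfc hfz using hcon'
  obtain ⟨δ1, hd1, hd2⟩ := exists_between hδ'
  set Y : ℝ := |h0| + |Y0| + 1 with hY
  set K : Set ℂ := Set.Icc (-δ1) δ1 ×ℂ Set.Icc (-Y) Y with hK
  have hKc : IsCompact K := isCompact_Icc.reProdIm isCompact_Icc
  have hKm : ∀ z : ℂ, z ∈ K ↔ |z.re| ≤ δ1 ∧ |z.im| ≤ Y := by
    intro z; simp [hK, Complex.mem_reProdIm, abs_le]
  set L := C / ((δ' - δ1) / 2) with hL
  have hlip : ∀ n, ∀ z w : ℂ, |z.re| ≤ δ1 → |w.re| ≤ δ1 → ‖f n w - f n z‖ ≤ L * ‖w - z‖ :=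
    fun n z w hz hw => strip_lip hd2 (hf n) hz hw
  haveI : CompactSpace K := isCompact_iff_compactSpace.mp hKc
  have hcont : ∀ n, Continuous (fun z : K => f n z) := by
    intro n
    rw [continuous_iff_continuousAt]
    intro z
    have := (hf n z (lt_of_le_of_lt ((hKm z).1 z.2).1 hd2)).1.continuousAt
    exact this.comp continuous_subtype_val.continuousAt
  let G : ℕ → BoundedContinuousFunction K ℂ := fun n =>
    BoundedContinuousFunction.mkOfCompact ⟨fun z : K => f n z, hcont n⟩
  have hG : ∀ n (z : K), G n z = f n z := fun n z => rfl
  have hcomp : IsCompact (closure (Set.range G)) := by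
    refine BoundedContinuousFunction.arzela_ascoli (Metric.closedBall (0:ℂ) C)
      (isCompact_closedBall _ _) _ ?_ ?_
    · rintro _ z ⟨n, rfl⟩
      simpa [hG] using (hf n z (lt_of_le_of_lt ((hKm z).1 z.2).1 hd2)).2
    · refine Metric.equicontinuous_of_continuity_modulus (fun t => L * t) ?_ _ ?_
      · have : Tendsto (fun t : ℝ => L * t) (𝓝 0) (𝓝 (L * 0)) := (continuous_const_mul L).tendsto 0
        simpa using this
      · rintro x y ⟨_, n, rfl⟩
        change dist (f n x) (f n y) ≤ L * dist (x:ℂ) (y:ℂ)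
        rw [dist_eq_norm, dist_eq_norm]
        exact hlip n y x ((hKm y).1 y.2).1 ((hKm x).1 x.2).1
  obtain ⟨g, -, φ, hφ, hlim⟩ := hcomp.tendsto_subseq (fun n => subset_closure (Set.mem_range_self n))
  have hunif := BoundedContinuousFunction.tendsto_iff_tendstoUniformly.1 hlim
  classical
  let g0 : ℂ → ℂ := fun z => if hz : z ∈ K then g ⟨z, hz⟩ else 0
  have hg0 : ∀ z (hz : z ∈ K), g0 z = g ⟨z, hz⟩ := fun z hz => dif_pos hz
  have hunif' : TendstoUniformlyOn (fun n => f (φ n)) g0 atTop K := by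
    rw [Metric.tendstoUniformlyOn_iff]
    intro ε hε
    filter_upwards [Metric.tendstoUniformly_iff.1 hunif ε hε] with n hn z hz
    rw [hg0 z hz]
    exact hn ⟨z, hz⟩
  set U : Set ℂ := Set.Ioo (-δ1) δ1 ×ℂ Set.Ioo (-Y) Y with hU
  have hUo : IsOpen U := isOpen_Ioo.reProdIm isOpen_Ioo
  have hUK : U ⊆ K := Complex.reProdIm_subset_iff'.2 (Or.inl ⟨Set.Ioo_subset_Icc_self, Set.Ioo_subset_Icc_self⟩)
  have hUm : ∀ z : ℂ, z ∈ U ↔ |z.re| < δ1 ∧ |z.im| < Y := by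
    intro z; simp [hU, Complex.mem_reProdIm, abs_lt]
  have hdiff : DifferentiableOn ℂ g0 U := by
    refine (hunif'.mono hUK).tendstoLocallyUniformlyOn.differentiableOn ?_ hUo
    exact Eventually.of_forall fun n z hz =>
      (hf _ z (by have := ((hUm z).1 hz).1; linarith)).1.differentiableWithinAt
  have hpre : IsPreconnected U := by
    have : U = Complex.reLm ⁻¹' (Set.Ioo (-δ1) δ1) ∩ Complex.imLm ⁻¹' (Set.Ioo (-Y) Y) := rfl
    rw [this]
    exact (((convex_Ioo _ _).linear_preimage _).inter
      ((convex_Ioo _ _).linear_preimage _)).isPreconnected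
  have hpt : ∀ z ∈ K, Tendsto (fun n => f (φ n) z) atTop (𝓝 (g0 z)) := fun z hz =>
    hunif'.tendsto_at hz
  have hY0U : Complex.I * (Y0:ℂ) ∈ U := by
    rw [hUm]; simp
    refine ⟨by linarith, ?_⟩
    have := abs_nonneg h0; linarith
  have hg0c : c ≤ ‖g0 (Complex.I * (Y0:ℂ))‖ :=
    ge_of_tendsto (hpt _ (hUK hY0U)).norm (Eventually.of_forall fun n => hfc _)
  -- zero-free line
  have hline : ∃ x : ℝ, |x| ≤ δ ∧ ∀ y : ℝ, |y| ≤ h0 → g0 ((x:ℂ) + Complex.I * (y:ℂ)) ≠ 0 := by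
    by_contra hno
    push Not at hno
    let Z : Set ℂ := {z | (|z.re| ≤ δ ∧ |z.im| ≤ |h0|) ∧ g0 z = 0}
    have hZK : Z ⊆ Set.Icc (-δ) δ ×ℂ Set.Icc (-|h0|) |h0| := by
      rintro z ⟨⟨h1, h2⟩, -⟩
      exact ⟨abs_le.1 h1, abs_le.1 h2⟩
    have hZinf : Z.Infinite := by
      intro hfin
      have : (Complex.re '' Z).Finite := hfin.image _
      refine (Set.Icc_infinite (show -δ < δ by linarith)) (this.subset ?_)
      intro x hx
      obtain ⟨y, hy, hz⟩ := hno x (abs_le.2 hx)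
      refine ⟨(x:ℂ) + Complex.I * (y:ℂ), ⟨⟨?_, ?_⟩, hz⟩, ?_⟩
      · simpa using abs_le.2 hx
      · simpa using hy.trans (le_abs_self _)
      · simp
    obtain ⟨z0, hz0, hacc⟩ := hZinf.exists_accPt_of_subset_isCompact
      (isCompact_Icc.reProdIm isCompact_Icc) hZK
    have hz0U : z0 ∈ U := by
      rw [hUm]
      have h1 := abs_le.2 hz0.1
      have h2 := abs_le.2 hz0.2
      have := abs_nonneg Y0
      exact ⟨lt_of_le_of_lt h1 hd1, by linarith⟩
    have hfreq : ∃ᶠ z in 𝓝[≠] z0, g0 z = 0 :=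
      (accPt_iff_frequently_nhdsNE.1 hacc).mono fun z hz => hz.2
    have := (hdiff.analyticOnNhd hUo).eqOn_zero_of_preconnected_of_frequently_eq_zero hpre hz0U hfreq hY0U
    rw [this] at hg0c
    simp at hg0c
    linarith
  obtain ⟨x, hx, hne⟩ := hline
  -- subsequence of zeros y
  choose y hy hfy using fun n => hfz (φ n) x hx
  have hmem : ∀ y : ℝ, |y| ≤ h0 → (x:ℂ) + Complex.I * (y:ℂ) ∈ U := by
    intro y hy
    rw [hUm]; simp
    have := abs_nonneg Y0; have := le_abs_self h0
    exact ⟨by linarith, by linarith⟩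
  obtain ⟨y1, hy1, ψ, hψ, hyl⟩ := (isCompact_Icc (a := -h0) (b := h0)).tendsto_subseq
    (fun n => abs_le.1 (hy n))
  have hy1' : |y1| ≤ h0 := abs_le.2 hy1
  have hcg : ContinuousAt g0 ((x:ℂ) + Complex.I * (y1:ℂ)) :=
    (hdiff.differentiableAt (hUo.mem_nhds (hmem y1 hy1'))).continuousAt
  have hpl : Tendsto (fun n => (x:ℂ) + Complex.I * ((y (ψ n) : ℝ):ℂ)) atTop
      (𝓝 ((x:ℂ) + Complex.I * (y1:ℂ))) := by
    refine tendsto_const_nhds.add (tendsto_const_nhds.mul ?_)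
    exact (Complex.continuous_ofReal.tendsto y1).comp hyl
  have h1 : Tendsto (fun n => g0 ((x:ℂ) + Complex.I * ((y (ψ n) : ℝ):ℂ))) atTop
      (𝓝 (g0 ((x:ℂ) + Complex.I * (y1:ℂ)))) := hcg.tendsto.comp hpl
  have h2 : Tendsto (fun n => g0 ((x:ℂ) + Complex.I * ((y (ψ n) : ℝ):ℂ))) atTop (𝓝 0) := by
    rw [Metric.tendsto_nhds]
    intro ε hε
    have hev1 := hψ.tendsto_atTop.eventually
      (Metric.tendstoUniformlyOn_iff.1 hunif' (ε/2) (by linarith))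
    have hev2 : ∀ᶠ n : ℕ in atTop, 1 / ((n:ℝ) + 1) < ε / 2 :=
      (tendsto_one_div_add_atTop_nhds_zero_nat (𝕜 := ℝ)).eventually (gt_mem_nhds (by linarith))
    have hev3 := (hφ.comp hψ).tendsto_atTop.eventually hev2
    filter_upwards [hev1, hev3] with n hn1 hn3
    have a1 := hn1 _ (hUK (hmem _ (hy (ψ n))))
    have a2 := hfy (ψ n)
    simp only [Function.comp] at hn3
    rw [dist_zero_right]
    rw [dist_eq_norm] at a1
    have := norm_le_norm_add_norm_sub' (g0 ((x:ℂ) + Complex.I * ((y (ψ n) : ℝ):ℂ)))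
      (f (φ (ψ n)) ((x:ℂ) + Complex.I * ((y (ψ n) : ℝ):ℂ)))
    linarith
  exact hne y1 hy1' (tendsto_nhds_unique h1 h2)

end PM

namespace PM
open Filter Topology

/-- subordination with explicit constants -/
def SubC (T : H →ₗ.[ℂ] H) (C : T.domain →ₗ[ℂ] H) (p b M : ℝ) : Prop :=
  ∀ x : T.domain, ‖C x‖ ≤ b * ‖T x‖ ^ p * ‖(x : H)‖ ^ (1 - p) + M * ‖(x : H)‖

lemma subC_est {T : H →ₗ.[ℂ] H} {C : T.domain →ₗ[ℂ] H} {p b M : ℝ} (hC : SubC T C p b M)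
    (hb : 0 < b) (hM : 0 ≤ M) (hp0 : 0 ≤ p) (hp1 : p < 1) (x : T.domain) {Y d X q : ℝ}
    (hY : 0 ≤ Y) (hd : 0 < d) (hX : 0 ≤ X) (h1 : ‖(x : H)‖ ≤ Y / d)
    (h2 : ‖T x‖ ≤ (2 + X / d) * Y) (hq : b * (2 * d + X) ^ p + M ≤ q * d) :
    ‖C x‖ ≤ q * Y := by
  have hYd : 0 ≤ Y / d := by positivity
  have e1 : (2 + X / d) * Y = (2 * d + X) * (Y / d) := by field_simp
  have a1 : ‖T x‖ ^ p ≤ (2 * d + X) ^ p * (Y / d) ^ p := by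
    rw [← Real.mul_rpow (by positivity) hYd, ← e1]
    exact Real.rpow_le_rpow (norm_nonneg _) h2 hp0
  have a2 : ‖(x : H)‖ ^ (1 - p) ≤ (Y / d) ^ (1 - p) :=
    Real.rpow_le_rpow (norm_nonneg _) h1 (by linarith)
  have a3 : (Y / d) ^ p * (Y / d) ^ (1 - p) = Y / d := by
    rw [← Real.rpow_add' hYd (by norm_num)]; norm_num
  calc ‖C x‖ ≤ b * ‖T x‖ ^ p * ‖(x : H)‖ ^ (1 - p) + M * ‖(x : H)‖ := hC x
    _ ≤ b * ((2 * d + X) ^ p * (Y / d) ^ p) * (Y / d) ^ (1 - p) + M * (Y / d) := by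
        gcongr
    _ = (b * (2 * d + X) ^ p + M) * (Y / d) := by
        rw [show b * ((2 * d + X) ^ p * (Y / d) ^ p) * (Y / d) ^ (1 - p)
          = b * (2 * d + X) ^ p * ((Y / d) ^ p * (Y / d) ^ (1 - p)) by ring, a3]; ring
    _ ≤ q * d * (Y / d) := by gcongr
    _ = q * Y := by field_simp

lemma lemmaQ {b M p κ K0 : ℝ} (hb : 0 < b) (hM : 0 ≤ M) (hp0 : 0 ≤ p) (hp1 : p < 1)
    (hpM : p = 0 → M = 0) (hκ : b < κ) (hK0 : 0 ≤ K0) :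
    ∃ q, 0 ≤ q ∧ q < 1 ∧ ∃ ρ0 ≥ 1, ∀ ρ ≥ ρ0, ∀ d, κ * ρ ^ p ≤ d → ∀ X, 0 ≤ X →
      X ≤ ρ + K0 * ρ ^ p → b * (2 * d + X) ^ p + M ≤ q * d := by
  have hκ0 : 0 < κ := hb.trans hκ
  set K1 := 2 * κ + K0 with hK1
  have t1 : Tendsto (fun ρ : ℝ => b * K1 * ρ ^ (p - 1) + M * ρ ^ (-p)) atTop (𝓝 (b * K1 * 0 + 0)) := by
    refine Tendsto.add (tendsto_const_nhds.mul ?_) ?_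
    · have := tendsto_rpow_neg_atTop (y := 1 - p) (by linarith)
      simpa using this
    · rcases hp0.eq_or_lt with h | h
      · rw [hpM h.symm]; simp
      · have := (tendsto_rpow_neg_atTop h).const_mul M
        simpa using this
  have ev := t1.eventually (gt_mem_nhds (show b * K1 * 0 + 0 < (κ - b) / 2 by
    have : 0 < κ - b := by linarith
    simp; linarith))
  obtain ⟨ρ1, h1⟩ := eventually_atTop.1 ev
  refine ⟨(κ + b) / 2 / κ, by positivity, by rw [div_lt_one hκ0]; linarith, max ρ1 1,
    le_max_right _ _, ?_⟩
  intro ρ hρ d hd X hX0 hX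
  have hρ1 : 1 ≤ ρ := (le_max_right _ _).trans hρ
  have hρ0 : 0 < ρ := by linarith
  have h2 := h1 ρ ((le_max_left _ _).trans hρ)
  set w := ρ ^ p with hw
  have hw0 : 0 < w := Real.rpow_pos_of_pos hρ0 p
  set s := d / (κ * w) with hs
  have hs1 : 1 ≤ s := by rw [hs, le_div_iff₀ (by positivity)]; linarith
  have hd' : d = s * (κ * w) := by rw [hs]; field_simp
  have hsp : s ^ p ≤ s := by
    calc s ^ p ≤ s ^ (1:ℝ) := Real.rpow_le_rpow_of_exponent_le hs1 hp1.le
      _ = s := Real.rpow_one s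
  have hle : 2 * d + X ≤ s * (ρ * (1 + K1 * ρ ^ (p - 1))) := by
    have e : ρ * (1 + K1 * ρ ^ (p - 1)) = ρ + K1 * w := by
      rw [hw, Real.rpow_sub_one hρ0.ne']; field_simp
    rw [e, hK1, hd']
    have : X ≤ s * X := by nlinarith
    nlinarith
  have hu1 : 1 ≤ 1 + K1 * ρ ^ (p - 1) := by
    have : 0 ≤ K1 * ρ ^ (p - 1) := by rw [hK1]; positivity
    linarith
  have hup : (1 + K1 * ρ ^ (p - 1)) ^ p ≤ 1 + K1 * ρ ^ (p - 1) := by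
    calc _ ≤ (1 + K1 * ρ ^ (p - 1)) ^ (1:ℝ) := Real.rpow_le_rpow_of_exponent_le hu1 hp1.le
      _ = _ := Real.rpow_one _
  have hd0 : 0 < d := lt_of_lt_of_le (by positivity) hd
  have h3 : (2 * d + X) ^ p ≤ s * (w * (1 + K1 * ρ ^ (p - 1))) := by
    calc (2 * d + X) ^ p ≤ (s * (ρ * (1 + K1 * ρ ^ (p - 1)))) ^ p :=
          Real.rpow_le_rpow (by positivity) hle hp0
      _ = s ^ p * (w * (1 + K1 * ρ ^ (p - 1)) ^ p) := by
          rw [Real.mul_rpow (by positivity) (by positivity), Real.mul_rpow hρ0.le (by linarith)]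
      _ ≤ _ := by gcongr
  have hMw : M ≤ s * (w * (M * ρ ^ (-p))) := by
    have : w * (M * ρ ^ (-p)) = M := by
      rw [hw, Real.rpow_neg hρ0.le]; field_simp
    rw [this]; nlinarith
  calc b * (2 * d + X) ^ p + M ≤ b * (s * (w * (1 + K1 * ρ ^ (p - 1)))) + s * (w * (M * ρ ^ (-p))) := by
        gcongr
    _ = s * w * (b + (b * K1 * ρ ^ (p - 1) + M * ρ ^ (-p))) := by ring
    _ ≤ s * w * (b + (κ - b) / 2) := by gcongr
    _ = (κ + b) / 2 / κ * d := by rw [hd']; field_simp; ring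

lemma res_bound {T : H →ₗ.[ℂ] H} {C : T.domain →ₗ[ℂ] H} {p b M : ℝ} (hC : SubC T C p b M)
    (hb : 0 < b) (hM : 0 ≤ M) (hp0 : 0 ≤ p) (hp1 : p < 1) {S : H →L[ℂ] H} {z : ℂ}
    (hz : z ∈ pmResolventSet (addB T S)) {d X q : ℝ} (hd : 0 < d)
    (hr : ‖res (addB T S) z‖ ≤ 1 / d) (him : |z.im| ≤ d) (hX : |z.re| + ‖S‖ ≤ X)
    (hq : b * (2 * d + X) ^ p + M ≤ q * d) (y : H) (hy : res (addB T S) z y ∈ T.domain) :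
    ‖C ⟨res (addB T S) z y, hy⟩‖ ≤ q * ‖y‖ := by
  set x := res (addB T S) z y with hx
  have hxn : ‖x‖ ≤ ‖y‖ / d := by
    calc ‖x‖ ≤ ‖res (addB T S) z‖ * ‖y‖ := ContinuousLinearMap.le_opNorm _ _
      _ ≤ 1 / d * ‖y‖ := by gcongr
      _ = _ := by ring
  have hX0 : 0 ≤ X := le_trans (by positivity) hX
  refine subC_est hC hb hM hp0 hp1 ⟨x, hy⟩ (norm_nonneg y) hd hX0 hxn ?_ hq
  have e : T ⟨x, hy⟩ + S x = y + z • x := apply_res hz y hy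
  have e2 : T ⟨x, hy⟩ = y + z • x - S x := by rw [← e]; simp
  have hzn : ‖z‖ ≤ |z.re| + |z.im| := Complex.norm_le_abs_re_add_abs_im z
  calc ‖T ⟨x, hy⟩‖ ≤ ‖y‖ + ‖z‖ * ‖x‖ + ‖S‖ * ‖x‖ := by
        rw [e2]
        refine (norm_sub_le _ _).trans ?_
        gcongr
        · refine (norm_add_le _ _).trans ?_
          rw [norm_smul]
        · exact S.le_opNorm _
    _ ≤ ‖y‖ + (X + d) * ‖x‖ := by
        have : (‖z‖ + ‖S‖) * ‖x‖ ≤ (X + d) * ‖x‖ :=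
          mul_le_mul_of_nonneg_right (by linarith) (norm_nonneg _)
        linarith
    _ ≤ ‖y‖ + (X + d) * (‖y‖ / d) := by gcongr
    _ = (2 + X / d) * ‖y‖ := by field_simp; ring

/-- uniform estimates at a point -/
structure Good (T : H →ₗ.[ℂ] H) (C : T.domain →ₗ[ℂ] H) (z : ℂ) (K D : ℝ) : Prop where
  hT : z ∈ pmResolventSet T
  hA : z ∈ pmResolventSet (addC T C)
  rT : ‖res T z‖ ≤ K / D
  rA : ‖res (addC T C) z‖ ≤ K / D
  cA : ∀ y (h : res (addC T C) z y ∈ T.domain), ‖C ⟨res (addC T C) z y, h⟩‖ ≤ K * ‖y‖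

lemma Good.mono {T : H →ₗ.[ℂ] H} {C : T.domain →ₗ[ℂ] H} {z : ℂ} {K D K' D' : ℝ}
    (g : Good T C z K D) (hK : K ≤ K') (hD : K / D ≤ K' / D') : Good T C z K' D' :=
  ⟨g.hT, g.hA, g.rT.trans hD, g.rA.trans hD, fun y h => (g.cA y h).trans (by gcongr)⟩

lemma outside {T : H →ₗ.[ℂ] H} {C : T.domain →ₗ[ℂ] H} {p b M h : ℝ} (hT : IsSA T)
    (hC : SubC T C p b M) (hb : 0 < b) (hM : 0 ≤ M) (hp0 : 0 ≤ p) (hp1 : p < 1)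
    (hpM : p = 0 → M = 0) (hh : b < h) :
    ∃ K ≥ 1, ∃ ρ0 ≥ 1, ∀ ρ ≥ ρ0, ∀ z : ℂ, |z.re| ≤ ρ → h * ρ ^ p ≤ |z.im| →
      Good T C z K |z.im| := by
  obtain ⟨q, hq0, hq1, ρ0, hρ0, hQ⟩ := lemmaQ hb hM hp0 hp1 hpM hh le_rfl
  have h1q : 0 < 1 - q := by linarith
  refine ⟨1 / (1 - q), by rw [ge_iff_le, le_div_iff₀ h1q]; linarith, ρ0, hρ0, ?_⟩
  intro ρ hρ z hre him
  have hρp : 0 < ρ := by linarith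
  have hw : 0 < ρ ^ p := Real.rpow_pos_of_pos hρp p
  have hd : 0 < |z.im| := lt_of_lt_of_le (by have := hb.trans hh; positivity) him
  have hzr : z ∈ pmResolventSet T := hT.real z (abs_pos.1 hd)
  have hz0 : z ∈ pmResolventSet (addB T 0) := by rwa [addB_zero]
  have hrT : ‖res T z‖ ≤ 1 / |z.im| := by
    refine ContinuousLinearMap.opNorm_le_bound _ (by positivity) fun y => ?_
    have := hT.im_mul_res_le hzr y
    rw [div_mul_eq_mul_div, one_mul, le_div_iff₀ hd]; linarith
  have hqq := hQ ρ hρ _ him |z.re| (abs_nonneg _) (by simpa using hre)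
  have hB : ∀ y (hy : res T z y ∈ T.domain), ‖C ⟨res T z y, hy⟩‖ ≤ q * ‖y‖ := by
    have := @res_bound H _ _ _ T C p b M hC hb hM hp0 hp1 0 z hz0 _ |z.re| q hd
      (by rwa [addB_zero]) le_rfl (by simp) hqq
    simpa only [addB_zero] using this
  obtain ⟨hA, hu⟩ := pert hzr C hq0 hq1 (fun y => hB y _)
  have hK1 : (1:ℝ) ≤ 1 / (1 - q) := by rw [le_div_iff₀ h1q]; linarith
  refine ⟨hzr, hA, hrT.trans (by gcongr), ?_, ?_⟩
  · refine ContinuousLinearMap.opNorm_le_bound _ (by positivity) fun y => ?_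
    obtain ⟨u, e, hu⟩ := hu y
    rw [e]
    calc ‖res T z u‖ ≤ 1 / |z.im| * (‖y‖ / (1 - q)) := by
          refine ((res T z).le_opNorm u).trans ?_
          gcongr
      _ = _ := by ring
  · intro y hy
    obtain ⟨u, e, hu⟩ := hu y
    have : ‖C ⟨res (addC T C) z y, hy⟩‖ = ‖C ⟨res T z u, res_mem hzr u⟩‖ := by
      congr 2; exact Subtype.ext e
    rw [this]
    refine (hB u _).trans ?_
    calc q * ‖u‖ ≤ 1 * (‖y‖ / (1 - q)) := by gcongr
      _ = _ := by ring

end PM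

namespace PM
open Filter Topology

lemma finrank_sup_le (F : Finset ℝ) (V : ℝ → Submodule ℂ H)
    (hV : ∀ ν ∈ F, FiniteDimensional ℂ (V ν)) :
    FiniteDimensional ℂ (F.sup V : Submodule ℂ H) ∧
      Module.finrank ℂ (F.sup V : Submodule ℂ H) ≤ ∑ ν ∈ F, Module.finrank ℂ (V ν) := by
  classical
  induction F using Finset.induction_on with
  | empty =>
    rw [Finset.sup_empty]
    exact ⟨inferInstance, by simp⟩
  | insert a s ha ih =>
    obtain ⟨i1, i2⟩ := ih (fun ν hν => hV ν (Finset.mem_insert_of_mem hν))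
    haveI := hV a (Finset.mem_insert_self _ _)
    rw [Finset.sup_insert, Finset.sum_insert ha]
    refine ⟨Submodule.finiteDimensional_sup _ _, ?_⟩
    exact (Submodule.finrank_add_le_finrank_add_finrank _ _).trans (by gcongr)

lemma norm_proj_le {E : H →L[ℂ] H} (hs : ∀ x y, inner ℂ (E x) y = inner ℂ x (E y))
    (hi : E.comp E = E) : ‖E‖ ≤ 1 := by
  refine ContinuousLinearMap.opNorm_le_bound _ zero_le_one fun x => ?_
  have h1 : inner ℂ (E x) (E x) = inner ℂ x (E x) := by
    rw [hs x (E x)]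
    congr 1
    exact congrArg (fun f : H →L[ℂ] H => f x) hi
  have h2 : ‖E x‖ * ‖E x‖ ≤ ‖x‖ * ‖E x‖ := by
    rw [← inner_self_eq_norm_mul_norm (𝕜 := ℂ), h1]
    exact re_inner_le_norm x (E x)
  rcases (norm_nonneg (E x)).eq_or_lt with h | h
  · rw [← h]; positivity
  · rw [one_mul]; exact le_of_mul_le_mul_right h2 h

lemma addB_addC (T : H →ₗ.[ℂ] H) (C : T.domain →ₗ[ℂ] H) (S : H →L[ℂ] H) :
    addB (addC T C) S = addC (addB T S) C := by
  refine LinearPMap.ext rfl ?_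
  intro x hx hx2
  change (T ⟨x, hx⟩ + C ⟨x, hx⟩) + S x = (T ⟨x, hx⟩ + S x) + C ⟨x, hx⟩
  abel

lemma strip {T : H →ₗ.[ℂ] H} {C : T.domain →ₗ[ℂ] H} {p b M b₁ δ' q : ℝ} 
    (hC : SubC T C p b M) (hb : 0 < b) (hM : 0 ≤ M) (hp0 : 0 ≤ p) (hp1 : p < 1)
    (hδ0 : 0 < δ') (hδb : δ' < b₁) (hq0 : 0 ≤ q) (hq1 : q < 1)
    {r : ℝ} (hr : 0 < |r|)
    (hQ : ∀ d, (b₁ - δ') * |r| ^ p ≤ d → b * (2 * d + (|r| + (δ' + 2 * b₁) * |r| ^ p)) ^ p + M ≤ q * d)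
    {F : Finset ℝ} (hF : ∀ ν ∈ F, |ν - r| < b₁ * |r| ^ p)
    (hF' : ∀ l : ℝ, (l : ℂ) ∉ pmResolventSet T → |l - r| < b₁ * |r| ^ p → l ∈ F)
    {E : H →L[ℂ] H} (hE : ‖E‖ ≤ 1)
    (hEr : ∀ (σ z : ℂ) (d : ℝ), 0 < d →
      (∀ l : ℝ, (l : ℂ) ∉ pmResolventSet T → d ≤ ‖(l : ℂ) + (if l ∈ F then σ else 0) - z‖) →
      ∃ R, IsResolventOf (addB T (σ • E)) z R ∧ ‖R‖ ≤ 1 / d)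
    {z : ℂ} (hz : |z.re - r| ≤ δ' * |r| ^ p) {d σ : ℝ} (hσ : σ = 2 * b₁ * |r| ^ p)
    (hd : d = max ((b₁ - δ') * |r| ^ p) |z.im|) :
    ∃ (h1 : z ∈ pmResolventSet (addB T ((σ : ℂ) • E))), ‖res (addB T ((σ : ℂ) • E)) z‖ ≤ 1 / d ∧
      z ∈ pmResolventSet (addC (addB T ((σ : ℂ) • E)) C) ∧
      ‖res (addC (addB T ((σ : ℂ) • E)) C) z‖ ≤ 1 / (d * (1 - q)) ∧
      ∀ y, ∃ u, res (addC (addB T ((σ : ℂ) • E)) C) z y = res (addB T ((σ : ℂ) • E)) z u ∧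
        ‖u‖ ≤ ‖y‖ / (1 - q) ∧
        ‖C ⟨res (addB T ((σ : ℂ) • E)) z u, res_mem h1 u⟩‖ ≤ q * ‖u‖ := by
  have hw : 0 < |r| ^ p := Real.rpow_pos_of_pos hr p
  set w := |r| ^ p with hwdef
  have hb₁ : 0 < b₁ := by linarith
  have hd0 : 0 < d := by
    rw [hd]; exact lt_max_of_lt_left (mul_pos (by linarith) hw)
  have h1q : 0 < 1 - q := by linarith
  have hσ0 : 0 ≤ σ := by rw [hσ]; positivity
  obtain ⟨R, hR, hRn⟩ := hEr (σ : ℂ) z d hd0 (by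
    intro l hl
    rw [hd]
    refine max_le ?_ ?_
    · refine le_trans ?_ (Complex.abs_re_le_norm _)
      have hz' := abs_le.1 hz
      by_cases hlF : l ∈ F
      · have := abs_lt.1 (hF l hlF)
        simp only [hlF, if_true]
        simp only [Complex.sub_re, Complex.add_re, Complex.ofReal_re]
        refine le_trans ?_ (le_abs_self _)
        rw [hσ]; nlinarith
      · have hge : b₁ * w ≤ |l - r| := by
          by_contra hlt
          exact hlF (hF' l hl (not_le.1 hlt))
        simp only [hlF, if_false]
        simp only [Complex.sub_re, Complex.add_re, Complex.ofReal_re, Complex.zero_re, add_zero]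
        have t : |l - r| ≤ |l - z.re| + |z.re - r| := abs_sub_le _ _ _
        nlinarith
    · refine le_trans (le_of_eq ?_) (Complex.abs_im_le_norm _)
      split_ifs <;> simp)
  have h1 : z ∈ pmResolventSet (addB T ((σ : ℂ) • E)) := ⟨R, hR⟩
  have h2 : ‖res (addB T ((σ : ℂ) • E)) z‖ ≤ 1 / d := by
    rw [eq_res_of_isResolventOf hR]; exact hRn
  have hS : ‖(σ : ℂ) • E‖ ≤ 2 * b₁ * w := by
    rw [norm_smul]
    have : ‖(σ:ℂ)‖ = σ := by simp [abs_of_nonneg hσ0]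
    rw [this, hσ]
    have : 0 ≤ 2 * b₁ * w := by positivity
    nlinarith
  have hre : |z.re| ≤ |r| + δ' * w := by
    have : |z.re| ≤ |z.re - r| + |r| := by
      calc |z.re| = |(z.re - r) + r| := by ring_nf
        _ ≤ _ := abs_add_le _ _
    linarith
  have hB : ∀ y (hy : res (addB T ((σ : ℂ) • E)) z y ∈ T.domain),
      ‖C ⟨res (addB T ((σ : ℂ) • E)) z y, hy⟩‖ ≤ q * ‖y‖ := by
    intro y hy
    exact res_bound hC hb hM hp0 hp1 h1 hd0 h2 (by rw [hd]; exact le_max_right _ _)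
      (X := |r| + (δ' + 2 * b₁) * w) (by nlinarith) (hQ d (by rw [hd]; exact le_max_left _ _)) y hy
  obtain ⟨hA, hu⟩ := pert h1 C hq0 hq1 (fun y => hB y _)
  refine ⟨h1, h2, hA, ?_, ?_⟩
  · refine ContinuousLinearMap.opNorm_le_bound _ (by positivity) fun y => ?_
    obtain ⟨u, e, hu⟩ := hu y
    rw [e]
    calc _ ≤ 1 / d * (‖y‖ / (1 - q)) := by
          refine ((res _ z).le_opNorm u).trans ?_
          gcongr
      _ = _ := by field_simp
  · intro y
    obtain ⟨u, e, hu⟩ := hu y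
    exact ⟨u, e, hu, hB u _⟩

end PM

namespace PM
open Filter Topology

lemma opNorm_le_of_factor {R R' : H →L[ℂ] H} {k c : ℝ} (hk : 0 ≤ k) (hc : 0 ≤ c) (hR' : ‖R'‖ ≤ c)
    (h : ∀ y, ∃ u, R y = R' u ∧ ‖u‖ ≤ k * ‖y‖) : ‖R‖ ≤ c * k := by
  refine ContinuousLinearMap.opNorm_le_bound _ (by positivity) fun y => ?_
  obtain ⟨u, e, hu⟩ := h y
  rw [e]
  calc ‖R' u‖ ≤ ‖R'‖ * ‖u‖ := R'.le_opNorm u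
    _ ≤ c * (k * ‖y‖) := by gcongr
    _ = _ := by ring

set_option maxHeartbeats 2000000 in
lemma lines {T : H →ₗ.[ℂ] H} {C : T.domain →ₗ[ℂ] H} {p b M b₁ δ h : ℝ} (hT : IsSA T)
    (hC : SubC T C p b M) (hb : 0 < b) (hM : 0 ≤ M) (hp0 : 0 ≤ p) (hp1 : p < 1)
    (hpM : p = 0 → M = 0) (hh : b < h) (hδ : 0 < δ) (hδb : δ < b₁ - b) (m : ℕ) :
    ∃ K ≥ 1, ∃ R0 ≥ 1, ∀ r : ℝ, R0 ≤ |r| → ∀ F : Finset ℝ,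
      (∀ ν ∈ F, |ν - r| < b₁ * |r| ^ p) →
      (∀ l : ℝ, (l : ℂ) ∉ pmResolventSet T → |l - r| < b₁ * |r| ^ p → l ∈ F) →
      (∀ ν ∈ F, FiniteDimensional ℂ (pmEigenspace T (ν : ℂ))) →
      (∑ ν ∈ F, Module.finrank ℂ (pmEigenspace T (ν : ℂ))) ≤ m →
      ∃ r' : ℝ, |r' - r| ≤ δ * |r| ^ p ∧
        ∀ y : ℝ, Good T C ((r' : ℂ) + Complex.I * (y : ℂ)) K (|r| ^ p) := by
  obtain ⟨δ', hd1, hd2⟩ := exists_between hδb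
  have hb₁ : 0 < b₁ := by linarith
  have hδ'0 : 0 < δ' := by linarith
  have hδ'b : δ' < b₁ := by linarith
  set κ := b₁ - δ' with hκ
  have hκ0 : 0 < κ := by linarith
  have hh0 : 0 < h := by linarith
  obtain ⟨q, hq0, hq1, ρ0, hρ0, hQ⟩ := lemmaQ hb hM hp0 hp1 hpM (show b < κ by linarith)
    (show 0 ≤ δ' + 2 * b₁ by positivity)
  have h1q : 0 < 1 - q := by linarith
  obtain ⟨K1, hK1, ρ1, hρ1, hout⟩ := outside hT hC hb hM hp0 hp1 hpM hh
  set L1 := 2 * b₁ / (κ * (1 - q)) with hL1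
  have hL10 : 0 ≤ L1 := by positivity
  obtain ⟨⟨η, hη, hdet1⟩, ⟨Kd0, hdet2⟩, ⟨Ki, hKi, hinv⟩⟩ := matrix_facts m L1
  set Kd := max Kd0 1 with hKd
  have hKd1 : 1 ≤ Kd := le_max_right _ _
  set Y0 := 2 * b₁ / ((1 - q) * η) with hY0
  have hY00 : 0 < Y0 := by positivity
  set h0 := h * (1 + δ) with hh0def
  have hh00 : 0 < h0 := by positivity
  obtain ⟨ε, hε, hline⟩ := compact_line (Kd * Kd) (1 / 4) Y0 h0 δ δ' (by norm_num) hδ hd1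
  set L2 := Ki / (ε / Kd) with hL2
  have hL20 : 0 ≤ L2 := by positivity
  set K2 := 1 + L1 * ((m:ℝ) * ((m:ℝ) * L2)) with hK2
  have hK20 : 1 ≤ K2 := by
    have : 0 ≤ L1 * ((m:ℝ) * ((m:ℝ) * L2)) := by positivity
    linarith
  set K := K1 * (1 + 1 / h0) + K2 / (1 - q) * (1 + 1 / κ) with hK
  have hK3 : K1 ≤ K := by
    have a : 0 ≤ K1 * (1 / h0) := by positivity
    have b : 0 ≤ K2 / (1 - q) * (1 + 1 / κ) := by positivity
    rw [hK]; linarith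
  have hK4 : K1 / h0 ≤ K := by
    have b : 0 ≤ K2 / (1 - q) * (1 + 1 / κ) := by positivity
    have : K1 / h0 = K1 * (1 / h0) := by ring
    rw [hK, this]; linarith
  have hK5 : K2 / (1 - q) ≤ K := by
    have a : 0 ≤ K1 * (1 + 1 / h0) := by positivity
    have b : 0 ≤ K2 / (1 - q) * (1 / κ) := by positivity
    rw [hK]; linarith
  have hK6 : K2 / (1 - q) * (1 / κ) ≤ K := by
    have a : 0 ≤ K1 * (1 + 1 / h0) := by positivity
    have b : 0 ≤ K2 / (1 - q) := by positivity
    rw [hK]; linarith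
  refine ⟨K, hK1.trans hK3, max ρ0 ρ1, hρ0.trans (le_max_left _ _), ?_⟩
  intro r hr F hF hF' hfd hm
  have hrρ0 : ρ0 ≤ |r| := (le_max_left _ _).trans hr
  have hrρ1 : ρ1 ≤ |r| := (le_max_right _ _).trans hr
  have hr1 : 1 ≤ |r| := by linarith
  have hr0 : 0 < |r| := by linarith
  have hw : 0 < |r| ^ p := Real.rpow_pos_of_pos hr0 p
  set w := |r| ^ p with hwdef
  have hiso : ∀ ν ∈ F, ∀ᶠ l : ℝ in 𝓝 ν, (l : ℂ) ∉ pmResolventSet T → l = ν := by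
    intro ν hν
    have e1 : ∀ᶠ l : ℝ in 𝓝 ν, |l - r| < b₁ * w := by
      have : ContinuousAt (fun l : ℝ => |l - r|) ν := by fun_prop
      exact this.eventually (gt_mem_nhds (hF ν hν))
    have e2 : ∀ᶠ l : ℝ in 𝓝 ν, l ∉ (F.erase ν : Set ℝ) :=
      (F.erase ν).finite_toSet.isClosed.isOpen_compl.mem_nhds (by simp)
    filter_upwards [e1, e2] with l h1 h2 h3
    by_contra hne
    exact h2 (by simpa using And.intro (hF' l h3 h1) hne)
  obtain ⟨E, hEs, hEi, hEr, hEres⟩ := hT.specProj F hiso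
  have hE1 := norm_proj_le hEs hEi
  obtain ⟨hfd', hfr⟩ := finrank_sup_le F (fun ν => pmEigenspace T (ν:ℂ)) hfd
  obtain ⟨e, he1, hEe⟩ := proj_expand hEs hEi hEr (hfr.trans hm)
  set σ := 2 * b₁ * w with hσ
  have hσ0 : 0 < σ := by positivity
  have hσn : ‖(σ:ℂ)‖ = σ := by simp [abs_of_pos hσ0]
  have hst := fun z : ℂ => fun hz : |z.re - r| ≤ δ' * w =>
    strip hC hb hM hp0 hp1 hδ'0 hδ'b hq0 hq1 hr0
      (fun d hd => hQ |r| hrρ0 d hd _ (by positivity) le_rfl) hF hF' hE1 hEres hz hσ rfl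
  set T' := addB T ((σ:ℂ) • E) with hT'
  set A' := addC T' C with hA'
  have hdle : ∀ z : ℂ, |z.re - r| ≤ δ' * w → ‖(σ:ℂ)‖ * ‖res T' z‖ ≤ L1 ∧ ‖(σ:ℂ)‖ * ‖res A' z‖ ≤ L1 := by
    intro z hz
    obtain ⟨h1, h2, h3, h4, -⟩ := hst z hz
    have hd : κ * w ≤ max (κ * w) |z.im| := le_max_left _ _
    have hd0 : 0 < κ * w := by positivity
    constructor
    · calc _ ≤ σ * (1 / (κ * w)) := by
            rw [hσn]
            refine mul_le_mul_of_nonneg_left (h2.trans ?_) hσ0.le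
            gcongr
        _ = 2 * b₁ / κ := by rw [hσ]; field_simp
        _ ≤ L1 := by
            rw [hL1]
            refine div_le_div_of_nonneg_left (by positivity) (by positivity) ?_
            nlinarith
    · calc _ ≤ σ * (1 / (κ * w * (1 - q))) := by
            rw [hσn]
            refine mul_le_mul_of_nonneg_left (h4.trans ?_) hσ0.le
            gcongr
        _ = L1 := by rw [hσ, hL1]; field_simp
  let aff : ℂ → ℂ := fun ζ => (r:ℂ) + (w:ℂ) * ζ
  have haff : ∀ ζ : ℂ, |ζ.re| ≤ δ' → |(aff ζ).re - r| ≤ δ' * w := by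
    intro ζ hζ
    have : (aff ζ).re - r = w * ζ.re := by simp [aff]
    rw [this, abs_mul, abs_of_pos hw, mul_comm]
    exact mul_le_mul_of_nonneg_right hζ hw.le
  let f : ℂ → ℂ := fun ζ => (frM A' e (σ:ℂ) (aff ζ)).det * (frM T' e (σ:ℂ) (aff ζ)).det
  have hb1 : ∀ z : ℂ, |z.re - r| ≤ δ' * w → ‖(frM A' e (σ:ℂ) z).det‖ ≤ Kd ∧
      ‖(frM T' e (σ:ℂ) z).det‖ ≤ Kd := by
    intro z hz
    exact ⟨(hdet2 _ fun i j => (frM_entry he1 _ _ i j).trans (hdle z hz).2).trans (le_max_left _ _),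
      (hdet2 _ fun i j => (frM_entry he1 _ _ i j).trans (hdle z hz).1).trans (le_max_left _ _)⟩
  obtain ⟨x, hx, hfx⟩ := hline f (by
    intro ζ hζ
    have hz := haff ζ hζ.le
    obtain ⟨h1, h2, h3, h4, -⟩ := hst _ hz
    have hda : DifferentiableAt ℂ aff ζ := by simp only [aff]; fun_prop
    refine ⟨DifferentiableAt.mul ?_ ?_, ?_⟩
    · exact (frM_diff e (σ:ℂ) h3).comp ζ hda
    · exact (frM_diff e (σ:ℂ) h1).comp ζ hda
    · rw [norm_mul]
      have := hb1 _ hz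
      exact mul_le_mul this.1 this.2 (norm_nonneg _) (by linarith)) (by
    have hz : |(aff (Complex.I * (Y0:ℂ))).re - r| ≤ δ' * w := haff _ (by simpa using hδ'0.le)
    obtain ⟨h1, h2, h3, h4, -⟩ := hst _ hz
    have him : |(aff (Complex.I * (Y0:ℂ))).im| = Y0 * w := by
      have : (aff (Complex.I * (Y0:ℂ))).im = Y0 * w := by simp [aff]; ring
      rw [this, abs_of_pos (by positivity)]
    rw [him] at h2 h4
    have hd : Y0 * w ≤ max (κ * w) (Y0 * w) := le_max_right _ _
    have hd0 : 0 < Y0 * w := by positivity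
    have c1 : ‖(σ:ℂ)‖ * ‖res T' (aff (Complex.I * (Y0:ℂ)))‖ ≤ η := by
      calc _ ≤ σ * (1 / (Y0 * w)) := by
            rw [hσn]
            refine mul_le_mul_of_nonneg_left (h2.trans ?_) hσ0.le
            gcongr
        _ = (1 - q) * η := by rw [hσ, hY0]; field_simp
        _ ≤ η := by nlinarith
    have c2 : ‖(σ:ℂ)‖ * ‖res A' (aff (Complex.I * (Y0:ℂ)))‖ ≤ η := by
      calc _ ≤ σ * (1 / (Y0 * w * (1 - q))) := by
            rw [hσn]
            refine mul_le_mul_of_nonneg_left (h4.trans ?_) hσ0.le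
            gcongr
        _ = η := by rw [hσ, hY0]; field_simp
    have d1 := hdet1 _ fun i j => (frM_entry he1 _ _ i j).trans c2
    have d2 := hdet1 _ fun i j => (frM_entry he1 _ _ i j).trans c1
    change _ ≤ ‖_ * _‖
    rw [norm_mul]
    calc (1/4 : ℝ) = 1/2 * (1/2) := by norm_num
      _ ≤ _ := mul_le_mul d1 d2 (by norm_num) (norm_nonneg _))
  refine ⟨r + w * x, ?_, ?_⟩
  · rw [add_sub_cancel_left, abs_mul, abs_of_pos hw]; nlinarith
  intro y
  by_cases hy : |y| ≤ h0 * w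
  · have hy2 : |y / w| ≤ h0 := by rw [abs_div, abs_of_pos hw, div_le_iff₀ hw]; exact hy
    have hfy := hfx (y / w) hy2
    set z : ℂ := ((r + w * x : ℝ) : ℂ) + Complex.I * (y:ℂ) with hz
    have hzaff : aff ((x:ℂ) + Complex.I * ((y / w : ℝ) : ℂ)) = z := by
      have : (w:ℂ) ≠ 0 := by exact_mod_cast hw.ne'
      simp only [aff, hz]; push_cast; field_simp; ring
    have hzs : |z.re - r| ≤ δ' * w := by
      rw [← hzaff]; exact haff _ (by simp; linarith)
    obtain ⟨h1, h2, h3, h4, h5⟩ := hst _ hzs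
    obtain ⟨hL1T, hL1A⟩ := hdle z hzs
    have hfy' : ε ≤ ‖(frM A' e (σ:ℂ) z).det‖ * ‖(frM T' e (σ:ℂ) z).det‖ := by
      rw [← norm_mul, ← hzaff]; exact hfy
    obtain ⟨hk1, hk2⟩ := hb1 z hzs
    have hKd0 : 0 < Kd := by linarith
    have dA : ε / Kd ≤ ‖(frM A' e (σ:ℂ) z).det‖ := by
      rw [div_le_iff₀ hKd0]
      exact hfy'.trans (mul_le_mul_of_nonneg_left hk2 (norm_nonneg _))
    have dT : ε / Kd ≤ ‖(frM T' e (σ:ℂ) z).det‖ := by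
      rw [div_le_iff₀ hKd0, mul_comm]
      exact hfy'.trans (mul_le_mul_of_nonneg_right hk1 (norm_nonneg _))
    have hεK : 0 < ε / Kd := by positivity
    have iA := hinv _ (fun i j => (frM_entry he1 _ z i j).trans hL1A) _ hεK dA
    have iT := hinv _ (fun i j => (frM_entry he1 _ z i j).trans hL1T) _ hεK dT
    have nA : (frM A' e (σ:ℂ) z).det ≠ 0 := norm_pos_iff.1 (hεK.trans_le dA)
    have nT : (frM T' e (σ:ℂ) z).det ≠ 0 := norm_pos_iff.1 (hεK.trans_le dT)
    have hAeq : addB (addC T C) ((σ:ℂ) • E) = A' := addB_addC T C _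
    obtain ⟨rhoT, facT⟩ := finrank_pert (A := T) hEe he1 h1 nT iT
    have h3' : z ∈ pmResolventSet (addB (addC T C) ((σ:ℂ) • E)) := by rw [hAeq]; exact h3
    obtain ⟨rhoA, facA⟩ := finrank_pert (A := addC T C) hEe he1 h3' (by rw [hAeq]; exact nA)
      (L := L2) (by rw [hAeq]; exact iA)
    rw [hAeq] at facA
    have kk : ∀ R : H →L[ℂ] H, ‖(σ:ℂ)‖ * ‖R‖ ≤ L1 →
        (1 + ‖(σ:ℂ)‖ * ((m:ℝ) * ((m:ℝ) * (L2 * ‖R‖)))) ≤ K2 := by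
      intro R hR
      have : ‖(σ:ℂ)‖ * ((m:ℝ) * ((m:ℝ) * (L2 * ‖R‖))) = (‖(σ:ℂ)‖ * ‖R‖) * ((m:ℝ) * ((m:ℝ) * L2)) := by
        ring
      rw [this, hK2]
      gcongr
    have facT' : ∀ y, ∃ u, res T z y = res T' z u ∧ ‖u‖ ≤ K2 * ‖y‖ := by
      intro y
      obtain ⟨u, e1, e2⟩ := facT y
      exact ⟨u, e1, e2.trans (mul_le_mul_of_nonneg_right (kk _ hL1T) (norm_nonneg _))⟩
    have facA' : ∀ y, ∃ u, res (addC T C) z y = res A' z u ∧ ‖u‖ ≤ K2 * ‖y‖ := by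
      intro y
      obtain ⟨u, e1, e2⟩ := facA y
      exact ⟨u, e1, e2.trans (mul_le_mul_of_nonneg_right (kk _ hL1A) (norm_nonneg _))⟩
    have hd : κ * w ≤ max (κ * w) |z.im| := le_max_left _ _
    have hd0 : 0 < κ * w := by positivity
    have h2' : ‖res T' z‖ ≤ 1 / (κ * w) := h2.trans (by gcongr)
    have h4' : ‖res A' z‖ ≤ 1 / (κ * w * (1 - q)) := h4.trans (by gcongr)
    have hfin : 1 / (κ * w * (1 - q)) * K2 ≤ K / w := by
      have : 1 / (κ * w * (1 - q)) * K2 = (K2 / (1 - q) * (1 / κ)) / w := by field_simp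
      rw [this]; gcongr
    refine ⟨rhoT, rhoA, ?_, ?_, ?_⟩
    · refine (opNorm_le_of_factor (by linarith) (by positivity) h2' facT').trans (le_trans ?_ hfin)
      refine mul_le_mul_of_nonneg_right ?_ (by linarith)
      refine one_div_le_one_div_of_le (by positivity) ?_
      nlinarith
    · exact (opNorm_le_of_factor (by linarith) (by positivity) h4' facA').trans hfin
    · intro v hv
      obtain ⟨u, e1, e2⟩ := facA' v
      obtain ⟨u', e3, e4, e5⟩ := h5 u
      have : ‖C ⟨res (addC T C) z v, hv⟩‖ = ‖C ⟨res T' z u', res_mem h1 u'⟩‖ := by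
        congr 2; exact Subtype.ext (e1.trans e3)
      rw [this]
      calc _ ≤ q * ‖u'‖ := e5
        _ ≤ 1 * (‖u‖ / (1 - q)) := by gcongr
        _ ≤ 1 * ((K2 * ‖v‖) / (1 - q)) := by gcongr
        _ = K2 / (1 - q) * ‖v‖ := by ring
        _ ≤ K * ‖v‖ := by gcongr
  · push Not at hy
    have hwr : w ≤ |r| := by
      calc w ≤ |r| ^ (1:ℝ) := Real.rpow_le_rpow_of_exponent_le hr1 hp1.le
        _ = |r| := Real.rpow_one _
    set z : ℂ := ((r + w * x : ℝ) : ℂ) + Complex.I * (y:ℂ) with hz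
    have hzre : z.re = r + w * x := by simp [hz]
    have hzim : z.im = y := by simp [hz]
    have hre : |z.re| ≤ (1 + δ) * |r| := by
      rw [hzre]
      refine (abs_add_le _ _).trans ?_
      rw [abs_mul, abs_of_pos hw]
      nlinarith [abs_nonneg x]
    have hpow : ((1 + δ) * |r|) ^ p ≤ (1 + δ) * w := by
      rw [Real.mul_rpow (by positivity) (by positivity)]
      gcongr
      calc (1 + δ) ^ p ≤ (1 + δ) ^ (1:ℝ) := Real.rpow_le_rpow_of_exponent_le (by linarith) hp1.le
        _ = _ := Real.rpow_one _
    have g := hout ((1 + δ) * |r|) (by nlinarith) z hre (by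
      rw [hzim]
      calc h * ((1 + δ) * |r|) ^ p ≤ h * ((1 + δ) * w) := by gcongr
        _ = h0 * w := by rw [hh0def]; ring
        _ ≤ |y| := hy.le)
    refine g.mono hK3 ?_
    rw [hzim]
    have hhw : 0 < h0 * w := by positivity
    calc K1 / |y| ≤ K1 / (h0 * w) := by gcongr
      _ = (K1 / h0) / w := by field_simp
      _ ≤ K / w := by gcongr

end PM

namespace PM
open Filter Topology

/-- a primitive dominating the kernel -/
structure Prim (p t Cp : ℝ) (F F' : ℝ → ℝ) : Prop where
  der : ∀ x, 1 ≤ x → HasDerivAt F (F' x) x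
  dom : ∀ x, 1 ≤ x → x ^ p / ((t - x) ^ 2 + (x ^ p) ^ 2) ≤ F' x
  bdd : ∀ x y, 1 ≤ x → 1 ≤ y → F y - F x ≤ Cp

lemma rpow_le_self {x p : ℝ} (hx : 1 ≤ x) (hp1 : p < 1) : x ^ p ≤ x := by
  calc x ^ p ≤ x ^ (1:ℝ) := Real.rpow_le_rpow_of_exponent_le hx hp1.le
    _ = x := Real.rpow_one x

lemma rpow_two_mul_le {x p : ℝ} (hx : 0 ≤ x) (hp0 : 0 ≤ p) (hp1 : p < 1) :
    (2 * x) ^ p ≤ 2 * x ^ p := by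
  rw [Real.mul_rpow (by norm_num) hx]
  gcongr
  exact rpow_le_self (by norm_num) hp1

lemma exists_prim {p : ℝ} (hp0 : 0 ≤ p) (hp1 : p < 1) :
    ∃ Cp, 0 ≤ Cp ∧ ∀ t, ∃ F F', Prim p t Cp F F' := by
  have h1p : 0 < 1 - p := by linarith
  refine ⟨4 / (1 - p) + 8 * Real.pi, by positivity, fun t => ?_⟩
  have hder0 : ∀ x : ℝ, 1 ≤ x →
      HasDerivAt (fun x : ℝ => -(4 / (1 - p)) * x ^ (p - 1)) (4 * x ^ (p - 2)) x := by
    intro x hx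
    have := (Real.hasDerivAt_rpow_const (x := x) (p := p - 1) (Or.inl (by linarith))).const_mul
      (-(4 / (1 - p)))
    refine this.congr_deriv ?_
    rw [show p - 1 - 1 = p - 2 by ring]
    field_simp; ring
  have hb0 : ∀ x : ℝ, 1 ≤ x → 0 ≤ x ^ (p - 1) ∧ x ^ (p - 1) ≤ 1 := fun x hx =>
    ⟨by positivity, Real.rpow_le_one_of_one_le_of_nonpos hx (by linarith)⟩
  have hfar : ∀ x : ℝ, 1 ≤ x → t < x / 2 → x ^ p / ((t - x) ^ 2 + (x ^ p) ^ 2) ≤ 4 * x ^ (p - 2) := by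
    intro x hx ht
    have hx0 : 0 < x := by linarith
    have e : x ^ (p - 2) = x ^ p / x ^ 2 := by
      rw [Real.rpow_sub hx0]; norm_num
    rw [e]
    have hxp : 0 < x ^ p := Real.rpow_pos_of_pos hx0 p
    calc x ^ p / ((t - x) ^ 2 + (x ^ p) ^ 2) ≤ x ^ p / (x ^ 2 / 4) := by
          apply div_le_div_of_nonneg_left hxp.le (by positivity)
          nlinarith [sq_nonneg (x ^ p)]
      _ = _ := by field_simp
  by_cases ht : t < 1 / 2
  · refine ⟨_, _, hder0, fun x hx => hfar x hx (by linarith), ?_⟩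
    intro x y hx hy
    have h1 := hb0 x hx
    have h2 := hb0 y hy
    have : 0 < 4 / (1 - p) := by positivity
    have hpi := Real.pi_pos
    nlinarith
  · push Not at ht
    have ht0 : 0 < t := by linarith
    set u := t ^ p with hu
    have hu0 : 0 < u := Real.rpow_pos_of_pos ht0 p
    refine ⟨fun x => -(4 / (1 - p)) * x ^ (p - 1) + 8 * Real.arctan ((x - t) / (u / 2)),
      fun x => 4 * x ^ (p - 2) + 4 * u / ((t - x) ^ 2 + u ^ 2 / 4), ?_, ?_, ?_⟩
    · intro x hx
      refine (hder0 x hx).add ?_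
      have h1 : HasDerivAt (fun x : ℝ => (x - t) / (u / 2)) (1 / (u / 2)) x :=
        ((hasDerivAt_id x).sub_const t).div_const _
      have := (h1.arctan).const_mul 8
      refine this.congr_deriv ?_
      field_simp
      ring
    · intro x hx
      have hx0 : 0 < x := by linarith
      have hxp : 0 < x ^ p := Real.rpow_pos_of_pos hx0 p
      have n1 : 0 ≤ 4 * x ^ (p - 2) := by positivity
      have n2 : 0 ≤ 4 * u / ((t - x) ^ 2 + u ^ 2 / 4) := by positivity
      by_cases h1 : t < x / 2
      · linarith [hfar x hx h1]
      · push Not at h1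
        have hxu : x ^ p ≤ 2 * u := by
          calc x ^ p ≤ (2 * t) ^ p := Real.rpow_le_rpow hx0.le (by linarith) hp0
            _ ≤ 2 * u := rpow_two_mul_le ht0.le hp0 hp1
        have key : ((t - x) ^ 2 + u ^ 2 / 4) / 2 ≤ (t - x) ^ 2 + (x ^ p) ^ 2 := by
          by_cases h2 : t ≤ 2 * x
          · have : u ≤ 2 * x ^ p := by
              calc u ≤ (2 * x) ^ p := Real.rpow_le_rpow ht0.le h2 hp0
                _ ≤ _ := rpow_two_mul_le hx0.le hp0 hp1
            nlinarith [sq_nonneg (t - x)]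
          · push Not at h2
            have : u ≤ t := rpow_le_self (by linarith) hp1
            nlinarith [sq_nonneg (x ^ p)]
        have : x ^ p / ((t - x) ^ 2 + (x ^ p) ^ 2) ≤ 4 * u / ((t - x) ^ 2 + u ^ 2 / 4) := by
          rw [div_le_div_iff₀ (by positivity) (by positivity)]
          have k0 : 0 ≤ (t - x) ^ 2 + u ^ 2 / 4 := by positivity
          nlinarith [mul_le_mul hxu key (by positivity) (by positivity)]
        linarith
    · intro x y hx hy
      have h1 := hb0 x hx
      have h2 := hb0 y hy
      have : 0 < 4 / (1 - p) := by positivity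
      have a1 := Real.arctan_lt_pi_div_two ((y - t) / (u / 2))
      have a2 := Real.neg_pi_div_two_lt_arctan ((x - t) / (u / 2))
      have : -(4 / (1 - p)) * y ^ (p - 1) + 4 / (1 - p) * x ^ (p - 1) ≤ 4 / (1 - p) := by nlinarith
      change (-(4 / (1 - p)) * y ^ (p - 1) + 8 * Real.arctan ((y - t) / (u / 2))) -
        (-(4 / (1 - p)) * x ^ (p - 1) + 8 * Real.arctan ((x - t) / (u / 2))) ≤ _
      linarith

lemma Prim.mvt {p t Cp : ℝ} {F F' : ℝ → ℝ} (hF : Prim p t Cp F F') {u v m : ℝ} (hu : 1 ≤ u)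
    (huv : u ≤ v) (hm : ∀ x, u ≤ x → x ≤ v → m ≤ x ^ p / ((t - x) ^ 2 + (x ^ p) ^ 2)) :
    m * (v - u) ≤ F v - F u := by
  refine (convex_Icc u v).mul_sub_le_image_sub_of_le_deriv
    (fun x hx => (hF.der x (hu.trans hx.1)).continuousAt.continuousWithinAt)
    (fun x hx => ?_) (fun x hx => ?_) u (Set.left_mem_Icc.2 huv) v (Set.right_mem_Icc.2 huv) huv
  · rw [interior_Icc] at hx
    exact (hF.der x (hu.trans hx.1.le)).differentiableAt.differentiableWithinAt
  · rw [interior_Icc] at hx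
    rw [(hF.der x (hu.trans hx.1.le)).deriv]
    exact (hm x hx.1.le hx.2.le).trans (hF.dom x (hu.trans hx.1.le))

lemma Prim.mono {p t Cp : ℝ} {F F' : ℝ → ℝ} (hF : Prim p t Cp F F') {u v : ℝ} (hu : 1 ≤ u)
    (huv : u ≤ v) : F u ≤ F v := by
  have := hF.mvt hu huv (m := 0) (fun x h1 h2 => by have : 0 < x := by linarith
                                                    positivity)
  linarith

lemma Prim.line_b {p t Cp c : ℝ} {F F' : ℝ → ℝ} (hF : Prim p t Cp F F') (hp0 : 0 ≤ p)
    (hp1 : p < 1) (hc0 : 0 < c) (hc1 : c ≤ 1) {a b : ℝ} (ha : 1 ≤ a) (hab : c * b ^ p ≤ b - a)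
    (ht : c * b ^ p ≤ |t - b|) :
    (b ^ p) ^ 2 / (t - b) ^ 2 ≤ (4 / c * (2 + 2 / c ^ 2)) * (F b - F a) := by
  have hb1 : 1 ≤ b := by
    by_contra hlt
    push Not at hlt
    by_cases h0 : 0 ≤ b
    · have : 0 ≤ b ^ p := by positivity
      nlinarith
    · have hlt2 : b < a := by linarith
      have h3 : |b ^ p| ≤ |b| ^ p := Real.abs_rpow_le_abs_rpow b p
      have h5 : |b| ^ p ≤ max 1 |b| := by
        rcases le_total 1 |b| with h | h
        · exact (rpow_le_self h hp1).trans (le_max_right _ _)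
        · exact (Real.rpow_le_one (abs_nonneg _) h hp0).trans (le_max_left _ _)
      have h6 : |b| = -b := abs_of_neg (not_le.1 h0)
      have h4 := neg_le_of_abs_le (h3.trans h5)
      have : c * b ^ p ≥ - max 1 |b| := by
        have : (0:ℝ) ≤ max 1 |b| := by positivity
        nlinarith
      rcases le_total 1 |b| with h | h
      · rw [max_eq_right h] at this; linarith
      · rw [max_eq_left h] at this; linarith
  have hb0 : 0 < b := by linarith
  set w := b ^ p with hw
  have hw0 : 0 < w := Real.rpow_pos_of_pos hb0 p
  have hwb : w ≤ b := rpow_le_self hb1 hp1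
  have hd0 : 0 < |t - b| := lt_of_lt_of_le (by positivity) ht
  have hsq : (c * w) ^ 2 ≤ (t - b) ^ 2 := by
    rw [← sq_abs (t - b)]; gcongr
  have hD : 0 < (t - b) ^ 2 := by rw [← sq_abs (t - b)]; positivity
  have hu : a ≤ b - c / 2 * w := by nlinarith
  have hwsq : w ^ 2 ≤ (t - b) ^ 2 / c ^ 2 := by
    rw [le_div_iff₀ (by positivity)]; nlinarith
  have := hF.mvt (u := b - c / 2 * w) (v := b) (m := (w / 2) / ((2 + 2 / c ^ 2) * (t - b) ^ 2))
    (ha.trans hu) (by nlinarith) (by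
      intro x h1 h2
      have hx1 : 1 ≤ x := by linarith
      have hbx : b ≤ 2 * x := by nlinarith
      have hwx : w ≤ 2 * x ^ p := by
        calc w ≤ (2 * x) ^ p := Real.rpow_le_rpow hb0.le hbx hp0
          _ ≤ _ := rpow_two_mul_le (by linarith) hp0 hp1
      have hxw : x ^ p ≤ w := Real.rpow_le_rpow (by linarith) h2 hp0
      have hx0 : 0 < x ^ p := Real.rpow_pos_of_pos (by linarith) p
      apply div_le_div₀ hx0.le (by linarith) (by positivity)
      have e1 : (t - x) ^ 2 ≤ 2 * (t - b) ^ 2 + 2 * (b - x) ^ 2 := by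
        nlinarith [sq_nonneg ((t - b) - (b - x))]
      have e2 : (b - x) ^ 2 ≤ (c / 2 * w) ^ 2 := by
        apply pow_le_pow_left₀ (by linarith); linarith
      have e3 : (x ^ p) ^ 2 ≤ w ^ 2 := by gcongr
      have e4 : (2 + 2 / c ^ 2) * (t - b) ^ 2 = 2 * (t - b) ^ 2 + 2 * ((t - b) ^ 2 / c ^ 2) := by
        field_simp
      rw [e4]
      have e5 : (c / 2 * w) ^ 2 ≤ w ^ 2 / 4 := by
        have : c ^ 2 ≤ 1 := by nlinarith
        nlinarith [sq_nonneg w]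
      nlinarith)
  have hm := hF.mono ha hu
  have e : (w / 2) / ((2 + 2 / c ^ 2) * (t - b) ^ 2) * (b - (b - c / 2 * w))
      = (w ^ 2 / (t - b) ^ 2) / (4 / c * (2 + 2 / c ^ 2)) := by
    field_simp; ring
  rw [e, div_le_iff₀ (by positivity)] at this
  refine this.trans ?_
  rw [mul_comm]
  gcongr

lemma Prim.line_a {p t Cp c : ℝ} {F F' : ℝ → ℝ} (hF : Prim p t Cp F F') (hp0 : 0 ≤ p)
    (hp1 : p < 1) (hc0 : 0 < c) (hc1 : c ≤ 1) {a b : ℝ} (ha : 1 ≤ a) (hab : c * a ^ p ≤ b - a)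
    (ht : c * a ^ p ≤ |t - a|) :
    (a ^ p) ^ 2 / (t - a) ^ 2 ≤ (2 / c * (2 + 5 / c ^ 2)) * (F b - F a) := by
  have ha0 : 0 < a := by linarith
  set w := a ^ p with hw
  have hw0 : 0 < w := Real.rpow_pos_of_pos ha0 p
  have hwa : w ≤ a := rpow_le_self ha hp1
  have hd0 : 0 < |t - a| := lt_of_lt_of_le (by positivity) ht
  have hsq : (c * w) ^ 2 ≤ (t - a) ^ 2 := by
    rw [← sq_abs (t - a)]; gcongr
  have hD : 0 < (t - a) ^ 2 := by rw [← sq_abs (t - a)]; positivity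
  have hu : a + c / 2 * w ≤ b := by nlinarith
  have hwsq : w ^ 2 ≤ (t - a) ^ 2 / c ^ 2 := by
    rw [le_div_iff₀ (by positivity)]; nlinarith
  have hcw : 0 < c / 2 * w := by positivity
  have := hF.mvt (u := a) (v := a + c / 2 * w) (m := w / ((2 + 5 / c ^ 2) * (t - a) ^ 2))
    ha (by linarith) (by
      intro x h1 h2
      have hx1 : 1 ≤ x := by linarith
      have hbx : x ≤ 2 * a := by nlinarith
      have hwx : x ^ p ≤ 2 * w := by
        calc x ^ p ≤ (2 * a) ^ p := Real.rpow_le_rpow (by linarith) hbx hp0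
          _ ≤ _ := rpow_two_mul_le (by linarith) hp0 hp1
      have hxw : w ≤ x ^ p := Real.rpow_le_rpow (by linarith) h1 hp0
      have hx0 : 0 < x ^ p := Real.rpow_pos_of_pos (by linarith) p
      apply div_le_div₀ hx0.le hxw (by positivity)
      have e1 : (t - x) ^ 2 ≤ 2 * (t - a) ^ 2 + 2 * (x - a) ^ 2 := by
        nlinarith [sq_nonneg ((t - a) + (x - a))]
      have e2 : (x - a) ^ 2 ≤ (c / 2 * w) ^ 2 := by
        apply pow_le_pow_left₀ (by linarith); linarith
      have e3 : (x ^ p) ^ 2 ≤ (2 * w) ^ 2 := by gcongr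
      have e4 : (2 + 5 / c ^ 2) * (t - a) ^ 2 = 2 * (t - a) ^ 2 + 5 * ((t - a) ^ 2 / c ^ 2) := by
        field_simp
      rw [e4]
      have e5 : (c / 2 * w) ^ 2 ≤ w ^ 2 / 4 := by
        have : c ^ 2 ≤ 1 := by nlinarith
        nlinarith [sq_nonneg w]
      nlinarith)
  have hm := hF.mono (by linarith) hu
  have e : w / ((2 + 5 / c ^ 2) * (t - a) ^ 2) * (a + c / 2 * w - a)
      = (w ^ 2 / (t - a) ^ 2) / (2 / c * (2 + 5 / c ^ 2)) := by
    field_simp; ring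
  rw [e, div_le_iff₀ (by positivity)] at this
  refine this.trans ?_
  rw [mul_comm]
  gcongr

lemma Prim.horiz {p t Cp h : ℝ} {F F' : ℝ → ℝ} (hF : Prim p t Cp F F') (hp0 : 0 ≤ p)
    (hp1 : p < 1) (hh : 0 < h) {a b : ℝ} (ha : 1 ≤ a) (hab : a ≤ b) :
    ∫ x in Set.Icc a b, x ^ p / ((t - x) ^ 2 + (h * x ^ p) ^ 2) ≤ (1 + 1 / h ^ 2) * (F b - F a) := by
  rw [MeasureTheory.integral_Icc_eq_integral_Ioc, ← intervalIntegral.integral_of_le hab]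
  have hcont : ContinuousOn (fun x : ℝ => x ^ p / ((t - x) ^ 2 + (h * x ^ p) ^ 2)) (Set.Icc a b) := by
    have h1 : ContinuousOn (fun x : ℝ => x ^ p) (Set.Icc a b) :=
      continuousOn_id.rpow_const (fun x hx => Or.inr hp0)
    refine h1.div (by fun_prop) (fun x hx => ?_)
    have : 0 < x := by linarith [hx.1]
    positivity
  have := intervalIntegral.integral_le_sub_of_hasDeriv_right_of_le
    (g := fun x => (1 + 1 / h ^ 2) * F x) (g' := fun x => (1 + 1 / h ^ 2) * F' x) hab
    (fun x hx => ((hF.der x (ha.trans hx.1)).const_mul _).continuousAt.continuousWithinAt)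
    (fun x hx => ((hF.der x (ha.trans hx.1.le)).const_mul _).hasDerivWithinAt)
    (hcont.integrableOn_Icc) (by
      intro x hx
      have hx1 : 1 ≤ x := ha.trans hx.1.le
      have hx0 : 0 < x ^ p := Real.rpow_pos_of_pos (by linarith) p
      refine le_trans ?_ (mul_le_mul_of_nonneg_left (hF.dom x hx1) (by positivity))
      rw [mul_div_assoc', div_le_div_iff₀ (by positivity) (by positivity)]
      have : (t - x) ^ 2 + (x ^ p) ^ 2 ≤ (1 + 1 / h ^ 2) * ((t - x) ^ 2 + (h * x ^ p) ^ 2) := by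
        have e : (1 + 1 / h ^ 2) * ((t - x) ^ 2 + (h * x ^ p) ^ 2)
          = (t - x) ^ 2 + (x ^ p) ^ 2 + (h * x ^ p) ^ 2 + 1 / h ^ 2 * (t - x) ^ 2 := by
          field_simp
          ring
        rw [e]
        have : 0 ≤ 1 / h ^ 2 * (t - x) ^ 2 := by positivity
        nlinarith [sq_nonneg (h * x ^ p)]
      nlinarith)
  linarith

end PM

namespace PM
open Filter Topology

lemma sum_tele {f : ℤ → ℝ} {C : ℝ} {N0 : ℤ} (mono : ∀ k, N0 ≤ k → 0 ≤ f k - f (k - 1))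
    (bdd : ∀ k, N0 - 1 ≤ k → f k - f (N0 - 1) ≤ C) (F : Finset ℤ) (hF : ∀ k ∈ F, N0 ≤ k) :
    ∑ k ∈ F, (f k - f (k - 1)) ≤ C := by
  have h1 : ∀ n : ℕ, ∑ i ∈ Finset.range n, (f (N0 + i) - f (N0 + i - 1)) = f (N0 + n - 1) - f (N0 - 1) := by
    intro n
    induction n with
    | zero => simp
    | succ n ih =>
      rw [Finset.sum_range_succ, ih]
      have : N0 + ((n + 1 : ℕ) : ℤ) - 1 = N0 + n := by push_cast; ring
      rw [this]; ring
  obtain ⟨n, hn⟩ : ∃ n : ℕ, ∀ k ∈ F, (k - N0).toNat < n := by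
    refine ⟨(F.sup (fun k => (k - N0).toNat)) + 1, fun k hk => ?_⟩
    exact Nat.lt_succ_of_le (Finset.le_sup (f := fun k => (k - N0).toNat) hk)
  have h2 : ∑ k ∈ F, (f k - f (k - 1))
      ≤ ∑ k ∈ (Finset.range n).image (fun i : ℕ => N0 + (i : ℤ)), (f k - f (k - 1)) := by
    apply Finset.sum_le_sum_of_subset_of_nonneg
    · intro k hk
      rw [Finset.mem_image]
      exact ⟨(k - N0).toNat, Finset.mem_range.2 (hn k hk), by have := hF k hk; omega⟩
    · intro k hk _
      rw [Finset.mem_image] at hk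
      obtain ⟨i, _, rfl⟩ := hk
      exact mono _ (by omega)
  rw [Finset.sum_image (by intro i _ j _ hij; simpa using hij), h1] at h2
  exact h2.trans (bdd _ (by omega))

/-- the scalar majorant of the contour integral over a trapezoid -/
def tot (h p a b l : ℝ) : ℝ :=
  2 * (∫ x in Set.Icc a b, |x| ^ p / ((l - x) ^ 2 + (h * |x| ^ p) ^ 2)) +
    (2 * h * ((|b| ^ p) ^ 2 / (l - b) ^ 2) + 2 * h * ((|a| ^ p) ^ 2 / (l - a) ^ 2))

lemma tot_neg (h p : ℝ) {a b : ℝ} (hab : a ≤ b) (l : ℝ) : tot h p (-b) (-a) (-l) = tot h p a b l := by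
  unfold tot
  rw [MeasureTheory.integral_Icc_eq_integral_Ioc, MeasureTheory.integral_Icc_eq_integral_Ioc,
    ← intervalIntegral.integral_of_le hab, ← intervalIntegral.integral_of_le (by linarith)]
  have := intervalIntegral.integral_comp_neg (a := a) (b := b)
    (fun x : ℝ => |x| ^ p / ((-l - x) ^ 2 + (h * |x| ^ p) ^ 2))
  rw [← this]
  have e : ∀ x : ℝ, (-l - -x) ^ 2 = (l - x) ^ 2 := fun x => by ring
  simp only [abs_neg, e]
  ring

lemma tot_le {p t Cp c h : ℝ} {F F' : ℝ → ℝ} (hF : Prim p t Cp F F') (hp0 : 0 ≤ p)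
    (hp1 : p < 1) (hc0 : 0 < c) (hc1 : c ≤ 1) (hh : 0 < h) {a b : ℝ} (ha : 1 ≤ a)
    (hab : c * (|b| ^ p + |a| ^ p) ≤ b - a)
    (hta : c * |a| ^ p ≤ |t - a|) (htb : c * |b| ^ p ≤ |t - b|) :
    tot h p a b t ≤ (2 * (1 + 1 / h ^ 2) + 2 * h * (4 / c * (2 + 2 / c ^ 2)) +
      2 * h * (2 / c * (2 + 5 / c ^ 2))) * (F b - F a) := by
  have ha' : 0 ≤ |a| ^ p := by positivity
  have hb' : 0 ≤ |b| ^ p := by positivity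
  have hab' : a ≤ b := by nlinarith [mul_nonneg hc0.le ha', mul_nonneg hc0.le hb']
  have ea : |a| = a := abs_of_pos (by linarith)
  have eb : |b| = b := abs_of_pos (by linarith)
  rw [ea] at hab hta ha'
  rw [eb] at hab htb hb'
  have h1 := hF.line_b hp0 hp1 hc0 hc1 ha (by nlinarith [mul_nonneg hc0.le ha', mul_nonneg hc0.le hb']) htb
  have h2 := hF.line_a hp0 hp1 hc0 hc1 ha (b := b) (by nlinarith [mul_nonneg hc0.le ha', mul_nonneg hc0.le hb']) hta
  have h3 := hF.horiz hp0 hp1 hh ha hab'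
  have h4 : ∫ x in Set.Icc a b, |x| ^ p / ((t - x) ^ 2 + (h * |x| ^ p) ^ 2)
      = ∫ x in Set.Icc a b, x ^ p / ((t - x) ^ 2 + (h * x ^ p) ^ 2) := by
    apply MeasureTheory.setIntegral_congr_fun measurableSet_Icc
    intro x hx
    have : |x| = x := abs_of_pos (by linarith [hx.1])
    change |x| ^ p / ((t - x) ^ 2 + (h * |x| ^ p) ^ 2) = x ^ p / ((t - x) ^ 2 + (h * x ^ p) ^ 2)
    rw [this]
  unfold tot
  rw [h4, ea, eb]
  have h5 := mul_le_mul_of_nonneg_left h1 (show 0 ≤ 2 * h by positivity)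
  have h6 := mul_le_mul_of_nonneg_left h2 (show 0 ≤ 2 * h by positivity)
  nlinarith

/-- a sequence of abscissae with large gaps -/
structure SeqP (p c : ℝ) (N : ℕ) (s : ℤ → ℝ) : Prop where
  c0 : 0 < c
  c1 : c ≤ 1
  pos : ∀ k : ℤ, (N : ℤ) - 1 ≤ k → 1 ≤ s k
  neg : ∀ k : ℤ, k ≤ -(N : ℤ) → s k ≤ -1
  gap : ∀ k : ℤ, (N : ℤ) ≤ |k| → c * (|s k| ^ p + |s (k - 1)| ^ p) ≤ s k - s (k - 1)

lemma SeqP.le {p c : ℝ} {N : ℕ} {s : ℤ → ℝ} (S : SeqP p c N s) {k : ℤ} (hk : (N : ℤ) ≤ |k|) :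
    s (k - 1) ≤ s k := by
  have := S.gap k hk
  have : 0 ≤ c * (|s k| ^ p + |s (k - 1)| ^ p) := by
    have := S.c0
    positivity
  linarith

lemma sum_tot {p h c : ℝ} (hp0 : 0 ≤ p) (hp1 : p < 1) (hh : 0 < h) (hc0 : 0 < c) (hc1 : c ≤ 1) :
    ∃ C, 0 ≤ C ∧ ∀ (N : ℕ) (s : ℤ → ℝ), SeqP p c N s → ∀ l : ℝ,
      (∀ k : ℤ, ((N : ℤ) - 1 ≤ k ∨ k ≤ -(N : ℤ)) → c * |s k| ^ p ≤ |l - s k|) →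
      ∀ F : Finset ℤ, (∀ k ∈ F, (N : ℤ) ≤ |k|) → ∑ k ∈ F, tot h p (s (k - 1)) (s k) l ≤ C := by
  obtain ⟨Cp, hCp, hprim⟩ := exists_prim hp0 hp1
  set C0 := (2 * (1 + 1 / h ^ 2) + 2 * h * (4 / c * (2 + 2 / c ^ 2)) +
      2 * h * (2 / c * (2 + 5 / c ^ 2))) with hC0
  have C00 : 0 ≤ C0 := by positivity
  refine ⟨C0 * Cp + C0 * Cp, by positivity, ?_⟩
  intro N s S l hl F hF
  obtain ⟨G, G', hG⟩ := hprim l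
  obtain ⟨E, E', hE⟩ := hprim (-l)
  rw [← Finset.sum_filter_add_sum_filter_not F (fun k => (N : ℤ) ≤ k)]
  refine add_le_add ?_ ?_
  · calc ∑ k ∈ F.filter (fun k => (N : ℤ) ≤ k), tot h p (s (k - 1)) (s k) l
        ≤ ∑ k ∈ F.filter (fun k => (N : ℤ) ≤ k), C0 * (G (s k) - G (s (k - 1))) := by
          apply Finset.sum_le_sum
          intro k hk
          rw [Finset.mem_filter] at hk
          exact tot_le hG hp0 hp1 hc0 hc1 hh (S.pos _ (by omega)) (S.gap k (hF k hk.1))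
            (hl _ (by omega)) (hl _ (by omega))
      _ = C0 * ∑ k ∈ F.filter (fun k => (N : ℤ) ≤ k), (G (s k) - G (s (k - 1))) := by
          rw [Finset.mul_sum]
      _ ≤ C0 * Cp := by
          apply mul_le_mul_of_nonneg_left _ C00
          apply sum_tele (f := fun k => G (s k)) (N0 := N)
          · intro k hk
            have := hG.mono (S.pos (k - 1) (by omega)) (S.le (hk.trans (le_abs_self k)))
            simpa using this
          · intro k hk
            exact hG.bdd _ _ (S.pos _ le_rfl) (S.pos _ hk)
          · intro k hk
            exact (Finset.mem_filter.1 hk).2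
  · have hF' : ∀ k ∈ F.filter (fun k => ¬ (N : ℤ) ≤ k), k ≤ -(N : ℤ) := by
      intro k hk
      rw [Finset.mem_filter] at hk
      have h1 := hF k hk.1
      rcases abs_cases k with h2 | h2 <;> omega
    calc ∑ k ∈ F.filter (fun k => ¬ (N : ℤ) ≤ k), tot h p (s (k - 1)) (s k) l
        ≤ ∑ k ∈ F.filter (fun k => ¬ (N : ℤ) ≤ k), C0 * (E (-s (k - 1)) - E (-s k)) := by
          apply Finset.sum_le_sum
          intro k hk
          have hk' := hF' k hk
          have hka := hF k (Finset.mem_filter.1 hk).1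
          rw [← tot_neg h p (S.le hka) l]
          apply tot_le hE hp0 hp1 hc0 hc1 hh
          · linarith [S.neg k hk']
          · rw [abs_neg, abs_neg]
            linarith [S.gap k hka]
          · rw [abs_neg, show -l - -s k = -(l - s k) by ring, abs_neg]
            exact hl _ (Or.inr hk')
          · rw [abs_neg, show -l - -s (k - 1) = -(l - s (k - 1)) by ring, abs_neg]
            exact hl _ (Or.inr (by omega))
      _ = C0 * ∑ k ∈ F.filter (fun k => ¬ (N : ℤ) ≤ k), (E (-s (k - 1)) - E (-s k)) := by
          rw [Finset.mul_sum]
      _ = C0 * ∑ j ∈ (F.filter (fun k => ¬ (N : ℤ) ≤ k)).image (fun k => -k),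
            (E (-s (-j - 1)) - E (-s (-(j - 1) - 1))) := by
          rw [Finset.sum_image (by intro i _ j _ hij; simpa using hij)]
          congr 1
          apply Finset.sum_congr rfl
          intro k hk
          rw [neg_neg, show -(-k - 1) - 1 = k by ring]
      _ ≤ C0 * Cp := by
          apply mul_le_mul_of_nonneg_left _ C00
          apply sum_tele (f := fun j => E (-s (-j - 1))) (N0 := N)
          · intro k hk
            have h1 : (N : ℤ) ≤ |(-k)| := by rw [abs_neg]; exact hk.trans (le_abs_self k)
            have := hE.mono (u := -s (-k)) (v := -s (-k - 1)) (by linarith [S.neg (-k) (by omega)])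
              (by linarith [S.le h1])
            have e : -(k - 1) - 1 = -k := by ring
            simp only [e]
            linarith
          · intro k hk
            exact hE.bdd _ _ (by linarith [S.neg (-((N : ℤ) - 1) - 1) (by omega)])
              (by linarith [S.neg (-k - 1) (by omega)])
          · intro k hk
            rw [Finset.mem_image] at hk
            obtain ⟨j, hj, rfl⟩ := hk
            have := hF' j hj
            omega

end PM

namespace PM
open Filter Topology

/-- distance to the spectrum -/
theorem one_le_dist {A : H →ₗ.[ℂ] H} {z l : ℂ} (hz : z ∈ pmResolventSet A)
    (hl : l ∉ pmResolventSet A) : 1 ≤ ‖l - z‖ * ‖res A z‖ := by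
  by_contra hlt
  push Not at hlt
  apply hl
  obtain ⟨h1, -⟩ := pert hz (-(l - z) • A.domain.subtype) (by positivity) hlt (by
    intro y
    change ‖-(l - z) • res A z y‖ ≤ _
    rw [norm_smul, norm_neg, mul_assoc]
    exact mul_le_mul_of_nonneg_left ((res A z).le_opNorm y) (norm_nonneg _))
  obtain ⟨R, hR1, hR2⟩ := h1
  refine ⟨R, ?_, ?_⟩
  · intro x
    have := hR1 x
    refine Eq.trans ?_ this
    congr 1
    change A x - l • (x : H) = A x + -(l - z) • (x : H) - z • (x : H)
    module
  · intro y
    obtain ⟨hy, h2⟩ := hR2 y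
    refine ⟨hy, ?_⟩
    have h3 : A ⟨R y, hy⟩ + -(l - z) • R y - z • R y = y := h2
    rw [← sub_eq_zero] at h3 ⊢
    rw [← h3]
    module

theorem IsSA.norm_res_conj {T : H →ₗ.[ℂ] H} (hT : IsSA T) {z : ℂ} (hz : z ∈ pmResolventSet T) (y : H) :
    ‖res T ((starRingEnd ℂ) z) y‖ = ‖res T z y‖ := by
  have hz' := hT.conj_mem hz
  have h1 : inner ℂ (res T z y) (res T z y)
      = inner ℂ (res T ((starRingEnd ℂ) z) y) (res T ((starRingEnd ℂ) z) y) := by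
    rw [hT.inner_res hz, hT.inner_res hz', Complex.conj_conj, res_comm hz hz']
  rw [inner_self_eq_norm_sq_to_K, inner_self_eq_norm_sq_to_K] at h1
  have h2 : ‖res T z y‖ ^ 2 = ‖res T ((starRingEnd ℂ) z) y‖ ^ 2 := by exact_mod_cast h1
  exact ((sq_eq_sq₀ (norm_nonneg _) (norm_nonneg _)).1 h2).symm

lemma pt {T : H →ₗ.[ℂ] H} {C : T.domain →ₗ[ℂ] H} {p b M h K ρ : ℝ} (hT : IsSA T)
    (hC : SubC T C p b M) (hb : 0 < b) (hM : 0 ≤ M) (hp0 : 0 ≤ p) (hp1 : p < 1) (hh : 0 < h)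
    (hK : 1 ≤ K) {z : ℂ} {D : ℝ} (g : Good T C z K D) (hρ : |z.re| = ρ) (hρ1 : 1 ≤ ρ)
    (him : |z.im| ≤ h * ρ ^ p) (x y : H) :
    ‖inner ℂ y (res (addC T C) z x - res T z x)‖ ≤ ((1 + K) * (b * (2 + h) + M)) *
      ((ρ ^ p / ρ ^ 2 * ‖x‖ ^ 2 + ρ ^ p * ‖res T z x‖ ^ 2) +
       (ρ ^ p / ρ ^ 2 * ‖y‖ ^ 2 + ρ ^ p * ‖res T z y‖ ^ 2)) := by
  have hρ0 : 0 < ρ := by linarith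
  have hzn : ‖z‖ ≤ (1 + h) * ρ := by
    have h1 := Complex.norm_le_abs_re_add_abs_im z
    have h2 := rpow_le_self hρ1 hp1
    have h3 : h * ρ ^ p ≤ h * ρ := mul_le_mul_of_nonneg_left h2 hh.le
    rw [hρ] at h1
    linarith
  set A := addC T C with hA
  have huT : res A z x ∈ T.domain := res_mem g.hA x
  have hvT : res T z x ∈ T.domain := res_mem g.hT x
  set u := res A z x with hu
  set v := res T z x with hv
  have eA : A ⟨u, res_mem g.hA x⟩ = x + z • u := apply_res g.hA x _
  have eA' : T ⟨u, huT⟩ + C ⟨u, huT⟩ = x + z • u := eA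
  have eT : T ⟨v, hvT⟩ = x + z • v := apply_res g.hT x _
  -- first identity
  have i1 : u = v - res T z (C ⟨u, huT⟩) := by
    have : res T z (x - C ⟨u, huT⟩) = u := by
      apply eq_res g.hT huT
      rw [sub_eq_iff_eq_add, sub_add_eq_add_sub, ← eA']
      abel
    rw [map_sub] at this
    exact this.symm
  -- second identity
  have i2 : u = v - res A z (C ⟨v, hvT⟩) := by
    have : res A z (x + C ⟨v, hvT⟩) = v := by
      apply eq_res g.hA (x := v) hvT
      have : A ⟨v, hvT⟩ = T ⟨v, hvT⟩ + C ⟨v, hvT⟩ := rfl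
      rw [this, eT]
      abel
    rw [map_add] at this
    exact eq_sub_of_add_eq this
  have hwT : res A z (C ⟨v, hvT⟩) ∈ T.domain := res_mem g.hA _
  have i3 : C ⟨u, huT⟩ = C ⟨v, hvT⟩ - C ⟨res A z (C ⟨v, hvT⟩), hwT⟩ := by
    rw [← map_sub]
    congr 1
    ext
    exact i2
  have n1 : ‖C ⟨u, huT⟩‖ ≤ (1 + K) * ‖C ⟨v, hvT⟩‖ := by
    rw [i3]
    have := g.cA (C ⟨v, hvT⟩) hwT
    have := norm_sub_le (C ⟨v, hvT⟩) (C ⟨res A z (C ⟨v, hvT⟩), hwT⟩)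
    linarith
  have hρp : 1 ≤ ρ ^ p := Real.one_le_rpow hρ1 hp0
  have n2 : ‖C ⟨v, hvT⟩‖ ≤ (b * (2 + h) + M) * (ρ ^ p * (‖x‖ / ρ + ‖v‖)) := by
    have h1 := hC ⟨v, hvT⟩
    rw [eT] at h1
    change _ ≤ b * ‖x + z • v‖ ^ p * ‖v‖ ^ (1 - p) + M * ‖v‖ at h1
    have h2 : ‖x + z • v‖ ≤ ‖x‖ + (1 + h) * ρ * ‖v‖ := by
      refine (norm_add_le _ _).trans ?_
      rw [norm_smul]
      gcongr
    set t := ‖x + z • v‖ with ht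
    have ht0 : 0 ≤ t := norm_nonneg _
    have h3 : t ^ p * ‖v‖ ^ (1 - p) ≤ ρ ^ p * (‖x‖ / ρ + (2 + h) * ‖v‖) := by
      have e1 : t ^ p = ρ ^ p * (t / ρ) ^ p := by
        rw [← Real.mul_rpow hρ0.le (by positivity)]
        congr 1
        field_simp
      have e2 := Real.geom_mean_le_arith_mean2_weighted hp0 (by linarith : 0 ≤ 1 - p)
        (show 0 ≤ t / ρ by positivity) (norm_nonneg v) (by ring)
      rw [e1, mul_assoc]
      apply mul_le_mul_of_nonneg_left _ (by positivity)
      have e3 : t / ρ ≤ ‖x‖ / ρ + (1 + h) * ‖v‖ := by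
        rw [div_le_iff₀ hρ0]
        have : (‖x‖ / ρ + (1 + h) * ‖v‖) * ρ = ‖x‖ + (1 + h) * ρ * ‖v‖ := by
          field_simp
        rw [this]; exact h2
      have e4 : 0 ≤ t / ρ := by positivity
      have e5 := norm_nonneg v
      nlinarith
    have hx0 : 0 ≤ ‖x‖ / ρ := by positivity
    have hv0 := norm_nonneg v
    have h4 : M * ‖v‖ ≤ M * (ρ ^ p * (‖x‖ / ρ + ‖v‖)) := by
      apply mul_le_mul_of_nonneg_left _ hM
      nlinarith
    have h5 : b * (t ^ p * ‖v‖ ^ (1 - p)) ≤ b * ((2 + h) * (ρ ^ p * (‖x‖ / ρ + ‖v‖))) := by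
      apply mul_le_mul_of_nonneg_left _ hb.le
      refine h3.trans ?_
      have : ‖x‖ / ρ ≤ (2 + h) * (‖x‖ / ρ) := by nlinarith
      calc ρ ^ p * (‖x‖ / ρ + (2 + h) * ‖v‖) ≤ ρ ^ p * ((2 + h) * (‖x‖ / ρ) + (2 + h) * ‖v‖) := by
            apply mul_le_mul_of_nonneg_left _ (by positivity)
            linarith
        _ = _ := by ring
    linarith
  have e0 : u - v = - res T z (C ⟨u, huT⟩) := by
    nth_rw 1 [i1]; abel
  rw [e0, inner_neg_right, norm_neg]
  have e1 : inner ℂ y (res T z (C ⟨u, huT⟩)) = inner ℂ (res T ((starRingEnd ℂ) z) y) (C ⟨u, huT⟩) := by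
    rw [hT.inner_res (hT.conj_mem g.hT), Complex.conj_conj]
  rw [e1]
  refine (norm_inner_le_norm _ _).trans ?_
  rw [hT.norm_res_conj g.hT]
  set w := ‖res T z y‖ with hw
  have hw0 : 0 ≤ w := norm_nonneg _
  have hv0 := norm_nonneg v
  have hc : 0 ≤ b * (2 + h) + M := by positivity
  have n3 : w * ‖C ⟨u, huT⟩‖ ≤ ((1 + K) * (b * (2 + h) + M)) * (ρ ^ p * (w * (‖x‖ / ρ + ‖v‖))) := by
    have : ‖C ⟨u, huT⟩‖ ≤ (1 + K) * ((b * (2 + h) + M) * (ρ ^ p * (‖x‖ / ρ + ‖v‖))) :=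
      n1.trans (mul_le_mul_of_nonneg_left n2 (by linarith))
    calc _ ≤ w * ((1 + K) * ((b * (2 + h) + M) * (ρ ^ p * (‖x‖ / ρ + ‖v‖)))) :=
          mul_le_mul_of_nonneg_left this hw0
      _ = _ := by ring
  refine n3.trans ?_
  apply mul_le_mul_of_nonneg_left _ (by have : 0 ≤ 1 + K := by linarith
                                        positivity)
  have e6 : (ρ ^ p / ρ ^ 2 * ‖x‖ ^ 2 + ρ ^ p * ‖v‖ ^ 2) + (ρ ^ p / ρ ^ 2 * ‖y‖ ^ 2 + ρ ^ p * w ^ 2)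
      = ρ ^ p * ((‖x‖ / ρ) ^ 2 + ‖v‖ ^ 2 + (‖y‖ / ρ) ^ 2 + w ^ 2) := by
    field_simp
    ring
  rw [e6]
  apply mul_le_mul_of_nonneg_left _ (by positivity)
  nlinarith [sq_nonneg (w - (‖x‖ / ρ + ‖v‖)), sq_nonneg (‖x‖ / ρ - ‖v‖), sq_nonneg (‖y‖ / ρ),
    sq_nonneg w]

/-- the contour integral projection of a self-adjoint operator is self-adjoint -/
theorem star_integral (f : ℝ → H →L[ℂ] H) (a b : ℝ) :
    star (∫ u in a..b, f u) = ∫ u in a..b, star (f u) := by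
  have h1 : ∀ μ : MeasureTheory.Measure ℝ, star (∫ u, f u ∂μ) = ∫ u, star (f u) ∂μ := by
    intro μ
    exact ((starL' ℝ : (H →L[ℂ] H) ≃L[ℝ] (H →L[ℂ] H)).integral_comp_comm f).symm
  simp only [intervalIntegral, star_sub, h1]

theorem TrapData.proj_star (d : TrapData) {T : H →ₗ.[ℂ] H} (hT : IsSA T)
    (hK : d.chain.carrier ⊆ pmResolventSet T) :
    star (d.chain.proj T) = d.chain.proj T := by
  have hst : ∀ i u, u ∈ Set.uIcc (d.sI i) (d.tI i) → star (d.gam' i u • res T (d.gam i u)) =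
      (starRingEnd ℂ) (d.gam' i u) • res T ((starRingEnd ℂ) (d.gam i u)) := by
    intro i u hu
    have hz : d.gam i u ∈ pmResolventSet T := hK (d.chain.mem_carrier (i := i) hu)
    rw [star_smul, ContinuousLinearMap.star_eq_adjoint, hT.adjoint_res hz]
    rfl
  have hst' : ∀ i, star (∫ u in d.sI i..d.tI i, d.gam' i u • res T (d.gam i u)) =
      ∫ u in d.sI i..d.tI i, (starRingEnd ℂ) (d.gam' i u) • res T ((starRingEnd ℂ) (d.gam i u)) := by
    intro i
    rw [star_integral]
    exact intervalIntegral.integral_congr (fun u hu => hst i u hu)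
  have key : star (d.chain.oint (res T)) = - d.chain.oint (res T) := by
    change star (∑ i, ∫ u in d.sI i..d.tI i, d.gam' i u • res T (d.gam i u)) =
      - ∑ i, ∫ u in d.sI i..d.tI i, d.gam' i u • res T (d.gam i u)
    rw [star_sum]
    simp_rw [hst']
    rw [Fin.sum_univ_four, Fin.sum_univ_four]
    have p0 : ∫ u in d.sI 0..d.tI 0, (starRingEnd ℂ) (d.gam' 0 u) • res T ((starRingEnd ℂ) (d.gam 0 u))
        = - ∫ u in d.sI 2..d.tI 2, d.gam' 2 u • res T (d.gam 2 u) := by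
      change ∫ u in d.a..d.b, (starRingEnd ℂ) (1 - Complex.I * d.g' u) •
          res T ((starRingEnd ℂ) (u - Complex.I * d.g u)) =
        - ∫ u in d.b..d.a, (1 + Complex.I * d.g' u) • res T (u + Complex.I * d.g u)
      rw [intervalIntegral.integral_symm d.a d.b, neg_neg]
      simp
    have p2 : ∫ u in d.sI 2..d.tI 2, (starRingEnd ℂ) (d.gam' 2 u) • res T ((starRingEnd ℂ) (d.gam 2 u))
        = - ∫ u in d.sI 0..d.tI 0, d.gam' 0 u • res T (d.gam 0 u) := by
      change ∫ u in d.b..d.a, (starRingEnd ℂ) (1 + Complex.I * d.g' u) •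
          res T ((starRingEnd ℂ) (u + Complex.I * d.g u)) =
        - ∫ u in d.a..d.b, (1 - Complex.I * d.g' u) • res T (u - Complex.I * d.g u)
      rw [intervalIntegral.integral_symm d.a d.b]
      simp [sub_eq_add_neg]
    have p1 : ∫ u in d.sI 1..d.tI 1, (starRingEnd ℂ) (d.gam' 1 u) • res T ((starRingEnd ℂ) (d.gam 1 u))
        = - ∫ u in d.sI 1..d.tI 1, d.gam' 1 u • res T (d.gam 1 u) := by
      change ∫ u in (-d.g d.b)..d.g d.b, (starRingEnd ℂ) Complex.I •
          res T ((starRingEnd ℂ) (d.b + Complex.I * u)) =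
        - ∫ u in (-d.g d.b)..d.g d.b, Complex.I • res T (d.b + Complex.I * u)
      have := intervalIntegral.integral_comp_neg (a := -d.g d.b) (b := d.g d.b)
        (fun u : ℝ => Complex.I • res T (d.b + Complex.I * u))
      rw [neg_neg] at this
      rw [← this, ← intervalIntegral.integral_neg]
      congr 1
      ext1 u
      simp
    have p3 : ∫ u in d.sI 3..d.tI 3, (starRingEnd ℂ) (d.gam' 3 u) • res T ((starRingEnd ℂ) (d.gam 3 u))
        = - ∫ u in d.sI 3..d.tI 3, d.gam' 3 u • res T (d.gam 3 u) := by
      change ∫ u in (d.g d.a)..(-d.g d.a), (starRingEnd ℂ) Complex.I •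
          res T ((starRingEnd ℂ) (d.a + Complex.I * u)) =
        - ∫ u in (d.g d.a)..(-d.g d.a), Complex.I • res T (d.a + Complex.I * u)
      have := intervalIntegral.integral_comp_neg (a := d.g d.a) (b := -d.g d.a)
        (fun u : ℝ => Complex.I • res T (d.a + Complex.I * u))
      rw [neg_neg] at this
      rw [← this, ← intervalIntegral.integral_neg]
      congr 1
      ext1 u
      simp
    rw [p0, p1, p2, p3]
    abel
  unfold Chain.proj
  rw [star_smul, key, smul_neg, ← neg_smul]
  congr 1
  simp

theorem bessel_orth {κ : Type*} {P : κ → H →L[ℂ] H} (hs : ∀ k, star (P k) = P k)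
    (hP : ∀ k x, P k (P k x) = P k x) (hP' : ∀ j k, j ≠ k → ∀ x, P j (P k x) = 0)
    (F : Finset κ) (x : H) : ∑ k ∈ F, ‖P k x‖ ^ 2 ≤ ‖x‖ ^ 2 := by
  classical
  have hin : ∀ k u v, inner ℂ (P k u) v = inner ℂ u (P k v) := by
    intro k u v
    nth_rw 1 [← hs k]
    rw [ContinuousLinearMap.star_eq_adjoint, ContinuousLinearMap.adjoint_inner_left]
  set σ := ∑ k ∈ F, ‖P k x‖ ^ 2 with hσ
  have h1 : ∀ k, inner ℂ x (P k x) = ((‖P k x‖ ^ 2 : ℝ) : ℂ) := by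
    intro k
    rw [← hP k x, ← hin, hP k x, inner_self_eq_norm_sq_to_K]
    norm_cast
  have h2 : inner ℂ x (∑ k ∈ F, P k x) = (σ : ℂ) := by
    rw [inner_sum, hσ]
    push_cast
    apply Finset.sum_congr rfl
    intro k _
    rw [h1]; push_cast; rfl
  have h3 : inner ℂ (∑ j ∈ F, P j x) (∑ k ∈ F, P k x) = (σ : ℂ) := by
    rw [← h2, sum_inner, inner_sum]
    apply Finset.sum_congr rfl
    intro j hj
    rw [hin, map_sum, Finset.sum_eq_single j, hP]
    · intro k _ hk
      exact hP' j k (Ne.symm hk) x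
    · intro hn; exact absurd hj hn
  rw [inner_self_eq_norm_sq_to_K] at h3
  have h4 : ‖∑ k ∈ F, P k x‖ ^ 2 = σ := by
    apply Complex.ofReal_injective
    rw [← h3]; push_cast; rfl
  have h5 : σ ≤ ‖x‖ * ‖∑ k ∈ F, P k x‖ := by
    have := norm_inner_le_norm (𝕜 := ℂ) x (∑ k ∈ F, P k x)
    rw [h2, Complex.norm_real] at this
    exact (le_abs_self σ).trans this
  nlinarith [sq_nonneg (‖x‖ - ‖∑ k ∈ F, P k x‖)]

end PM

namespace PM
open Filter Topology

lemma hasDerivAt_abs_rpow {x : ℝ} (hx : x ≠ 0) (p : ℝ) :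
    HasDerivAt (fun x : ℝ => |x| ^ p) (p * (|x| ^ p / x)) x := by
  have h1 := (hasDerivAt_abs hx).rpow_const (p := p) (Or.inl (by positivity))
  refine h1.congr_deriv ?_
  have h2 : |x| ^ (p - 1) = |x| ^ p / |x| := by
    rw [Real.rpow_sub (by positivity), Real.rpow_one]
  rw [h2]
  rcases lt_or_gt_of_ne hx with h | h
  · rw [abs_of_neg h, sign_neg h]
    simp
    field_simp
  · rw [abs_of_pos h, sign_pos h]
    simp

/-- the trapezoid between two abscissae -/
def trapD (h p a b : ℝ) (hh : 0 < h) (hab : a ≤ b) (h0 : 0 < a ∨ b < 0) : TrapData where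
  a := a
  b := b
  g := fun x => h * |x| ^ p
  g' := fun x => h * (p * (|x| ^ p / x))
  hab := hab
  hg := fun x hx => (hasDerivAt_abs_rpow (by
    rcases h0 with h | h
    · exact ne_of_gt (lt_of_lt_of_le h hx.1)
    · exact ne_of_lt (lt_of_le_of_lt hx.2 h)) p).const_mul h
  hg' := by
    have hne : ∀ x ∈ Set.Icc a b, x ≠ 0 := by
      intro x hx
      rcases h0 with h | h
      · exact ne_of_gt (lt_of_lt_of_le h hx.1)
      · exact ne_of_lt (lt_of_le_of_lt hx.2 h)
    refine continuousOn_const.mul (continuousOn_const.mul (ContinuousOn.div ?_ continuousOn_id hne))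
    exact continuous_abs.continuousOn.rpow_const (fun x hx => Or.inl (by simpa using hne x hx))
  pos := by
    intro x hx
    have hne : x ≠ 0 := by
      rcases h0 with h | h
      · exact ne_of_gt (lt_of_lt_of_le h hx.1)
      · exact ne_of_lt (lt_of_le_of_lt hx.2 h)
    have : 0 < |x| := by positivity
    positivity

lemma setInt_uIcc {a b : ℝ} (hab : a ≤ b) (f : ℝ → ℝ) :
    ∫ x in Set.uIcc a b, f x = ∫ x in a..b, f x := by
  rw [Set.uIcc_of_le hab, MeasureTheory.integral_Icc_eq_integral_Ioc,
    intervalIntegral.integral_of_le hab]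

lemma vert_le {l s w g : ℝ} (hls : l ≠ s) (hw : 0 ≤ w) (hg : 0 ≤ g) :
    ∫ y in (-g)..g, w / ((l - s) ^ 2 + y ^ 2) ≤ 2 * g * (w / (l - s) ^ 2) := by
  have hD : 0 < (l - s) ^ 2 := by
    have : l - s ≠ 0 := sub_ne_zero.2 hls
    positivity
  calc ∫ y in (-g)..g, w / ((l - s) ^ 2 + y ^ 2) ≤ ∫ y in (-g)..g, w / (l - s) ^ 2 := by
        apply intervalIntegral.integral_mono_on (by linarith)
        · apply ContinuousOn.intervalIntegrable
          apply ContinuousOn.div continuousOn_const (by fun_prop)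
          intro y _
          positivity
        · exact intervalIntegrable_const
        · intro y _
          apply div_le_div_of_nonneg_left hw hD
          nlinarith [sq_nonneg y]
    _ = _ := by
        rw [intervalIntegral.integral_const, smul_eq_mul]; ring

lemma pieces_le {h p a b : ℝ} (hh : 0 < h) (hab : a ≤ b) (h0 : 0 < a ∨ b < 0) {l : ℝ}
    (hla : l ≠ a) (hlb : l ≠ b) (hp0 : 0 ≤ p) :
    let d := trapD h p a b hh hab h0
    ∑ i, ∫ u in Set.uIcc (d.sI i) (d.tI i), |(d.gam i u).re| ^ p / ‖(l : ℂ) - d.gam i u‖ ^ 2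
      ≤ tot h p a b l := by
  intro d
  have e : ∀ z : ℂ, ‖(l : ℂ) - z‖ ^ 2 = (l - z.re) ^ 2 + z.im ^ 2 := by
    intro z
    rw [Complex.sq_norm, Complex.normSq_apply]
    simp
    ring
  simp_rw [e]
  rw [Fin.sum_univ_four]
  have p0 : ∫ u in Set.uIcc (d.sI 0) (d.tI 0), |(d.gam 0 u).re| ^ p / ((l - (d.gam 0 u).re) ^ 2 + (d.gam 0 u).im ^ 2)
      = ∫ x in Set.Icc a b, |x| ^ p / ((l - x) ^ 2 + (h * |x| ^ p) ^ 2) := by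
    change ∫ u in Set.uIcc a b, |((u : ℂ) - Complex.I * ((h * |u| ^ p : ℝ) : ℂ)).re| ^ p /
      ((l - ((u : ℂ) - Complex.I * ((h * |u| ^ p : ℝ) : ℂ)).re) ^ 2 + ((u : ℂ) - Complex.I * ((h * |u| ^ p : ℝ) : ℂ)).im ^ 2) = _
    rw [Set.uIcc_of_le hab]
    congr 1
    ext1 u
    have e1 : ((u : ℂ) - Complex.I * ((h * |u| ^ p : ℝ) : ℂ)).re = u := by
      simp only [Complex.sub_re, Complex.mul_re, Complex.I_re, Complex.I_im, Complex.ofReal_re, Complex.ofReal_im]; ring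
    have e2 : ((u : ℂ) - Complex.I * ((h * |u| ^ p : ℝ) : ℂ)).im = -(h * |u| ^ p) := by
      simp only [Complex.sub_im, Complex.mul_im, Complex.I_re, Complex.I_im, Complex.ofReal_re, Complex.ofReal_im]; ring
    rw [e1, e2, neg_sq]
  have p2 : ∫ u in Set.uIcc (d.sI 2) (d.tI 2), |(d.gam 2 u).re| ^ p / ((l - (d.gam 2 u).re) ^ 2 + (d.gam 2 u).im ^ 2)
      = ∫ x in Set.Icc a b, |x| ^ p / ((l - x) ^ 2 + (h * |x| ^ p) ^ 2) := by
    change ∫ u in Set.uIcc b a, |((u : ℂ) + Complex.I * ((h * |u| ^ p : ℝ) : ℂ)).re| ^ p /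
      ((l - ((u : ℂ) + Complex.I * ((h * |u| ^ p : ℝ) : ℂ)).re) ^ 2 + ((u : ℂ) + Complex.I * ((h * |u| ^ p : ℝ) : ℂ)).im ^ 2) = _
    rw [Set.uIcc_comm, Set.uIcc_of_le hab]
    congr 1
    ext1 u
    have e1 : ((u : ℂ) + Complex.I * ((h * |u| ^ p : ℝ) : ℂ)).re = u := by
      simp only [Complex.add_re, Complex.mul_re, Complex.I_re, Complex.I_im, Complex.ofReal_re, Complex.ofReal_im]; ring
    have e2 : ((u : ℂ) + Complex.I * ((h * |u| ^ p : ℝ) : ℂ)).im = (h * |u| ^ p) := by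
      simp only [Complex.add_im, Complex.mul_im, Complex.I_re, Complex.I_im, Complex.ofReal_re, Complex.ofReal_im]; ring
    rw [e1, e2]
  have q : ∀ s : ℝ, l ≠ s → ∫ u in Set.uIcc (-(h * |s| ^ p)) (h * |s| ^ p),
      |((s : ℂ) + Complex.I * (u : ℂ)).re| ^ p /
      ((l - ((s : ℂ) + Complex.I * (u : ℂ)).re) ^ 2 + ((s : ℂ) + Complex.I * (u : ℂ)).im ^ 2)
      ≤ 2 * h * ((|s| ^ p) ^ 2 / (l - s) ^ 2) := by
    intro s hs
    have hg : 0 ≤ h * |s| ^ p := by positivity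
    rw [setInt_uIcc (by linarith)]
    have := vert_le hs (show 0 ≤ |s| ^ p by positivity) hg
    have e1 : ∀ u : ℝ, ((s : ℂ) + Complex.I * (u : ℂ)).re = s := by intro u; simp
    have e2 : ∀ u : ℝ, ((s : ℂ) + Complex.I * (u : ℂ)).im = u := by intro u; simp
    simp_rw [e1, e2]
    refine this.trans (le_of_eq ?_)
    ring
  have p1 := q b hlb
  have p3 : ∫ u in Set.uIcc (d.sI 3) (d.tI 3), |(d.gam 3 u).re| ^ p / ((l - (d.gam 3 u).re) ^ 2 + (d.gam 3 u).im ^ 2)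
      ≤ 2 * h * ((|a| ^ p) ^ 2 / (l - a) ^ 2) := by
    rw [Set.uIcc_comm]
    exact q a hla
  rw [p0, p2]
  unfold tot
  have p1' : ∫ u in Set.uIcc (d.sI 1) (d.tI 1), |(d.gam 1 u).re| ^ p / ((l - (d.gam 1 u).re) ^ 2 + (d.gam 1 u).im ^ 2)
      ≤ 2 * h * ((|b| ^ p) ^ 2 / (l - b) ^ 2) := p1
  linarith

/-- weights -/
def TrapData.wt (d : TrapData) (p : ℝ) (i : Fin 4) (u : ℝ) : ℝ := |(d.gam i u).re| ^ p

lemma TrapData.gam_cont (d : TrapData) (i : Fin 4) :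
    ContinuousOn (d.gam i) (Set.uIcc (d.sI i) (d.tI i)) :=
  fun u hu => (d.hder i u hu).continuousAt.continuousWithinAt

lemma TrapData.wt_cont (d : TrapData) {p : ℝ} (hp0 : 0 ≤ p) (i : Fin 4) :
    ContinuousOn (d.wt p i) (Set.uIcc (d.sI i) (d.tI i)) := by
  have h1 := d.gam_cont i
  have h2 : ContinuousOn (fun u => |(d.gam i u).re|) (Set.uIcc (d.sI i) (d.tI i)) :=
    (Complex.continuous_re.comp_continuousOn h1).abs
  exact h2.rpow_const (fun _ _ => Or.inr hp0)

lemma TrapData.wt0_cont (d : TrapData) {p : ℝ} (hp0 : 0 ≤ p) (i : Fin 4)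
    (hre : ∀ z ∈ d.chain.carrier, 1 ≤ |z.re|) :
    ContinuousOn (fun u => d.wt p i u / |(d.gam i u).re| ^ 2) (Set.uIcc (d.sI i) (d.tI i)) := by
  have h1 := d.gam_cont i
  have h2 : ContinuousOn (fun u => |(d.gam i u).re|) (Set.uIcc (d.sI i) (d.tI i)) :=
    (Complex.continuous_re.comp_continuousOn h1).abs
  refine (d.wt_cont hp0 i).div (h2.pow 2) (fun u hu => ?_)
  have := hre _ (d.chain.mem_carrier (i := i) hu)
  change 1 ≤ |(d.gam i u).re| at this
  have : 0 < |(d.gam i u).re| := by linarith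
  positivity

lemma TrapData.wtR_cont (d : TrapData) {T : H →ₗ.[ℂ] H} {p : ℝ} (hp0 : 0 ≤ p) (i : Fin 4)
    (hK : d.chain.carrier ⊆ pmResolventSet T) (x : H) :
    ContinuousOn (fun u => d.wt p i u * ‖res T (d.gam i u) x‖ ^ 2) (Set.uIcc (d.sI i) (d.tI i)) := by
  have h1 : ContinuousOn (fun u => res T (d.gam i u)) (Set.uIcc (d.sI i) (d.tI i)) :=
    (d.chain.cont_res hK).comp (d.gam_cont i) (fun u hu => d.chain.mem_carrier (i := i) hu)
  exact (d.wt_cont hp0 i).mul ((h1.clm_apply continuousOn_const).norm.pow 2)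

/-- the quadratic majorant -/
def TrapData.aa (d : TrapData) (T : H →ₗ.[ℂ] H) (p K : ℝ) (x : H) : ℝ :=
  K * (‖x‖ ^ 2 * (∑ i, ∫ u in Set.uIcc (d.sI i) (d.tI i), d.wt p i u / |(d.gam i u).re| ^ 2) +
    ∑ i, ∫ u in Set.uIcc (d.sI i) (d.tI i), d.wt p i u * ‖res T (d.gam i u) x‖ ^ 2)

lemma TrapData.gam'_le (d : TrapData) {h : ℝ} (hh : 0 < h) (hg' : ∀ x ∈ Set.Icc d.a d.b, |d.g' x| ≤ h)
    (i : Fin 4) : ∀ u ∈ Set.uIcc (d.sI i) (d.tI i), ‖d.gam' i u‖ ≤ 1 + h := by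
  intro u hu
  have hI : ‖Complex.I‖ ≤ 1 + h := by simp; linarith
  fin_cases i
  · have hu' : u ∈ Set.Icc d.a d.b := by rwa [← Set.uIcc_of_le d.hab]
    change ‖1 - Complex.I * (d.g' u : ℂ)‖ ≤ 1 + h
    refine (norm_sub_le _ _).trans ?_
    simpa using hg' u hu'
  · exact hI
  · have hu' : u ∈ Set.Icc d.a d.b := by rw [← Set.uIcc_of_le d.hab, Set.uIcc_comm]; exact hu
    change ‖1 + Complex.I * (d.g' u : ℂ)‖ ≤ 1 + h
    refine (norm_add_le _ _).trans ?_
    simpa using hg' u hu'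
  · exact hI

lemma TrapData.bil (d : TrapData) {T : H →ₗ.[ℂ] H} {C : T.domain →ₗ[ℂ] H} {p b M h K : ℝ} (hT : IsSA T)
    (hC : SubC T C p b M) (hb : 0 < b) (hM : 0 ≤ M) (hp0 : 0 ≤ p) (hp1 : p < 1) (hh : 0 < h)
    (hK : 1 ≤ K) (hg' : ∀ x ∈ Set.Icc d.a d.b, |d.g' x| ≤ h)
    (hgood : ∀ z ∈ d.chain.carrier, ∃ D, Good T C z K D)
    (hre : ∀ z ∈ d.chain.carrier, 1 ≤ |z.re|)
    (him : ∀ z ∈ d.chain.carrier, |z.im| ≤ h * |z.re| ^ p) (x y : H) :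
    ‖inner ℂ y ((d.chain.proj (addC T C) - d.chain.proj T) x)‖ ≤
      d.aa T p ((1 + h) * ((1 + K) * (b * (2 + h) + M))) x +
      d.aa T p ((1 + h) * ((1 + K) * (b * (2 + h) + M))) y := by
  set A := addC T C with hA
  set K2 := (1 + h) * ((1 + K) * (b * (2 + h) + M)) with hK2
  have cT : d.chain.carrier ⊆ pmResolventSet T := fun z hz => by
    obtain ⟨D, g⟩ := hgood z hz; exact g.hT
  have cA : d.chain.carrier ⊆ pmResolventSet A := fun z hz => by
    obtain ⟨D, g⟩ := hgood z hz; exact g.hA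
  have rA := d.chain.cont_res cA
  have rT := d.chain.cont_res cT
  set L : (H →L[ℂ] H) →L[ℂ] ℂ := (innerSL ℂ y).comp (ContinuousLinearMap.apply ℂ H x) with hL
  have hsub : ContinuousOn (fun z => res A z - res T z) d.chain.carrier := rA.sub rT
  have e1 : d.chain.oint (res A) - d.chain.oint (res T) = d.chain.oint (fun z => res A z - res T z) := by
    rw [sub_eq_iff_eq_add, ← d.chain.oint_add hsub rT]
    apply d.chain.oint_congr
    intro z _
    rw [sub_add_cancel]
  have e2 : inner ℂ y ((d.chain.proj A - d.chain.proj T) x) =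
      -(2 * Real.pi * Complex.I : ℂ)⁻¹ • d.chain.oint (fun z => L (res A z - res T z)) := by
    rw [d.chain.oint_clm L hsub, ← e1, ← map_smul, smul_sub]
    rfl
  have hc : ‖-(2 * Real.pi * Complex.I : ℂ)⁻¹‖ ≤ 1 := by
    rw [norm_neg, norm_inv, norm_mul, norm_mul, Complex.norm_I, Complex.norm_real, Complex.norm_two,
      mul_one, Real.norm_of_nonneg Real.pi_pos.le]
    apply inv_le_one_of_one_le₀
    linarith [Real.pi_gt_three]
  rw [e2, norm_smul]
  refine (mul_le_of_le_one_left (norm_nonneg _) hc).trans ?_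
  have per : ∀ i, ‖∫ u in (d.sI i)..(d.tI i), d.gam' i u • L (res A (d.gam i u) - res T (d.gam i u))‖ ≤
      K2 * ((‖x‖ ^ 2 * (∫ u in Set.uIcc (d.sI i) (d.tI i), d.wt p i u / |(d.gam i u).re| ^ 2) +
        ∫ u in Set.uIcc (d.sI i) (d.tI i), d.wt p i u * ‖res T (d.gam i u) x‖ ^ 2) +
        (‖y‖ ^ 2 * (∫ u in Set.uIcc (d.sI i) (d.tI i), d.wt p i u / |(d.gam i u).re| ^ 2) +
        ∫ u in Set.uIcc (d.sI i) (d.tI i), d.wt p i u * ‖res T (d.gam i u) y‖ ^ 2)) := by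
    intro i
    have c0 := (d.wt0_cont hp0 i hre).integrableOn_compact (μ := MeasureTheory.volume) isCompact_uIcc
    have cx := (d.wtR_cont hp0 i cT x).integrableOn_compact (μ := MeasureTheory.volume) isCompact_uIcc
    have cy := (d.wtR_cont hp0 i cT y).integrableOn_compact (μ := MeasureTheory.volume) isCompact_uIcc
    have cc : ContinuousOn (fun u => d.gam' i u • L (res A (d.gam i u) - res T (d.gam i u)))
        (Set.uIcc (d.sI i) (d.tI i)) :=
      (d.hcont' i).smul (L.continuous.comp_continuousOn
        (hsub.comp (d.gam_cont i) (fun u hu => d.chain.mem_carrier (i := i) hu)))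
    refine (intervalIntegral.norm_integral_le_integral_norm_uIoc).trans ?_
    have e3 : ∀ f : ℝ → ℝ, ∫ u in Set.uIoc (d.sI i) (d.tI i), f u = ∫ u in Set.uIcc (d.sI i) (d.tI i), f u :=
      fun f => (MeasureTheory.integral_Icc_eq_integral_Ioc).symm
    rw [e3]
    have e4 : K2 * ((‖x‖ ^ 2 * (∫ u in Set.uIcc (d.sI i) (d.tI i), d.wt p i u / |(d.gam i u).re| ^ 2) +
        ∫ u in Set.uIcc (d.sI i) (d.tI i), d.wt p i u * ‖res T (d.gam i u) x‖ ^ 2) +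
        (‖y‖ ^ 2 * (∫ u in Set.uIcc (d.sI i) (d.tI i), d.wt p i u / |(d.gam i u).re| ^ 2) +
        ∫ u in Set.uIcc (d.sI i) (d.tI i), d.wt p i u * ‖res T (d.gam i u) y‖ ^ 2)) =
        ∫ u in Set.uIcc (d.sI i) (d.tI i), K2 * ((‖x‖ ^ 2 * (d.wt p i u / |(d.gam i u).re| ^ 2) +
          d.wt p i u * ‖res T (d.gam i u) x‖ ^ 2) + (‖y‖ ^ 2 * (d.wt p i u / |(d.gam i u).re| ^ 2) +
          d.wt p i u * ‖res T (d.gam i u) y‖ ^ 2)) := by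
      rw [MeasureTheory.integral_const_mul, MeasureTheory.integral_add, MeasureTheory.integral_add,
        MeasureTheory.integral_add, MeasureTheory.integral_const_mul, MeasureTheory.integral_const_mul]
      · exact c0.const_mul _
      · exact cy
      · exact c0.const_mul _
      · exact cx
      · exact (c0.const_mul _).add cx
      · exact (c0.const_mul _).add cy
    rw [e4]
    apply MeasureTheory.setIntegral_mono_on
    · exact (cc.norm).integrableOn_compact isCompact_uIcc
    · exact (((c0.const_mul _).add cx).add ((c0.const_mul _).add cy)).const_mul _
    · exact measurableSet_uIcc
    · intro u hu
      have hz := d.chain.mem_carrier (i := i) hu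
      obtain ⟨D, g⟩ := hgood _ hz
      have h1 := pt hT hC hb hM hp0 hp1 hh hK g rfl (hre _ hz) (him _ hz) x y
      rw [norm_smul]
      have h2 := d.gam'_le hh hg' i u hu
      have h3 := mul_le_mul h2 h1 (norm_nonneg _) (by linarith)
      refine h3.trans (le_of_eq ?_)
      rw [hK2]
      unfold TrapData.wt
      change (1 + h) * (((1 + K) * (b * (2 + h) + M)) *
      ((|(d.gam i u).re| ^ p / |(d.gam i u).re| ^ 2 * ‖x‖ ^ 2 + |(d.gam i u).re| ^ p * ‖res T (d.gam i u) x‖ ^ 2) +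
       (|(d.gam i u).re| ^ p / |(d.gam i u).re| ^ 2 * ‖y‖ ^ 2 + |(d.gam i u).re| ^ p * ‖res T (d.gam i u) y‖ ^ 2))) = _
      ring
  change ‖∑ i, ∫ u in (d.sI i)..(d.tI i), d.gam' i u • L (res A (d.gam i u) - res T (d.gam i u))‖ ≤ _
  refine (norm_sum_le _ _).trans ((Finset.sum_le_sum (fun i _ => per i)).trans (le_of_eq ?_))
  unfold TrapData.aa
  rw [← Finset.mul_sum, Finset.sum_add_distrib, Finset.sum_add_distrib, Finset.sum_add_distrib,
    ← Finset.mul_sum, ← Finset.mul_sum, mul_add]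

end PM

namespace PM
open Filter Topology

lemma TrapData.isClosed_region (d : TrapData) (hg : Continuous d.g) : IsClosed d.region := by
  have : d.region = {z : ℂ | d.a ≤ z.re} ∩ ({z : ℂ | z.re ≤ d.b} ∩ {z : ℂ | |z.im| ≤ d.g z.re}) := rfl
  rw [this]
  refine (isClosed_le continuous_const Complex.continuous_re).inter
    ((isClosed_le Complex.continuous_re continuous_const).inter
      (isClosed_le (continuous_abs.comp Complex.continuous_im) (hg.comp Complex.continuous_re)))

lemma TrapData.frontier_region (d : TrapData) (hg : Continuous d.g) :
    frontier d.region ⊆ d.chain.carrier := by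
  intro z hz
  have hcl := d.isClosed_region hg
  rw [frontier, hcl.closure_eq] at hz
  obtain ⟨⟨h1, h2, h3⟩, hni⟩ := hz
  rw [d.mem_carrier_iff]
  by_contra hc
  push Not at hc
  obtain ⟨c1, c2, c3⟩ := hc
  have e3 : |z.im| < d.g z.re := lt_of_le_of_ne h3 (c1 h1 h2)
  have e1 : d.a < z.re := by
    refine lt_of_le_of_ne h1 fun h => ?_
    have := c2 h.symm
    rw [h] at this
    linarith
  have e2 : z.re < d.b := by
    refine lt_of_le_of_ne h2 fun h => ?_
    have := c3 h
    rw [← h] at this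
    linarith
  apply hni
  rw [mem_interior]
  refine ⟨{z : ℂ | d.a < z.re} ∩ ({z : ℂ | z.re < d.b} ∩ {z : ℂ | |z.im| < d.g z.re}), ?_, ?_, e1, e2, e3⟩
  · rintro w ⟨w1, w2, w3⟩
    exact ⟨le_of_lt w1, le_of_lt w2, le_of_lt w3⟩
  · exact (isOpen_lt continuous_const Complex.continuous_re).inter
      ((isOpen_lt Complex.continuous_re continuous_const).inter
      (isOpen_lt (continuous_abs.comp Complex.continuous_im) (hg.comp Complex.continuous_re)))

lemma cont_par (h : ℝ) {p : ℝ} (hp0 : 0 ≤ p) : Continuous fun x : ℝ => h * |x| ^ p :=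
  continuous_const.mul (continuous_abs.rpow_const (fun x => Or.inr hp0))

/-- the index set -/
abbrev KI (N : ℕ) := {k : ℤ // (N : ℤ) ≤ |k|}

lemma SeqP.sgn {p c : ℝ} {N : ℕ} {s : ℤ → ℝ} (S : SeqP p c N s) {k : ℤ} (hk : (N : ℤ) ≤ |k|) :
    1 ≤ s (k - 1) ∨ s k ≤ -1 := by
  rcases le_abs.1 hk with h | h
  · exact Or.inl (S.pos _ (by omega))
  · exact Or.inr (S.neg _ (by omega))

lemma SeqP.mono_pos {p c : ℝ} {N : ℕ} {s : ℤ → ℝ} (S : SeqP p c N s) {j k : ℤ}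
    (hj : (N : ℤ) - 1 ≤ j) (hjk : j ≤ k) : s j ≤ s k := by
  obtain ⟨n, rfl⟩ := Int.le.dest hjk
  clear hjk
  induction n with
  | zero => simp
  | succ n ih =>
    refine ih.trans ?_
    have := S.le (k := j + ((n + 1 : ℕ) : ℤ)) (by rw [le_abs]; left; push_cast; omega)
    rwa [show j + ((n + 1 : ℕ) : ℤ) - 1 = j + n by push_cast; ring] at this

lemma SeqP.mono_neg {p c : ℝ} {N : ℕ} {s : ℤ → ℝ} (S : SeqP p c N s) {j k : ℤ}
    (hk : k ≤ -(N : ℤ)) (hjk : j ≤ k) : s j ≤ s k := by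
  obtain ⟨n, rfl⟩ := Int.le.dest hjk
  clear hjk
  induction n with
  | zero => simp
  | succ n ih =>
    have := S.le (k := j + ((n + 1 : ℕ) : ℤ)) (by rw [le_abs]; right; push_cast at hk ⊢; omega)
    rw [show j + ((n + 1 : ℕ) : ℤ) - 1 = j + n by push_cast; ring] at this
    exact (ih (by push_cast at hk ⊢; omega)).trans this

structure Setup (T : H →ₗ.[ℂ] H) (C : T.domain →ₗ[ℂ] H) (p h K c : ℝ) (N : ℕ) (s : ℤ → ℝ) : Prop where
  S : SeqP p c N s
  N0 : 0 < N
  K1 : 1 ≤ K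
  cK : c * K ≤ 1
  hh : 0 < h
  hp0 : 0 ≤ p
  hp1 : p < 1
  vert : ∀ k : ℤ, ((N : ℤ) - 1 ≤ k ∨ k ≤ -(N : ℤ)) → ∀ y : ℝ,
    Good T C ((s k : ℂ) + Complex.I * (y : ℂ)) K (|s k| ^ p)
  out : ∀ z : ℂ, (s ((N : ℤ) - 1) ≤ z.re ∨ z.re ≤ s (-(N : ℤ))) → h * |z.re| ^ p ≤ |z.im| →
    ∃ D, Good T C z K D
  far : ∀ a b : ℝ, ∃ Y > 0, ∀ z : ℂ, a ≤ z.re → z.re ≤ b → Y ≤ |z.im| → Good T C z K |z.im|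

section setup
variable {T : H →ₗ.[ℂ] H} {C : T.domain →ₗ[ℂ] H} {p h K c : ℝ} {N : ℕ} {s : ℤ → ℝ}

/-- the trapezoid -/
def Setup.d (X : Setup T C p h K c N s) (k : KI N) : TrapData :=
  trapD h p (s (k.1 - 1)) (s k.1) X.hh (X.S.le k.2)
    ((X.S.sgn k.2).imp (fun h => by linarith) (fun h => by linarith))

lemma Setup.abs_ge (X : Setup T C p h K c N s) (k : KI N) {x : ℝ} (h1 : s (k.1 - 1) ≤ x)
    (h2 : x ≤ s k.1) : 1 ≤ |x| := by
  rcases X.S.sgn k.2 with h | h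
  · exact (by linarith : 1 ≤ x).trans (le_abs_self x)
  · exact (by linarith : 1 ≤ -x).trans (neg_le_abs x)

lemma Setup.lines_of (X : Setup T C p h K c N s) {k : ℤ} (hk : (N : ℤ) - 1 ≤ k ∨ k ≤ -(N : ℤ))
    {z : ℂ} (hz : z.re = s k) : Good T C z K (|s k| ^ p) := by
  have := X.vert k hk z.im
  rwa [← hz, show ((z.re : ℂ) + Complex.I * (z.im : ℂ)) = z by
    rw [mul_comm]; exact Complex.re_add_im z, hz] at this

lemma KI.ok (k : KI N) : (((N : ℤ) - 1 ≤ k.1 - 1 ∨ k.1 - 1 ≤ -(N : ℤ))) ∧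
    (((N : ℤ) - 1 ≤ k.1 ∨ k.1 ≤ -(N : ℤ))) := by
  rcases le_abs.1 k.2 with h | h <;> omega

lemma Setup.good (X : Setup T C p h K c N s) (k : KI N) :
    ∀ z ∈ (X.d k).chain.carrier, ∃ D, Good T C z K D := by
  refine (X.d k).carrier_subset (S := {z | ∃ D, Good T C z K D}) ?_ ?_ ?_
  · intro z h1 h2 h3
    refine X.out z ?_ (le_of_eq h3.symm)
    change s (k.1 - 1) ≤ z.re at h1
    change z.re ≤ s k.1 at h2
    rcases le_abs.1 k.2 with h | h
    · left
      exact (X.S.mono_pos le_rfl (by omega)).trans h1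
    · right
      exact h2.trans (X.S.mono_neg le_rfl (by omega))
  · intro z h1 h2
    exact ⟨_, X.lines_of k.ok.1 h1⟩
  · intro z h1 h2
    exact ⟨_, X.lines_of k.ok.2 h1⟩

lemma Setup.re_ge (X : Setup T C p h K c N s) (k : KI N) :
    ∀ z ∈ (X.d k).chain.carrier, 1 ≤ |z.re| := by
  have hab : s (k.1 - 1) ≤ s k.1 := X.S.le k.2
  refine (X.d k).carrier_subset (S := {z | 1 ≤ |z.re|}) ?_ ?_ ?_
  · intro z h1 h2 h3
    exact X.abs_ge k h1 h2
  · intro z h1 h2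
    have h1' : z.re = s (k.1 - 1) := h1
    exact X.abs_ge k h1'.ge (h1'.le.trans hab)
  · intro z h1 h2
    have h1' : z.re = s k.1 := h1
    exact X.abs_ge k (hab.trans h1'.ge) h1'.le

lemma Setup.im_le (X : Setup T C p h K c N s) (k : KI N) :
    ∀ z ∈ (X.d k).chain.carrier, |z.im| ≤ h * |z.re| ^ p := by
  refine (X.d k).carrier_subset (S := {z | |z.im| ≤ h * |z.re| ^ p}) ?_ ?_ ?_
  · intro z h1 h2 h3
    exact le_of_eq h3
  · intro z h1 h2
    change |z.im| ≤ h * |z.re| ^ p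
    rw [h1]; exact h2
  · intro z h1 h2
    change |z.im| ≤ h * |z.re| ^ p
    rw [h1]; exact h2

lemma Setup.g'_le (X : Setup T C p h K c N s) (k : KI N) :
    ∀ x ∈ Set.Icc (X.d k).a (X.d k).b, |(X.d k).g' x| ≤ h := by
  intro x hx
  have h1 : 1 ≤ |x| := X.abs_ge k hx.1 hx.2
  have h2 := rpow_le_self h1 X.hp1
  have hh := X.hh
  have hp0 := X.hp0
  have hp1 := X.hp1
  change |h * (p * (|x| ^ p / x))| ≤ h
  rw [abs_mul, abs_mul, abs_div, abs_of_pos hh, abs_of_nonneg hp0, abs_of_nonneg (by positivity : 0 ≤ |x| ^ p)]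
  have h3 : |x| ^ p / |x| ≤ 1 := by rw [div_le_one (by linarith)]; exact h2
  have h4 : 0 ≤ |x| ^ p / |x| := by positivity
  have : p * (|x| ^ p / |x|) ≤ 1 := by nlinarith
  nlinarith

lemma Setup.carT (X : Setup T C p h K c N s) (k : KI N) :
    (X.d k).chain.carrier ⊆ pmResolventSet T := fun z hz => by
  obtain ⟨D, hD⟩ := X.good k z hz
  exact hD.hT

lemma Setup.carA (X : Setup T C p h K c N s) (k : KI N) :
    (X.d k).chain.carrier ⊆ pmResolventSet (addC T C) := fun z hz => by
  obtain ⟨D, hD⟩ := X.good k z hz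
  exact hD.hA

lemma Setup.front (X : Setup T C p h K c N s) (k : KI N) :
    frontier (X.d k).region ⊆ (X.d k).chain.carrier :=
  (X.d k).frontier_region (cont_par h X.hp0)

lemma Setup.overlap (X : Setup T C p h K c N s) {j k : KI N} (hjk : j ≠ k) {z : ℂ}
    (hj : z ∈ (X.d j).region) (hk : z ∈ (X.d k).region) : ∃ D, Good T C z K D := by
  have key : ∀ j k : KI N, j.1 < k.1 → z ∈ (X.d j).region → z ∈ (X.d k).region →
      ∃ D, Good T C z K D := by
    intro j k hlt hj hk
    obtain ⟨j1, j2, _⟩ := hj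
    obtain ⟨k1, k2, _⟩ := hk
    change s (j.1 - 1) ≤ z.re at j1
    change z.re ≤ s j.1 at j2
    change s (k.1 - 1) ≤ z.re at k1
    change z.re ≤ s k.1 at k2
    rcases le_abs.1 k.2 with h | h
    · rcases le_abs.1 j.2 with h' | h'
      · have := X.S.mono_pos (j := j.1) (k := k.1 - 1) (by omega) (by omega)
        exact ⟨_, X.lines_of (k := j.1) (by omega) (le_antisymm j2 (this.trans k1))⟩
      · have e1 := X.S.neg j.1 (by omega)
        have e2 := X.S.pos (k.1 - 1) (by omega)
        linarith
    · have := X.S.mono_neg (j := j.1) (k := k.1 - 1) (by omega) (by omega)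
      exact ⟨_, X.lines_of (k := j.1) (by omega) (le_antisymm j2 (this.trans k1))⟩
  rcases lt_trichotomy j.1 k.1 with h | h | h
  · exact key j k h hj hk
  · exact absurd (Subtype.ext h) hjk
  · exact key k j h hk hj

end setup
end PM

namespace PM
open Filter Topology

section setup
variable {T : H →ₗ.[ℂ] H} {C : T.domain →ₗ[ℂ] H} {p h K c : ℝ} {N : ℕ} {s : ℤ → ℝ}

lemma Setup.mu_le (X : Setup T C p h K c N s) (k : KI N) :
    ∑ i, ∫ u in Set.uIcc ((X.d k).sI i) ((X.d k).tI i),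
      (X.d k).wt p i u / |((X.d k).gam i u).re| ^ 2 ≤
      (1 + h) ^ 2 * tot h p (s (k.1 - 1)) (s k.1) 0 := by
  have hab : s (k.1 - 1) ≤ s k.1 := X.S.le k.2
  have n1 : (0 : ℝ) ≠ s (k.1 - 1) := fun e => by
    have := X.abs_ge k le_rfl hab
    rw [← e] at this; norm_num at this
  have n2 : (0 : ℝ) ≠ s k.1 := fun e => by
    have := X.abs_ge k hab le_rfl
    rw [← e] at this; norm_num at this
  have h1 := pieces_le X.hh (X.S.le k.2)
    ((X.S.sgn k.2).imp (fun h => by linarith) (fun h => by linarith)) n1 n2 X.hp0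
  have hh := X.hh
  refine le_trans ?_ (mul_le_mul_of_nonneg_left h1 (by positivity : 0 ≤ (1 + h) ^ 2))
  rw [Finset.mul_sum]
  apply Finset.sum_le_sum
  intro i _
  rw [← MeasureTheory.integral_const_mul]
  have hmem : ∀ u ∈ Set.uIcc ((X.d k).sI i) ((X.d k).tI i),
      (X.d k).gam i u ∈ (X.d k).chain.carrier := fun u hu => (X.d k).chain.mem_carrier (i := i) hu
  have hnz : ∀ u ∈ Set.uIcc ((X.d k).sI i) ((X.d k).tI i), 0 < ‖(X.d k).gam i u‖ := by
    intro u hu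
    have := X.re_ge k _ (hmem u hu)
    linarith [Complex.abs_re_le_norm ((X.d k).gam i u)]
  apply MeasureTheory.setIntegral_mono_on
  · exact ((X.d k).wt0_cont X.hp0 i (X.re_ge k)).integrableOn_compact isCompact_uIcc
  · have hc : ContinuousOn (fun u => (1 + h) ^ 2 * ((X.d k).wt p i u / ‖((0 : ℝ) : ℂ) - (X.d k).gam i u‖ ^ 2))
        (Set.uIcc ((X.d k).sI i) ((X.d k).tI i)) := by
      refine continuousOn_const.mul (((X.d k).wt_cont X.hp0 i).div
        (((continuousOn_const.sub ((X.d k).gam_cont i)).norm).pow 2) ?_)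
      intro u hu
      have := hnz u hu
      rw [Complex.ofReal_zero, zero_sub, norm_neg]
      positivity
    exact hc.integrableOn_compact isCompact_uIcc
  · exact measurableSet_uIcc
  · intro u hu
    have e1 := X.re_ge k _ (hmem u hu)
    have e2 := X.im_le k _ (hmem u hu)
    have e3 := rpow_le_self e1 X.hp1
    have e4 := hnz u hu
    change (X.d k).wt p i u / _ ≤ (1 + h) ^ 2 * ((X.d k).wt p i u / ‖((0 : ℝ) : ℂ) - (X.d k).gam i u‖ ^ 2)
    rw [Complex.ofReal_zero, zero_sub, norm_neg]
    have hw : 0 ≤ (X.d k).wt p i u := by unfold TrapData.wt; positivity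
    have e5 : ‖(X.d k).gam i u‖ ≤ (1 + h) * |((X.d k).gam i u).re| := by
      have := Complex.norm_le_abs_re_add_abs_im ((X.d k).gam i u)
      nlinarith
    have e6 : ‖(X.d k).gam i u‖ ^ 2 ≤ (1 + h) ^ 2 * |((X.d k).gam i u).re| ^ 2 := by
      rw [← mul_pow]; gcongr
    rw [← mul_div_assoc, div_le_div_iff₀ (by positivity) (by positivity)]
    nlinarith

lemma Setup.dist (X : Setup T C p h K c N s) {l : ℝ} (hl : (l : ℂ) ∉ pmResolventSet T) {k : ℤ}
    (hk : (N : ℤ) - 1 ≤ k ∨ k ≤ -(N : ℤ)) : c * |s k| ^ p ≤ |l - s k| := by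
  have g := X.vert k hk 0
  have h1 := one_le_dist g.hT hl
  have h2 := g.rT
  have e : ‖(l : ℂ) - ((s k : ℂ) + Complex.I * ((0 : ℝ) : ℂ))‖ = |l - s k| := by
    rw [Complex.ofReal_zero, mul_zero, add_zero, ← Complex.ofReal_sub, Complex.norm_real, Real.norm_eq_abs]
  rw [e] at h1
  have hs : 1 ≤ |s k| := by
    rcases hk with h | h
    · exact (X.S.pos k h).trans (le_abs_self _)
    · exact (by linarith [X.S.neg k h] : 1 ≤ - s k).trans (neg_le_abs _)
  have hsp : 0 < |s k| ^ p := by positivity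
  have hK : 0 < K := by linarith [X.K1]
  have h3 : 1 ≤ |l - s k| * (K / |s k| ^ p) := h1.trans (by gcongr)
  rw [← mul_div_assoc, one_le_div hsp] at h3
  have hc := X.S.c0
  calc c * |s k| ^ p ≤ c * (|l - s k| * K) := by gcongr
    _ = (c * K) * |l - s k| := by ring
    _ ≤ 1 * |l - s k| := by gcongr; exact X.cK
    _ = _ := one_mul _

lemma Setup.ne_of_dist (X : Setup T C p h K c N s) {l : ℝ} {k : ℤ} (hk : (N : ℤ) - 1 ≤ k ∨ k ≤ -(N : ℤ))
    (h : c * |s k| ^ p ≤ |l - s k|) : l ≠ s k := by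
  intro e
  rw [e, sub_self, abs_zero] at h
  have hs : 1 ≤ |s k| := by
    rcases hk with h | h
    · exact (X.S.pos k h).trans (le_abs_self _)
    · exact (by linarith [X.S.neg k h] : 1 ≤ - s k).trans (neg_le_abs _)
  have hsp : 0 < |s k| ^ p := by positivity
  nlinarith [X.S.c0]

lemma Setup.dist0 (X : Setup T C p h K c N s) {k : ℤ}
    (hk : (N : ℤ) - 1 ≤ k ∨ k ≤ -(N : ℤ)) : c * |s k| ^ p ≤ |0 - s k| := by
  have hs : 1 ≤ |s k| := by
    rcases hk with h | h
    · exact (X.S.pos k h).trans (le_abs_self _)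
    · exact (by linarith [X.S.neg k h] : 1 ≤ - s k).trans (neg_le_abs _)
  have := rpow_le_self hs X.hp1
  have h0 : 0 ≤ |s k| ^ p := by positivity
  rw [zero_sub, abs_neg]
  nlinarith [X.S.c0, X.S.c1]

lemma Setup.sum_aa (X : Setup T C p h K c N s) (hT : IsSA T) {K2 : ℝ} (hK2 : 0 ≤ K2) :
    ∃ Cs, 0 ≤ Cs ∧ ∀ (F : Finset (KI N)) (x : H), ∑ k ∈ F, (X.d k).aa T p K2 x ≤ Cs * ‖x‖ ^ 2 := by
  obtain ⟨C0, hC0, hC⟩ := sum_tot X.hp0 X.hp1 X.hh X.S.c0 X.S.c1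
  have hh := X.hh
  refine ⟨K2 * ((1 + h) ^ 2 * C0 + C0), by positivity, ?_⟩
  intro F x
  have hmap : ∀ l : ℝ, ∑ k ∈ F, tot h p (s (k.1 - 1)) (s k.1) l =
      ∑ k ∈ F.map ⟨Subtype.val, Subtype.val_injective⟩, tot h p (s (k - 1)) (s k) l := by
    intro l
    rw [Finset.sum_map]; rfl
  have hF' : ∀ k ∈ F.map ⟨Subtype.val, Subtype.val_injective⟩, (N : ℤ) ≤ |k| := by
    intro k hk
    rw [Finset.mem_map] at hk
    obtain ⟨a, _, rfl⟩ := hk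
    exact a.2
  have hmu : ∑ k ∈ F, ∑ i, ∫ u in Set.uIcc ((X.d k).sI i) ((X.d k).tI i),
      (X.d k).wt p i u / |((X.d k).gam i u).re| ^ 2 ≤ (1 + h) ^ 2 * C0 := by
    refine (Finset.sum_le_sum (fun k _ => X.mu_le k)).trans ?_
    rw [← Finset.mul_sum, hmap]
    gcongr
    exact hC N s X.S 0 (fun k hk => X.dist0 hk) _ hF'
  have hsq : ∑ k ∈ F, ∑ i, ∫ u in Set.uIcc ((X.d k).sI i) ((X.d k).tI i),
      (X.d k).wt p i u * ‖res T ((X.d k).gam i u) x‖ ^ 2 ≤ C0 * ‖x‖ ^ 2 := by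
    rw [← Finset.sum_product' F Finset.univ (fun k i => ∫ u in Set.uIcc ((X.d k).sI i) ((X.d k).tI i),
      (X.d k).wt p i u * ‖res T ((X.d k).gam i u) x‖ ^ 2)]
    refine hT.square (F ×ˢ Finset.univ) (fun i => (X.d i.1).sI i.2 ⊓ (X.d i.1).tI i.2)
      (fun i => (X.d i.1).sI i.2 ⊔ (X.d i.1).tI i.2) (fun i => (X.d i.1).gam i.2)
      (fun i => (X.d i.1).wt p i.2) ?_ ?_ ?_ ?_ C0 hC0 ?_ x
    · intro i _
      exact (X.d i.1).gam_cont i.2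
    · intro i _
      exact (X.d i.1).wt_cont X.hp0 i.2
    · intro i _ u _
      change 0 ≤ |((X.d i.1).gam i.2 u).re| ^ p
      positivity
    · intro i _ u hu
      exact X.carT i.1 ((X.d i.1).chain.mem_carrier (i := i.2) hu)
    · intro l hl
      have hd : ∀ k : ℤ, ((N : ℤ) - 1 ≤ k ∨ k ≤ -(N : ℤ)) → c * |s k| ^ p ≤ |l - s k| :=
        fun k hk => X.dist hl hk
      rw [Finset.sum_product]
      refine le_trans ?_ (hC N s X.S l hd _ hF')
      rw [← hmap]
      apply Finset.sum_le_sum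
      intro k _
      exact pieces_le X.hh (X.S.le k.2)
        ((X.S.sgn k.2).imp (fun h => by linarith) (fun h => by linarith))
        (X.ne_of_dist k.ok.1 (hd _ k.ok.1)) (X.ne_of_dist k.ok.2 (hd _ k.ok.2)) X.hp0
  unfold TrapData.aa
  rw [← Finset.mul_sum, Finset.sum_add_distrib, ← Finset.mul_sum]
  rw [mul_assoc]
  apply mul_le_mul_of_nonneg_left _ hK2
  have : 0 ≤ ‖x‖ ^ 2 := by positivity
  nlinarith

lemma TrapData.aa_nonneg (d : TrapData) (T : H →ₗ.[ℂ] H) (p : ℝ) {K : ℝ} (hK : 0 ≤ K) (x : H) :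
    0 ≤ d.aa T p K x := by
  unfold TrapData.aa TrapData.wt
  have e1 : 0 ≤ ∑ i, ∫ u in Set.uIcc (d.sI i) (d.tI i), |(d.gam i u).re| ^ p / |(d.gam i u).re| ^ 2 :=
    Finset.sum_nonneg fun i _ => MeasureTheory.integral_nonneg fun u => by positivity
  have e2 : 0 ≤ ∑ i, ∫ u in Set.uIcc (d.sI i) (d.tI i), |(d.gam i u).re| ^ p * ‖res T (d.gam i u) x‖ ^ 2 :=
    Finset.sum_nonneg fun i _ => MeasureTheory.integral_nonneg fun u => by positivity
  positivity

lemma TrapData.aa_hom (d : TrapData) (T : H →ₗ.[ℂ] H) (p K t : ℝ) (x : H) :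
    d.aa T p K ((t : ℂ) • x) = t ^ 2 * d.aa T p K x := by
  unfold TrapData.aa
  have e : ∀ i u, d.wt p i u * ‖res T (d.gam i u) ((t : ℂ) • x)‖ ^ 2 =
      t ^ 2 * (d.wt p i u * ‖res T (d.gam i u) x‖ ^ 2) := by
    intro i u
    rw [map_smul, norm_smul, Complex.norm_real, mul_pow, Real.norm_eq_abs, sq_abs]; ring
  simp only [e, MeasureTheory.integral_const_mul]
  rw [← Finset.mul_sum, norm_smul, Complex.norm_real, mul_pow, Real.norm_eq_abs, sq_abs]; ring

theorem Setup.bessel (X : Setup T C p h K c N s) (hT : IsSA T) {b M : ℝ} (hC : SubC T C p b M)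
    (hb : 0 < b) (hM : 0 ≤ M) (hL : LProp T) : ∃ C', 0 ≤ C' ∧
    (∀ (F : Finset (KI N)) x, ∑ k ∈ F, ‖(X.d k).chain.proj (addC T C) x‖ ^ 2 ≤ C' * ‖x‖ ^ 2) ∧
    (∀ (F : Finset (KI N)) x, ∑ k ∈ F,
      ‖ContinuousLinearMap.adjoint ((X.d k).chain.proj (addC T C)) x‖ ^ 2 ≤ C' * ‖x‖ ^ 2) := by
  have hh := X.hh
  have hK2 : 0 ≤ (1 + h) * ((1 + K) * (b * (2 + h) + M)) := by
    have := X.K1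
    positivity
  obtain ⟨Cs, hCs, hsum⟩ := X.sum_aa hT hK2
  obtain ⟨b1, b2⟩ := bessel_of_bilinear
    (D := fun k => (X.d k).chain.proj (addC T C) - (X.d k).chain.proj T)
    (a := fun k => (X.d k).aa T p ((1 + h) * ((1 + K) * (b * (2 + h) + M)))) hCs
    (fun k x => (X.d k).aa_nonneg T p hK2 x) (fun k t x => (X.d k).aa_hom T p _ t x) hsum
    (fun k x y => (X.d k).bil hT hC hb hM X.hp0 X.hp1 X.hh X.K1 (X.g'_le k) (X.good k) (X.re_ge k)
      (X.im_le k) x y)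
  have hst : ∀ k, star ((X.d k).chain.proj T) = (X.d k).chain.proj T := fun k =>
    (X.d k).proj_star hT (X.carT k)
  have hfr : ∀ k, frontier (X.d k).region ⊆ pmResolventSet T := fun k =>
    (X.front k).trans (X.carT k)
  have hR : ∀ k, IsRieszProjFor T (X.d k).region ((X.d k).chain.proj T) := fun k =>
    (X.d k).isRiesz hL (X.carT k) (hfr k)
  have hP := bessel_orth (P := fun k => (X.d k).chain.proj T) hst
    (fun k x => by
      have := (hR k).1
      exact DFunLike.congr_fun this x)
    (fun j k hjk x => riesz_kill hL (hR k) (hR j) (hfr k) (hfr j) (fun z hz => by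
      obtain ⟨D, hD⟩ := X.overlap hjk hz.2 hz.1
      exact hD.hT) x)
  have key : ∀ u v : H, ‖v‖ ^ 2 ≤ 2 * ‖u‖ ^ 2 + 2 * ‖v - u‖ ^ 2 := by
    intro u v
    have h1 : ‖v‖ ≤ ‖u‖ + ‖v - u‖ := by
      calc ‖v‖ = ‖u + (v - u)‖ := by congr 1; abel
        _ ≤ _ := norm_add_le _ _
    have h2 : ‖v‖ ^ 2 ≤ (‖u‖ + ‖v - u‖) ^ 2 := by gcongr
    nlinarith [sq_nonneg (‖u‖ - ‖v - u‖)]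
  refine ⟨2 + 2 * (4 * Cs ^ 2), by positivity, ?_, ?_⟩
  · intro F x
    have h1 : ∑ k ∈ F, ‖(X.d k).chain.proj (addC T C) x‖ ^ 2 ≤
        ∑ k ∈ F, (2 * ‖(X.d k).chain.proj T x‖ ^ 2 +
          2 * ‖((X.d k).chain.proj (addC T C) - (X.d k).chain.proj T) x‖ ^ 2) :=
      Finset.sum_le_sum fun k _ => key _ _
    rw [Finset.sum_add_distrib, ← Finset.mul_sum, ← Finset.mul_sum] at h1
    have h2 := hP F x
    have h3 := b1 F x
    linarith
  · intro F x
    have h1 : ∑ k ∈ F, ‖ContinuousLinearMap.adjoint ((X.d k).chain.proj (addC T C)) x‖ ^ 2 ≤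
        ∑ k ∈ F, (2 * ‖(X.d k).chain.proj T x‖ ^ 2 +
          2 * ‖ContinuousLinearMap.adjoint ((X.d k).chain.proj (addC T C) - (X.d k).chain.proj T) x‖ ^ 2) := by
      refine Finset.sum_le_sum fun k _ => ?_
      have e : ContinuousLinearMap.adjoint ((X.d k).chain.proj (addC T C) - (X.d k).chain.proj T) x =
          ContinuousLinearMap.adjoint ((X.d k).chain.proj (addC T C)) x - (X.d k).chain.proj T x := by
        rw [map_sub]
        change _ - (star ((X.d k).chain.proj T)) x = _
        rw [hst]
        rfl
      rw [e]
      exact key _ _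
    rw [Finset.sum_add_distrib, ← Finset.mul_sum, ← Finset.mul_sum] at h1
    have h2 := hP F x
    have h3 := b2 F x
    linarith

end setup
end PM

namespace PM
open Filter Topology

lemma SeqP.step {p c : ℝ} {N : ℕ} {s : ℤ → ℝ} (hp0 : 0 ≤ p) (S : SeqP p c N s) {k : ℤ}
    (hk : (N : ℤ) ≤ |k|) : c ≤ s k - s (k - 1) := by
  have h1 := S.gap k hk
  have hc := S.c0
  have h2 : 0 ≤ |s k| ^ p := by positivity
  have h3 : 0 ≤ |s (k - 1)| ^ p := by positivity
  rcases S.sgn hk with h | h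
  · have : 1 ≤ |s (k - 1)| ^ p := Real.one_le_rpow (h.trans (le_abs_self _)) hp0
    nlinarith
  · have : 1 ≤ |s k| ^ p := Real.one_le_rpow ((by linarith : 1 ≤ - s k).trans (neg_le_abs _)) hp0
    nlinarith

lemma SeqP.grow_pos {p c : ℝ} {N : ℕ} {s : ℤ → ℝ} (hp0 : 0 ≤ p) (S : SeqP p c N s) (n : ℕ) :
    1 + c * n ≤ s ((N : ℤ) - 1 + n) := by
  induction n with
  | zero => simpa using S.pos _ (le_refl ((N : ℤ) - 1))
  | succ n ih =>
    have := S.step hp0 (k := (N : ℤ) - 1 + ((n + 1 : ℕ) : ℤ)) (by rw [le_abs]; left; push_cast; omega)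
    rw [show (N : ℤ) - 1 + ((n + 1 : ℕ) : ℤ) - 1 = (N : ℤ) - 1 + n by push_cast; ring] at this
    push_cast at this ⊢
    nlinarith

lemma SeqP.grow_neg {p c : ℝ} {N : ℕ} {s : ℤ → ℝ} (hp0 : 0 ≤ p) (S : SeqP p c N s) (n : ℕ) :
    s (-(N : ℤ) - n) ≤ -1 - c * n := by
  induction n with
  | zero => simpa using S.neg _ (le_refl (-(N : ℤ)))
  | succ n ih =>
    have := S.step hp0 (k := -(N : ℤ) - n) (by rw [le_abs]; right; omega)
    rw [show -(N : ℤ) - n - 1 = -(N : ℤ) - ((n + 1 : ℕ) : ℤ) by push_cast; ring] at this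
    push_cast at this ⊢
    nlinarith

lemma SeqP.cover_pos {p c : ℝ} {N : ℕ} {s : ℤ → ℝ} (hp0 : 0 ≤ p) (S : SeqP p c N s) {x : ℝ}
    (hx : s ((N : ℤ) - 1) ≤ x) : ∃ k : ℤ, (N : ℤ) ≤ |k| ∧ s (k - 1) ≤ x ∧ x ≤ s k := by
  have hex : ∃ n : ℕ, x ≤ s ((N : ℤ) - 1 + n) := by
    obtain ⟨n, hn⟩ := exists_nat_ge (x / c)
    refine ⟨n, le_trans ?_ (S.grow_pos hp0 n)⟩
    rw [div_le_iff₀ S.c0] at hn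
    linarith
  classical
  have hf := Nat.find_spec hex
  rcases hn : Nat.find hex with _ | n
  · rw [hn] at hf
    refine ⟨N, le_abs_self _, hx, ?_⟩
    refine hf.trans (S.mono_pos (by simp) (by simp))
  · rw [hn] at hf
    have hlt := Nat.find_min hex (m := n) (by omega)
    refine ⟨(N : ℤ) - 1 + ((n + 1 : ℕ) : ℤ), by rw [le_abs]; left; push_cast; omega, ?_, hf⟩
    rw [show (N : ℤ) - 1 + ((n + 1 : ℕ) : ℤ) - 1 = (N : ℤ) - 1 + n by push_cast; ring]
    push Not at hlt
    exact hlt.le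

lemma SeqP.cover_neg {p c : ℝ} {N : ℕ} {s : ℤ → ℝ} (hp0 : 0 ≤ p) (S : SeqP p c N s) {x : ℝ}
    (hx : x ≤ s (-(N : ℤ))) : ∃ k : ℤ, (N : ℤ) ≤ |k| ∧ s (k - 1) ≤ x ∧ x ≤ s k := by
  have hex : ∃ n : ℕ, s (-(N : ℤ) - n) ≤ x := by
    obtain ⟨n, hn⟩ := exists_nat_ge (-x / c)
    refine ⟨n, le_trans (S.grow_neg hp0 n) ?_⟩
    rw [div_le_iff₀ S.c0] at hn
    linarith
  classical
  have hf := Nat.find_spec hex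
  rcases hn : Nat.find hex with _ | n
  · rw [hn] at hf
    refine ⟨-(N : ℤ), by rw [le_abs]; right; omega, ?_, hx⟩
    exact (S.mono_neg (by simp) (by simp)).trans hf
  · rw [hn] at hf
    have hlt := Nat.find_min hex (m := n) (by omega)
    refine ⟨-(N : ℤ) - n, by rw [le_abs]; right; omega, ?_, ?_⟩
    · rw [show -(N : ℤ) - n - 1 = -(N : ℤ) - ((n + 1 : ℕ) : ℤ) by push_cast; ring]
      exact hf
    · push Not at hlt
      exact hlt.le

section setup
variable {T : H →ₗ.[ℂ] H} {C : T.domain →ₗ[ℂ] H} {p h K c : ℝ} {N : ℕ} {s : ℤ → ℝ}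

lemma Setup.vert1 (X : Setup T C p h K c N s) {k : ℤ} (hk : (N : ℤ) - 1 ≤ k ∨ k ≤ -(N : ℤ)) (y : ℝ) :
    Good T C ((s k : ℂ) + Complex.I * (y : ℂ)) K 1 := by
  refine (X.vert k hk y).mono le_rfl ?_
  have hs : 1 ≤ |s k| := by
    rcases hk with h | h
    · exact (X.S.pos k h).trans (le_abs_self _)
    · exact (by linarith [X.S.neg k h] : 1 ≤ - s k).trans (neg_le_abs _)
  have := Real.one_le_rpow hs X.hp0
  have := X.K1
  gcongr

lemma Setup.right (X : Setup T C p h K c N s) (Y : ℝ) : ∃ k : ℤ, (N : ℤ) - 1 ≤ k ∧ Y < s k := by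
  obtain ⟨n, hn⟩ := exists_nat_ge (Y / c)
  refine ⟨(N : ℤ) - 1 + n, by omega, lt_of_lt_of_le ?_ (X.S.grow_pos X.hp0 n)⟩
  rw [div_le_iff₀ X.S.c0] at hn
  linarith

lemma Setup.left (X : Setup T C p h K c N s) (Y : ℝ) : ∃ k : ℤ, k ≤ -(N : ℤ) ∧ s k < Y := by
  obtain ⟨n, hn⟩ := exists_nat_ge (-Y / c)
  refine ⟨-(N : ℤ) - n, by omega, lt_of_le_of_lt (X.S.grow_neg X.hp0 n) ?_⟩
  rw [div_le_iff₀ X.S.c0] at hn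
  linarith

lemma Setup.LT (X : Setup T C p h K c N s) : LProp T := by
  refine lprop_of (C := K) (by linarith [X.K1]) ?_ ?_ ?_
  · intro Y
    obtain ⟨k, hk, hY⟩ := X.right Y
    refine ⟨s k, hY, fun y => ?_⟩
    have g := X.vert1 (Or.inl hk) y
    exact ⟨g.hT, by simpa using g.rT⟩
  · intro Y
    obtain ⟨k, hk, hY⟩ := X.left Y
    refine ⟨s k, hY, fun y => ?_⟩
    have g := X.vert1 (Or.inr hk) y
    exact ⟨g.hT, by simpa using g.rT⟩
  · intro a b
    obtain ⟨Y, hY, hg⟩ := X.far a b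
    exact ⟨Y, hY, fun z h1 h2 h3 => ⟨(hg z h1 h2 h3).hT, (hg z h1 h2 h3).rT⟩⟩

lemma Setup.LA (X : Setup T C p h K c N s) : LProp (addC T C) := by
  refine lprop_of (C := K) (by linarith [X.K1]) ?_ ?_ ?_
  · intro Y
    obtain ⟨k, hk, hY⟩ := X.right Y
    refine ⟨s k, hY, fun y => ?_⟩
    have g := X.vert1 (Or.inl hk) y
    exact ⟨g.hA, by simpa using g.rA⟩
  · intro Y
    obtain ⟨k, hk, hY⟩ := X.left Y
    refine ⟨s k, hY, fun y => ?_⟩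
    have g := X.vert1 (Or.inr hk) y
    exact ⟨g.hA, by simpa using g.rA⟩
  · intro a b
    obtain ⟨Y, hY, hg⟩ := X.far a b
    exact ⟨Y, hY, fun z h1 h2 h3 => ⟨(hg z h1 h2 h3).hA, (hg z h1 h2 h3).rA⟩⟩

lemma Setup.region_eq (X : Setup T C p h K c N s) (k : KI N) :
    (X.d k).region = Trapezoid h p s k.1 := rfl

lemma Setup.union_eq (X : Setup T C p h K c N s) :
    (⋃ k ∈ {k : ℤ | (N : ℤ) ≤ |k|}, Trapezoid h p s k) =
    {z : ℂ | (s ((N : ℤ) - 1) ≤ z.re ∨ z.re ≤ s (-(N : ℤ))) ∧ |z.im| ≤ h * |z.re| ^ p} := by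
  ext z
  simp only [Set.mem_iUnion, Set.mem_setOf_eq, Trapezoid, exists_prop]
  constructor
  · rintro ⟨k, hk, h1, h2, h3⟩
    refine ⟨?_, h3⟩
    rcases le_abs.1 hk with h | h
    · left
      exact (X.S.mono_pos le_rfl (by omega)).trans h1
    · right
      exact h2.trans (X.S.mono_neg le_rfl (by omega))
  · rintro ⟨h1 | h1, h3⟩
    · obtain ⟨k, hk, a, b⟩ := X.S.cover_pos X.hp0 h1
      exact ⟨k, hk, a, b, h3⟩
    · obtain ⟨k, hk, a, b⟩ := X.S.cover_neg X.hp0 h1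
      exact ⟨k, hk, a, b, h3⟩

lemma Setup.front0 (X : Setup T C p h K c N s) :
    frontier ((⋃ k ∈ {k : ℤ | (N : ℤ) ≤ |k|}, Trapezoid h p s k)ᶜ) ⊆ pmResolventSet (addC T C) := by
  rw [frontier_compl, X.union_eq]
  intro z hz
  have hcl : IsClosed {z : ℂ | (s ((N : ℤ) - 1) ≤ z.re ∨ z.re ≤ s (-(N : ℤ))) ∧ |z.im| ≤ h * |z.re| ^ p} :=
    ((isClosed_le continuous_const Complex.continuous_re).union
      (isClosed_le Complex.continuous_re continuous_const)).inter
      (isClosed_le (continuous_abs.comp Complex.continuous_im)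
        ((cont_par h X.hp0).comp Complex.continuous_re))
  rw [frontier, hcl.closure_eq] at hz
  obtain ⟨⟨h1, h3⟩, hni⟩ := hz
  by_contra hc
  apply hni
  have e3 : |z.im| < h * |z.re| ^ p := by
    by_contra hlt
    push Not at hlt
    obtain ⟨D, hD⟩ := X.out z h1 hlt
    exact hc hD.hA
  have e1 : s ((N : ℤ) - 1) ≠ z.re := fun e => hc (X.lines_of (Or.inl le_rfl) e.symm).hA
  have e2 : z.re ≠ s (-(N : ℤ)) := fun e => hc (X.lines_of (Or.inr le_rfl) e).hA
  rw [mem_interior]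
  refine ⟨({z : ℂ | s ((N : ℤ) - 1) < z.re} ∪ {z : ℂ | z.re < s (-(N : ℤ))}) ∩
    {z : ℂ | |z.im| < h * |z.re| ^ p}, ?_, ?_, ?_, e3⟩
  · rintro w ⟨w1, w2⟩
    exact ⟨w1.imp le_of_lt le_of_lt, le_of_lt w2⟩
  · exact ((isOpen_lt continuous_const Complex.continuous_re).union
      (isOpen_lt Complex.continuous_re continuous_const)).inter
      (isOpen_lt (continuous_abs.comp Complex.continuous_im)
        ((cont_par h X.hp0).comp Complex.continuous_re))
  · exact h1.imp (fun h => lt_of_le_of_ne h e1) (fun h => lt_of_le_of_ne h e2)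

lemma Setup.exists0 (X : Setup T C p h K c N s) : ∃ Q : H →L[ℂ] H, IsRieszProjFor (addC T C)
    ((⋃ k ∈ {k : ℤ | (N : ℤ) ≤ |k|}, Trapezoid h p s k)ᶜ) Q := by
  obtain ⟨Y, hY, hg⟩ := X.far (s (-(N : ℤ))) (s ((N : ℤ) - 1))
  have hab : s (-(N : ℤ)) ≤ s ((N : ℤ) - 1) := by
    linarith [X.S.neg _ (le_refl (-(N : ℤ))), X.S.pos _ (le_refl ((N : ℤ) - 1))]
  let d : TrapData :=
    { a := s (-(N : ℤ)), b := s ((N : ℤ) - 1), g := fun _ => Y, g' := fun _ => 0, hab := hab,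
      hg := fun x _ => hasDerivAt_const x Y, hg' := continuousOn_const, pos := fun _ _ => hY }
  have hcar : d.chain.carrier ⊆ pmResolventSet (addC T C) := by
    refine d.carrier_subset ?_ ?_ ?_
    · intro z h1 h2 h3
      exact (hg z h1 h2 (le_of_eq h3.symm)).hA
    · intro z h1 h2
      exact (X.lines_of (Or.inr le_rfl) h1).hA
    · intro z h1 h2
      exact (X.lines_of (Or.inl le_rfl) h1).hA
  refine ⟨_, riesz_congr (d.isRiesz X.LA hcar ((d.frontier_region continuous_const).trans hcar)) ?_⟩
  intro z hz
  rw [X.union_eq]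
  constructor
  · rintro ⟨h1, h2, h3⟩ ⟨h4 | h4, h5⟩
    · exact hz (X.lines_of (Or.inl le_rfl) (le_antisymm h2 h4)).hA
    · exact hz (X.lines_of (Or.inr le_rfl) (le_antisymm h4 h1)).hA
  · intro hn
    have hre : s (-(N : ℤ)) ≤ z.re ∧ z.re ≤ s ((N : ℤ) - 1) := by
      by_contra hc
      have h1 : s ((N : ℤ) - 1) ≤ z.re ∨ z.re ≤ s (-(N : ℤ)) := by
        by_contra h'
        push Not at h'
        exact hc ⟨h'.2.le, h'.1.le⟩
      apply hn
      refine ⟨h1, ?_⟩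
      by_contra hlt
      push Not at hlt
      obtain ⟨D, hD⟩ := X.out z h1 hlt.le
      exact hz hD.hA
    refine ⟨hre.1, hre.2, ?_⟩
    by_contra hlt
    push Not at hlt
    exact hz (hg z hre.1 hre.2 hlt.le).hA

theorem Setup.final (X : Setup T C p h K c N s) (hT : IsSA T) {b M : ℝ} (hC : SubC T C p b M)
    (hb : 0 < b) (hM : 0 ≤ M) :
    (∀ k : ℤ, (N : ℤ) ≤ |k| →
        ∀ z ∈ pmSpectrum (addC T C), z ∉ frontier (Trapezoid h p s k)) ∧
      (∃ Q : ℤ → H →L[ℂ] H,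
        IsRieszProjFor (addC T C)
          ((⋃ k ∈ {k : ℤ | (N : ℤ) ≤ |k|}, Trapezoid h p s k)ᶜ) (Q 0) ∧
        ∀ k : ℤ, (N : ℤ) ≤ |k| →
          IsRieszProjFor (addC T C) (Trapezoid h p s k) (Q k)) ∧
      ∀ Q : ℤ → H →L[ℂ] H,
        IsRieszProjFor (addC T C)
          ((⋃ k ∈ {k : ℤ | (N : ℤ) ≤ |k|}, Trapezoid h p s k)ᶜ) (Q 0) →
        (∀ k : ℤ, (N : ℤ) ≤ |k| →
          IsRieszProjFor (addC T C) (Trapezoid h p s k) (Q k)) →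
        (∀ j k : ℤ, (j = 0 ∨ (N : ℤ) ≤ |j|) → (k = 0 ∨ (N : ℤ) ≤ |k|) →
          (Q j).comp (Q k) = if j = k then Q j else 0) ∧
        ∀ x : H, HasSum (fun k : {k : ℤ // k = 0 ∨ (N : ℤ) ≤ |k|} => Q k.1 x) x := by
  have hfr : ∀ k : KI N, frontier (X.d k).region ⊆ pmResolventSet (addC T C) := fun k =>
    (X.front k).trans (X.carA k)
  have hR : ∀ k : KI N, IsRieszProjFor (addC T C) (X.d k).region ((X.d k).chain.proj (addC T C)) :=
    fun k => (X.d k).isRiesz X.LA (X.carA k) (hfr k)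
  have hN := X.N0
  have hn0 : ∀ k : ℤ, (N : ℤ) ≤ |k| → k ≠ 0 := by
    rintro k hk rfl
    simp at hk
    omega
  refine ⟨?_, ?_, ?_⟩
  · intro k hk z hz hf
    exact hz (hfr ⟨k, hk⟩ hf)
  · obtain ⟨Q0, hQ0⟩ := X.exists0
    refine ⟨fun k => if hk : (N : ℤ) ≤ |k| then (X.d ⟨k, hk⟩).chain.proj (addC T C) else Q0, ?_, ?_⟩
    · have : ¬ ((N : ℤ) ≤ |(0 : ℤ)|) := fun h => hn0 0 h rfl
      simp only [this, dif_neg, not_false_eq_true]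
      exact hQ0
    · intro k hk
      simp only [hk, dif_pos]
      exact hR ⟨k, hk⟩
  · intro Q hQ0 hQ
    set U : {k : ℤ // k = 0 ∨ (N : ℤ) ≤ |k|} → Set ℂ := fun k =>
      if k.1 = 0 then (⋃ k ∈ {k : ℤ | (N : ℤ) ≤ |k|}, Trapezoid h p s k)ᶜ else Trapezoid h p s k.1 with hU
    have hUf : ∀ k, frontier (U k) ⊆ pmResolventSet (addC T C) := by
      intro k
      by_cases h0 : k.1 = 0
      · simp only [hU, h0, if_true]
        exact X.front0
      · simp only [hU, h0, if_false]
        exact hfr ⟨k.1, k.2.resolve_left h0⟩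
    have hUR : ∀ k, IsRieszProjFor (addC T C) (U k) (Q k.1) := by
      intro k
      by_cases h0 : k.1 = 0
      · simp only [hU, h0, if_true]
        exact hQ0
      · simp only [hU, h0, if_false]
        exact hQ k.1 (k.2.resolve_left h0)
    have hUd : ∀ j k, j ≠ k → U j ∩ U k ⊆ pmResolventSet (addC T C) := by
      intro j k hjk z hz
      have hjk' : j.1 ≠ k.1 := fun e => hjk (Subtype.ext e)
      obtain ⟨hz1, hz2⟩ := hz
      by_cases h0 : j.1 = 0
      · have h1 : k.1 ≠ 0 := fun e => hjk' (h0.trans e.symm)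
        simp only [hU, h0, h1, if_true, if_false] at hz1 hz2
        exact absurd (Set.mem_biUnion (show k.1 ∈ {k : ℤ | (N : ℤ) ≤ |k|} from k.2.resolve_left h1) hz2) hz1
      · by_cases h1 : k.1 = 0
        · simp only [hU, h0, h1, if_true, if_false] at hz1 hz2
          exact absurd (Set.mem_biUnion (show j.1 ∈ {k : ℤ | (N : ℤ) ≤ |k|} from j.2.resolve_left h0) hz1) hz2
        · simp only [hU, h0, h1, if_false] at hz1 hz2
          obtain ⟨D, hD⟩ := X.overlap (j := ⟨j.1, j.2.resolve_left h0⟩) (k := ⟨k.1, k.2.resolve_left h1⟩)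
            (fun e => hjk' (Subtype.mk.inj e)) hz1 hz2
          exact hD.hA
    have hUc : ∀ z, ∃ k, z ∈ U k := by
      intro z
      by_cases hz : z ∈ ⋃ k ∈ {k : ℤ | (N : ℤ) ≤ |k|}, Trapezoid h p s k
      · simp only [Set.mem_iUnion, Set.mem_setOf_eq, exists_prop] at hz
        obtain ⟨k, hk, hz⟩ := hz
        refine ⟨⟨k, Or.inr hk⟩, ?_⟩
        simp only [hU, hn0 k hk, if_false]
        exact hz
      · exact ⟨⟨0, Or.inl rfl⟩, by simp only [hU, if_true]; exact hz⟩
    have hid : ∀ (k : {k : ℤ // k = 0 ∨ (N : ℤ) ≤ |k|}) x, Q k.1 (Q k.1 x) = Q k.1 x := by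
      intro k x
      exact DFunLike.congr_fun (hUR k).1 x
    have hkill : ∀ (j k : {k : ℤ // k = 0 ∨ (N : ℤ) ≤ |k|}), j ≠ k → ∀ x, Q j.1 (Q k.1 x) = 0 := by
      intro j k hjk x
      exact riesz_kill X.LA (hUR k) (hUR j) (hUf k) (hUf j) (hUd k j hjk.symm) x
    refine ⟨?_, ?_⟩
    · intro j k hj hk
      by_cases hjk : j = k
      · subst hjk
        rw [if_pos rfl]
        exact (hUR ⟨j, hj⟩).1
      · rw [if_neg hjk]
        ext x
        exact hkill ⟨j, hj⟩ ⟨k, hk⟩ (fun e => hjk (congrArg Subtype.val e)) x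
    · obtain ⟨C', hC', b1, b2⟩ := X.bessel hT hC hb hM X.LT
      have hQeq : ∀ k (hk : (N : ℤ) ≤ |k|), Q k = (X.d ⟨k, hk⟩).chain.proj (addC T C) := by
        intro k hk
        exact riesz_unique X.LA (hQ k hk) (hR ⟨k, hk⟩) (hfr ⟨k, hk⟩)
      -- a general summation device
      have gen : ∀ (f : ℤ → H → H) (c0 : ℝ), 0 ≤ c0 → (∀ x, ‖f 0 x‖ ≤ c0 * ‖x‖) →
          (∀ (F : Finset (KI N)) x, ∑ k ∈ F, ‖f k.1 x‖ ^ 2 ≤ C' * ‖x‖ ^ 2) →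
          ∀ (F : Finset {k : ℤ // k = 0 ∨ (N : ℤ) ≤ |k|}) x,
            ∑ k ∈ F, ‖f k.1 x‖ ^ 2 ≤ (c0 ^ 2 + C') * ‖x‖ ^ 2 := by
        intro f c0 hc0 h0 h1 F x
        classical
        have e1 : ∑ k ∈ F, ‖f k.1 x‖ ^ 2 = ∑ k ∈ F.map ⟨Subtype.val, Subtype.val_injective⟩, ‖f k x‖ ^ 2 := by
          rw [Finset.sum_map]; rfl
        rw [e1]
        set G := F.map ⟨Subtype.val, Subtype.val_injective⟩ with hG
        have hGm : ∀ k ∈ G, k = 0 ∨ (N : ℤ) ≤ |k| := by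
          intro k hk
          rw [hG, Finset.mem_map] at hk
          obtain ⟨a, _, rfl⟩ := hk
          exact a.2
        rw [← Finset.sum_filter_add_sum_filter_not G (fun k => (N : ℤ) ≤ |k|)]
        have e2 : ∑ k ∈ G.filter (fun k => (N : ℤ) ≤ |k|), ‖f k x‖ ^ 2 ≤ C' * ‖x‖ ^ 2 := by
          refine le_trans (le_of_eq ?_) (h1 (G.subtype (fun k => (N : ℤ) ≤ |k|)) x)
          rw [← Finset.subtype_map, Finset.sum_map]
          rfl
        have e3 : ∑ k ∈ G.filter (fun k => ¬ (N : ℤ) ≤ |k|), ‖f k x‖ ^ 2 ≤ c0 ^ 2 * ‖x‖ ^ 2 := by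
          calc ∑ k ∈ G.filter (fun k => ¬ (N : ℤ) ≤ |k|), ‖f k x‖ ^ 2
              ≤ ∑ k ∈ ({0} : Finset ℤ), ‖f k x‖ ^ 2 := by
                apply Finset.sum_le_sum_of_subset_of_nonneg
                · intro k hk
                  rw [Finset.mem_filter] at hk
                  rw [Finset.mem_singleton]
                  exact (hGm k hk.1).resolve_right hk.2
                · intros; positivity
            _ = ‖f 0 x‖ ^ 2 := Finset.sum_singleton _ _
            _ ≤ (c0 * ‖x‖) ^ 2 := by
                have := h0 x
                gcongr
            _ = _ := by ring
        linarith
      intro x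
      refine hasSum_of_bessel (Q := fun k : {k : ℤ // k = 0 ∨ (N : ℤ) ≤ |k|} => Q k.1)
        (C := ‖Q 0‖ ^ 2 + C') hid hkill ?_ ?_ ?_ x
      · refine gen (fun k x => Q k x) ‖Q 0‖ (norm_nonneg _) (fun x => (Q 0).le_opNorm x) ?_
        intro F x
        refine le_trans (le_of_eq ?_) (b1 F x)
        refine Finset.sum_congr rfl fun k _ => ?_
        rw [hQeq k.1 k.2]
      · refine gen (fun k x => ContinuousLinearMap.adjoint (Q k) x) ‖Q 0‖ (norm_nonneg _) (fun x => ?_) ?_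
        · have := (ContinuousLinearMap.adjoint (Q 0)).le_opNorm x
          rwa [LinearIsometryEquiv.norm_map] at this
        intro F x
        refine le_trans (le_of_eq ?_) (b2 F x)
        refine Finset.sum_congr rfl fun k _ => ?_
        rw [hQeq k.1 k.2]
      · intro v hv
        exact riesz_complete X.LA hUR hUf hUd hUc hv

end setup
end PM

namespace PM
open Filter Topology

lemma grow {r : ℤ → ℝ} {b₁ p : ℝ} (hb₁ : 0 < b₁) (hp0 : 0 ≤ p) (hp1 : p < 1)
    (hs : ∀ k, r k < r (k + 1)) (hg : ∀ k, b₁ * (|r k| ^ p + |r (k + 1)| ^ p) ≤ r (k + 1) - r k)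
    (R : ℝ) : ∃ n : ℕ, ∀ k : ℤ, (n : ℤ) ≤ k → R ≤ r k := by
  have hmono : StrictMono r := strictMono_int_of_lt_succ hs
  by_contra hcon
  push Not at hcon
  have hbd : ∀ k, r k ≤ R := by
    intro k
    obtain ⟨j, hj, hjR⟩ := hcon k.toNat
    exact (hmono.monotone (by omega : k ≤ j)).trans hjR.le
  set q : ℕ → ℝ := fun n => r n with hq
  have hqm : Monotone q := fun i j hij => hmono.monotone (by exact_mod_cast hij)
  have hstep : ∀ n : ℕ, q n + b₁ * |q n| ^ p ≤ q (n + 1) := by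
    intro n
    have := hg n
    have h0 : 0 ≤ |r ((n : ℤ) + 1)| ^ p := by positivity
    have e : q (n + 1) = r ((n : ℤ) + 1) := by simp [hq]
    rw [e]
    change r n + b₁ * |r n| ^ p ≤ _
    nlinarith
  obtain ⟨L, hL⟩ : ∃ L, Tendsto q atTop (𝓝 L) :=
    ⟨_, tendsto_atTop_ciSup hqm ⟨R, by rintro _ ⟨n, rfl⟩; exact hbd n⟩⟩
  have hcont : Tendsto (fun n => q n + b₁ * |q n| ^ p) atTop (𝓝 (L + b₁ * |L| ^ p)) := by
    have hc : Continuous fun x : ℝ => x + b₁ * |x| ^ p := continuous_id.add (cont_par b₁ hp0)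
    exact (hc.tendsto L).comp hL
  have hle : L + b₁ * |L| ^ p ≤ L :=
    le_of_tendsto_of_tendsto' hcont ((tendsto_add_atTop_iff_nat 1).2 hL) hstep
  have hz : |L| ^ p = 0 := by
    have : 0 ≤ |L| ^ p := by positivity
    nlinarith
  rw [Real.rpow_eq_zero_iff_of_nonneg (abs_nonneg L)] at hz
  have hL0 : L = 0 := abs_eq_zero.1 hz.1
  subst hL0
  have hneg : ∀ n, q n < 0 := by
    intro n
    have h1 : q n < q (n + 1) := by
      have := hs n
      simpa [hq] using this
    exact lt_of_lt_of_le h1 (hqm.ge_of_tendsto hL _)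
  have h3 : Tendsto (fun n => |q n| ^ (1 - p)) atTop (𝓝 0) := by
    have hc : Continuous fun x : ℝ => |x| ^ (1 - p) :=
      continuous_abs.rpow_const (fun x => Or.inr (by linarith))
    have := (hc.tendsto 0).comp hL
    rwa [abs_zero, Real.zero_rpow (by linarith)] at this
  obtain ⟨n, hn⟩ := (h3.eventually (gt_mem_nhds hb₁)).exists
  have hqn := hneg n
  have hpos : 0 < |q n| := by rw [abs_pos]; exact hqn.ne
  have hmul : |q n| = |q n| ^ (1 - p) * |q n| ^ p := by
    rw [← Real.rpow_add hpos]; simp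
  have h4 : 0 < |q n| ^ p := by positivity
  have h5 : |q n| < b₁ * |q n| ^ p := by
    calc |q n| = |q n| ^ (1 - p) * |q n| ^ p := hmul
      _ < _ := by gcongr
  have := hstep n
  have := hneg (n + 1)
  rw [abs_of_neg hqn] at h5
  rw [abs_of_neg hqn] at *
  linarith

lemma exists_large {p δ : ℝ} (hp1 : p < 1) : ∃ R1 : ℝ, 1 ≤ R1 ∧ ∀ x, R1 ≤ x → δ * x ^ p ≤ x / 2 := by
  have h : Tendsto (fun x : ℝ => x ^ (1 - p)) atTop atTop := tendsto_rpow_atTop (by linarith)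
  obtain ⟨R, hR⟩ := (h.eventually_ge_atTop (2 * δ)).exists_forall_of_atTop
  refine ⟨max R 1, le_max_right _ _, fun x hx => ?_⟩
  have hx1 : 1 ≤ x := (le_max_right _ _).trans hx
  have h1 := hR x ((le_max_left _ _).trans hx)
  have h0 : 0 < x ^ p := by positivity
  have hmul : x = x ^ (1 - p) * x ^ p := by
    rw [← Real.rpow_add (by linarith)]; simp
  nlinarith

theorem setup_exists {T : H →ₗ.[ℂ] H} {C : T.domain →ₗ[ℂ] H} {p b M h δ b₁ : ℝ} (hT : IsSA T)
    (hC : SubC T C p b M) (hb : 0 < b) (hM : 0 ≤ M) (hp0 : 0 ≤ p) (hp1 : p < 1)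
    (hpM : p = 0 → M = 0) (hh : b < h) (hδ : 0 < δ) (hδb : δ < b₁ - b) (m : ℕ) (r : ℤ → ℝ)
    (hs : ∀ k, r k < r (k + 1)) (hg : ∀ k, b₁ * (|r k| ^ p + |r (k + 1)| ^ p) ≤ r (k + 1) - r k)
    (hF : ∀ k, ∃ F : Finset ℝ, (∀ ν ∈ F, |ν - r k| < b₁ * |r k| ^ p) ∧
      (∀ l : ℝ, (l : ℂ) ∉ pmResolventSet T → |l - r k| < b₁ * |r k| ^ p → l ∈ F) ∧
      (∀ ν ∈ F, FiniteDimensional ℂ (pmEigenspace T (ν : ℂ))) ∧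
      (∑ ν ∈ F, Module.finrank ℂ (pmEigenspace T (ν : ℂ))) ≤ m) :
    ∃ N : ℕ, ∃ s : ℤ → ℝ, ∃ K c : ℝ, (∀ k, |s k - r k| ≤ δ * |r k| ^ p) ∧ Setup T C p h K c N s := by
  obtain ⟨K1, hK1, ρ0, hρ0, hout⟩ := outside hT hC hb hM hp0 hp1 hpM hh
  obtain ⟨K2, hK2, R0, hR0, hlin⟩ := lines hT hC hb hM hp0 hp1 hpM hh hδ hδb m
  have hb₁ : 0 < b₁ := by linarith
  have hex : ∀ k, ∃ x : ℝ, |x - r k| ≤ δ * |r k| ^ p ∧ (R0 ≤ |r k| → ∀ y : ℝ,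
      Good T C ((x : ℂ) + Complex.I * (y : ℂ)) K2 (|r k| ^ p)) := by
    intro k
    by_cases hk : R0 ≤ |r k|
    · obtain ⟨F, f1, f2, f3, f4⟩ := hF k
      obtain ⟨x, hx, hgood⟩ := hlin (r k) hk F f1 f2 f3 f4
      exact ⟨x, hx, fun _ => hgood⟩
    · exact ⟨r k, by rw [sub_self, abs_zero]; positivity, fun h => absurd h hk⟩
  choose s hsr hsg using hex
  obtain ⟨R1, hR1, hlarge⟩ := exists_large (p := p) (δ := δ) hp1
  set R2 := R0 + R1 + 2 + 2 * ρ0 with hR2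
  obtain ⟨n1, hn1⟩ := grow hb₁ hp0 hp1 hs hg R2
  obtain ⟨n2, hn2⟩ := grow (r := fun k => - r (-k)) hb₁ hp0 hp1 (by
      intro k
      have := hs (-(k + 1))
      rw [show -(k + 1) + 1 = -k by ring] at this
      simpa using this) (by
      intro k
      have := hg (-(k + 1))
      rw [show -(k + 1) + 1 = -k by ring] at this
      simp only [abs_neg]
      linarith) R2
  set N := n1 + n2 + 1 with hN
  set K := max K1 (2 * K2) with hK
  set c := min (min ((b₁ - δ) / 2) (1 / K)) 1 with hc
  have hKpos : 0 < K := lt_of_lt_of_le (by linarith) (le_max_left K1 (2 * K2))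
  have hpos : ∀ k : ℤ, (N : ℤ) - 1 ≤ k → R2 ≤ r k := fun k hk => hn1 k (by push_cast [hN] at hk; omega)
  have hneg : ∀ k : ℤ, k ≤ -(N : ℤ) → r k ≤ -R2 := by
    intro k hk
    have := hn2 (-k) (by push_cast [hN] at hk; omega)
    simp only [neg_neg] at this
    linarith
  have habs : ∀ k : ℤ, ((N : ℤ) - 1 ≤ k ∨ k ≤ -(N : ℤ)) → R2 ≤ |r k| := by
    rintro k (hk | hk)
    · exact (hpos k hk).trans (le_abs_self _)
    · exact (by linarith [hneg k hk] : R2 ≤ - r k).trans (neg_le_abs _)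
  have hhalf : ∀ k : ℤ, ((N : ℤ) - 1 ≤ k ∨ k ≤ -(N : ℤ)) → |s k - r k| ≤ |r k| / 2 := by
    intro k hk
    exact (hsr k).trans (hlarge _ (by linarith [habs k hk]))
  have hsp : ∀ k : ℤ, ((N : ℤ) - 1 ≤ k ∨ k ≤ -(N : ℤ)) → |s k| ^ p ≤ 2 * |r k| ^ p := by
    intro k hk
    have h1 := hhalf k hk
    have h2 : |s k| ≤ 2 * |r k| := by
      have : |s k| ≤ |s k - r k| + |r k| := by
        calc |s k| = |(s k - r k) + r k| := by congr 1; ring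
          _ ≤ _ := abs_add_le _ _
      linarith [abs_nonneg (r k)]
    exact (Real.rpow_le_rpow (abs_nonneg _) h2 hp0).trans (rpow_two_mul_le (abs_nonneg _) hp0 hp1)
  have hspos : ∀ k : ℤ, (N : ℤ) - 1 ≤ k → 1 + ρ0 ≤ s k := by
    intro k hk
    have h1 := hhalf k (Or.inl hk)
    have h2 := hpos k hk
    rw [abs_of_pos (by linarith : 0 < r k)] at h1
    have := (abs_le.1 h1).1
    linarith
  have hsneg : ∀ k : ℤ, k ≤ -(N : ℤ) → s k ≤ -(1 + ρ0) := by
    intro k hk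
    have h1 := hhalf k (Or.inr hk)
    have h2 := hneg k hk
    rw [abs_of_neg (by linarith : r k < 0)] at h1
    have := (abs_le.1 h1).2
    linarith
  have hc0 : 0 < c := by
    refine lt_min (lt_min ?_ ?_) one_pos
    · linarith
    · positivity
  refine ⟨N, s, K, c, hsr, ⟨?_, by omega, hK1.trans (le_max_left _ _), ?_, by linarith, hp0, hp1, ?_, ?_, ?_⟩⟩
  · refine ⟨hc0, min_le_right _ _, fun k hk => by linarith [hspos k hk], fun k hk => by linarith [hsneg k hk], ?_⟩
    intro k hk
    have hk1 : (N : ℤ) - 1 ≤ k ∨ k ≤ -(N : ℤ) := by rcases le_abs.1 hk with h | h <;> omega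
    have hk2 : (N : ℤ) - 1 ≤ k - 1 ∨ k - 1 ≤ -(N : ℤ) := by rcases le_abs.1 hk with h | h <;> omega
    have e1 := hsp k hk1
    have e2 := hsp (k - 1) hk2
    have e3 := hg (k - 1)
    rw [show k - 1 + 1 = k by ring] at e3
    have e4 := (abs_le.1 (hsr k)).1
    have e5 := (abs_le.1 (hsr (k - 1))).2
    have hcle : c ≤ (b₁ - δ) / 2 := (min_le_left _ _).trans (min_le_left _ _)
    have q1 : 0 ≤ |s k| ^ p := by positivity
    have q2 : 0 ≤ |s (k - 1)| ^ p := by positivity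
    calc c * (|s k| ^ p + |s (k - 1)| ^ p) ≤ (b₁ - δ) / 2 * (|s k| ^ p + |s (k - 1)| ^ p) := by gcongr
      _ ≤ (b₁ - δ) / 2 * (2 * |r k| ^ p + 2 * |r (k - 1)| ^ p) := by
          apply mul_le_mul_of_nonneg_left _ (by linarith)
          linarith
      _ ≤ _ := by linarith
  · calc c * K ≤ (1 / K) * K := by
          gcongr
          exact (min_le_left _ _).trans (min_le_right _ _)
      _ = 1 := by field_simp
  · intro k hk y
    have g := hsg k (by linarith [habs k hk]) y
    have hr0 : 0 < |r k| := by linarith [habs k hk]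
    have hs0 : 0 < |s k| := by
      rcases hk with h | h
      · exact abs_pos.2 (ne_of_gt (by linarith [hspos k h]))
      · exact abs_pos.2 (ne_of_lt (by linarith [hsneg k h]))
    have hK2K : 2 * K2 ≤ K := le_max_right _ _
    refine g.mono (by linarith) ?_
    rw [div_le_div_iff₀ (by positivity) (by positivity)]
    have := hsp k hk
    have q : 0 < |r k| ^ p := by positivity
    nlinarith
  · intro z hz him
    have hre : ρ0 ≤ |z.re| := by
      rcases hz with h | h
      · have := hspos _ (le_refl ((N : ℤ) - 1))
        exact (by linarith : ρ0 ≤ z.re).trans (le_abs_self _)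
      · have := hsneg _ (le_refl (-(N : ℤ)))
        exact (by linarith : ρ0 ≤ - z.re).trans (neg_le_abs _)
    refine ⟨|z.im|, (hout |z.re| hre z le_rfl him).mono (le_max_left _ _) ?_⟩
    gcongr
    exact le_max_left _ _
  · intro a' b'
    set ρ := max (max |a'| |b'|) ρ0 with hρ
    have hρ1 : ρ0 ≤ ρ := le_max_right _ _
    have hρp : 0 < ρ := by linarith
    refine ⟨h * ρ ^ p, mul_pos (by linarith) (by positivity), ?_⟩
    intro z h1 h2 h3
    have hre : |z.re| ≤ ρ := by
      have m1 : |a'| ≤ ρ := (le_max_left _ _).trans (le_max_left _ _)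
      have m2 : |b'| ≤ ρ := (le_max_right _ _).trans (le_max_left _ _)
      rw [abs_le] at m1 m2 ⊢
      constructor <;> linarith
    refine (hout ρ hρ1 z hre h3).mono (le_max_left _ _) ?_
    gcongr
    exact le_max_left _ _

end PM

/-- Theorem 2. Let `T` be self-adjoint with essential spectrum in the
pairwise disjoint intervals `Δ_k = [α_{2k−1}, α_{2k}]`, `k ∈ ℤ`, whose gaps
`Λ_k = (α_{2k}, α_{2k+1})` satisfy `α_{2k+1} − α_{2k} ≥ 2^{1−p} b₁ |α_{2k+1} + α_{2k}|^p`;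
outside the `Δ_k` the operator `T` has only discrete spectrum, each gap containing at most `m`
eigenvalues of `T` counted with multiplicity.  Let `B` be `p`-subordinate to `T` with
subordination bound `b' < b₁`, fix `h > b'` and `δ ∈ (0, b₁ − b')`, and let
`r_k = (α_{2k} + α_{2k+1})/2`.  Then there are `N ∈ ℕ` and reals `r'_k` with
`|r'_k − r_k| ≤ δ|r_k|^p` such that the boundaries of the curvilinear trapezoids `Π_k` contain
no spectrum of `A = T + B`, the Riesz projections `Q_k` of `A` for `Π_k` (`|k| ≥ N`) and `Q_0`
for the part of the spectrum outside all the `Π_k` exist, and the subspaces `Q_k(H)`,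
`|k| ≥ N`, together with `Q_0(H)` form an unconditional basis of subspaces of `H` (the family
is minimal and `Σ Q_k x` converges unconditionally to `x` for every `x ∈ H`). -/
theorem stmt1 (T B : H →ₗ.[ℂ] H) (p b₁ b' h : ℝ) (hp : p ∈ Set.Ico (0 : ℝ) 1) (hb₁ : 0 < b₁)
    (hsa : IsSelfAdjoint T) (α : ℤ → ℝ) (hmono : Monotone α)
    (hdisj : ∀ k l : ℤ, k ≠ l →
      Disjoint (Set.Icc (α (2 * k - 1)) (α (2 * k))) (Set.Icc (α (2 * l - 1)) (α (2 * l))))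
    (hgap : ∀ k : ℤ,
      (2 : ℝ) ^ (1 - p) * b₁ * |α (2 * k + 1) + α (2 * k)| ^ p ≤ α (2 * k + 1) - α (2 * k))
    (m : ℕ) (ev : ℤ → Finset ℝ)
    (hev : ∀ k : ℤ, (ev k : Set ℝ) ⊆ Set.Ioo (α (2 * k)) (α (2 * k + 1)))
    (hspec : pmSpectrum T ⊆
      (⋃ k : ℤ, Complex.ofReal '' Set.Icc (α (2 * k - 1)) (α (2 * k))) ∪
        ⋃ k : ℤ, Complex.ofReal '' (ev k : Set ℝ))
    (hfd : ∀ k : ℤ, ∀ ν ∈ ev k, FiniteDimensional ℂ (pmEigenspace T (ν : ℂ)))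
    (hm : ∀ k : ℤ, (∑ ν ∈ ev k, Module.finrank ℂ (pmEigenspace T (ν : ℂ))) ≤ m)
    (hle : T.domain ≤ B.domain) (hb' : IsGLB (SubordSet T B hle p) b') (hbb : b' < b₁)
    (hh : b' < h) (δ : ℝ) (hδ : 0 < δ) (hδ' : δ < b₁ - b') :
    ∃ N : ℕ, 0 < N ∧ ∃ r' : ℤ → ℝ,
      (∀ k : ℤ, |r' k - (α (2 * k) + α (2 * k + 1)) / 2| ≤
        δ * |(α (2 * k) + α (2 * k + 1)) / 2| ^ p) ∧
      (∀ k : ℤ, (N : ℤ) ≤ |k| →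
        ∀ z ∈ pmSpectrum (pmSum T B hle), z ∉ frontier (Trapezoid h p r' k)) ∧
      (∃ Q : ℤ → H →L[ℂ] H,
        IsRieszProjFor (pmSum T B hle)
          ((⋃ k ∈ {k : ℤ | (N : ℤ) ≤ |k|}, Trapezoid h p r' k)ᶜ) (Q 0) ∧
        ∀ k : ℤ, (N : ℤ) ≤ |k| →
          IsRieszProjFor (pmSum T B hle) (Trapezoid h p r' k) (Q k)) ∧
      ∀ Q : ℤ → H →L[ℂ] H,
        IsRieszProjFor (pmSum T B hle)
          ((⋃ k ∈ {k : ℤ | (N : ℤ) ≤ |k|}, Trapezoid h p r' k)ᶜ) (Q 0) →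
        (∀ k : ℤ, (N : ℤ) ≤ |k| →
          IsRieszProjFor (pmSum T B hle) (Trapezoid h p r' k) (Q k)) →
        (∀ j k : ℤ, (j = 0 ∨ (N : ℤ) ≤ |j|) → (k = 0 ∨ (N : ℤ) ≤ |k|) →
          (Q j).comp (Q k) = if j = k then Q j else 0) ∧
        ∀ x : H, HasSum (fun k : {k : ℤ // k = 0 ∨ (N : ℤ) ≤ |k|} => Q k.1 x) x := by
  obtain ⟨hp0, hp1⟩ := hp
  obtain ⟨b, ⟨hb, M, hM, hpM, hsub⟩, _, hblt⟩ := hb'.exists_between (show b' < min h (b₁ - δ) from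
    lt_min hh (by linarith))
  have hbh : b < h := hblt.trans_le (min_le_left _ _)
  have hδb : δ < b₁ - b := by linarith [hblt.trans_le (min_le_right h (b₁ - δ))]
  have hT : PM.IsSA T := by
    refine PM.isSA_of hsa fun z hz => ?_
    by_contra hc
    rcases hspec hc with h1 | h1 <;>
    · simp only [Set.mem_iUnion, Set.mem_image] at h1
      obtain ⟨_, x, _, rfl⟩ := h1
      exact hz (Complex.ofReal_im x)
  set r : ℤ → ℝ := fun k => (α (2 * k) + α (2 * k + 1)) / 2 with hr
  have hhalf : ∀ k, 2 * (b₁ * |r k| ^ p) ≤ α (2 * k + 1) - α (2 * k) := by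
    intro k
    refine le_trans (le_of_eq ?_) (hgap k)
    have e : α (2 * k + 1) + α (2 * k) = 2 * r k := by simp only [hr]; ring
    rw [e, abs_mul, abs_two, Real.mul_rpow (by norm_num) (abs_nonneg _)]
    have e2 : (2 : ℝ) ^ (1 - p) * 2 ^ p = 2 := by
      rw [← Real.rpow_add (by norm_num)]; simp
    calc 2 * (b₁ * |r k| ^ p) = ((2 : ℝ) ^ (1 - p) * 2 ^ p) * (b₁ * |r k| ^ p) := by rw [e2]
      _ = _ := by ring
  have hlo : ∀ k, α (2 * k) ≤ r k - b₁ * |r k| ^ p := by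
    intro k
    have := hhalf k
    simp only [hr] at this ⊢
    linarith
  have hhi : ∀ k, r k + b₁ * |r k| ^ p ≤ α (2 * k + 1) := by
    intro k
    have := hhalf k
    simp only [hr] at this ⊢
    linarith
  have hstep : ∀ k, α (2 * k + 1) ≤ α (2 * (k + 1)) := fun k => hmono (by omega)
  have hg : ∀ k, b₁ * (|r k| ^ p + |r (k + 1)| ^ p) ≤ r (k + 1) - r k := by
    intro k
    linarith [hlo (k + 1), hhi k, hstep k]
  have hs : ∀ k, r k < r (k + 1) := by
    intro k
    have h1 : α (2 * k) ≤ α (2 * k + 1) := hmono (by omega)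
    have h2 := hstep k
    have h3 : α (2 * (k + 1)) ≤ α (2 * (k + 1) + 1) := hmono (by omega)
    have h4 : α (2 * k) < α (2 * k + 1) := by
      refine lt_of_le_of_ne h1 fun e => ?_
      have hd := Set.disjoint_left.1 (hdisj k (k + 1) (by omega))
      refine hd (a := α (2 * k)) ⟨hmono (by omega), le_rfl⟩ ⟨?_, ?_⟩
      · rw [show 2 * (k + 1) - 1 = 2 * k + 1 by ring]
        exact e.ge
      · exact h1.trans h2
    simp only [hr]
    linarith
  have hF : ∀ k, ∃ F : Finset ℝ, (∀ ν ∈ F, |ν - r k| < b₁ * |r k| ^ p) ∧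
      (∀ l : ℝ, (l : ℂ) ∉ pmResolventSet T → |l - r k| < b₁ * |r k| ^ p → l ∈ F) ∧
      (∀ ν ∈ F, FiniteDimensional ℂ (pmEigenspace T (ν : ℂ))) ∧
      (∑ ν ∈ F, Module.finrank ℂ (pmEigenspace T (ν : ℂ))) ≤ m := by
    intro k
    classical
    refine ⟨(ev k).filter (fun ν => |ν - r k| < b₁ * |r k| ^ p), ?_, ?_, ?_, ?_⟩
    · intro ν hν
      exact (Finset.mem_filter.1 hν).2
    · intro l hl hlr
      refine Finset.mem_filter.2 ⟨?_, hlr⟩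
      have e := abs_lt.1 hlr
      have l1 : α (2 * k) < l := by linarith [hlo k, e.1]
      have l2 : l < α (2 * k + 1) := by linarith [hhi k, e.2]
      rcases hspec hl with h1 | h1
      · simp only [Set.mem_iUnion, Set.mem_image] at h1
        obtain ⟨j, x, hx, hxl⟩ := h1
        have hxl' : x = l := Complex.ofReal_injective hxl
        subst hxl'
        rcases le_or_gt j k with hjk | hjk
        · have : α (2 * j) ≤ α (2 * k) := hmono (by omega)
          linarith [hx.2]
        · have : α (2 * k + 1) ≤ α (2 * j - 1) := hmono (by omega)
          linarith [hx.1]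
      · simp only [Set.mem_iUnion, Set.mem_image] at h1
        obtain ⟨j, x, hx, hxl⟩ := h1
        have hxl' : x = l := Complex.ofReal_injective hxl
        subst hxl'
        have hxj := hev j hx
        rcases lt_trichotomy j k with hjk | hjk | hjk
        · have : α (2 * j + 1) ≤ α (2 * k) := hmono (by omega)
          linarith [hxj.2]
        · subst hjk
          exact hx
        · have : α (2 * k + 1) ≤ α (2 * j) := hmono (by omega)
          linarith [hxj.1]
    · intro ν hν
      exact hfd k ν (Finset.mem_filter.1 hν).1
    · exact (Finset.sum_le_sum_of_subset (Finset.filter_subset _ _)).trans (hm k)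
  have hC : PM.SubC T (B.toFun.comp (Submodule.inclusion hle)) p b M := fun x => hsub x
  obtain ⟨N, s, K, c, hsr, X⟩ := PM.setup_exists hT hC hb hM hp0 hp1 hpM hbh hδ hδb m r hs hg hF
  exact ⟨N, X.N0, s, hsr, X.final hT hC hb hM⟩
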